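/- Fix c ∈ ℝ and let m = m(n) = ⌊n(log n + c)⌋. Then the probability that D(n,m) contains a rainbow spanning arborescence converges, as n → ∞, to (1 + e^{−c}) · e^{−e^{−c}}. -/

import Mathlib

open Filter

/-- The directed edges of the complete digraph on `Fin n`:
ordered pairs `(tail, head)` of distinct vertices. -/
abbrev DEdge (n : ℕ) := {e : Fin n × Fin n // e.1 ≠ e.2}

/-- `ε(n) = log log n / log n`. -/
noncomputable def eps (n : ℕ) : ℝ := Real.log (Real.log n) / Real.log n

/-- The number of available colours: `⌊(1 + 50 ε) n⌋`. -/
noncomputable def numColours (n : ℕ) : ℕ := ⌊(1 + 50 * eps n) * n⌋₊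

/-- The set of colours `W`. -/
abbrev Colour (n : ℕ) := Fin (numColours n)

/-- The sample space of the coloured random digraph process: a uniformly random
permutation of the edges (determining the random ordering `e₁, …, e_N`) together
with a uniformly random colouring of the edges. -/
abbrev SampleSpace (n : ℕ) := Equiv.Perm (DEdge n) × (DEdge n → Colour n)

/-- The (0-indexed) position of edge `e` in the random ordering determined by `ω`. -/
noncomputable def edgePos {n : ℕ} (ω : SampleSpace n) (e : DEdge n) : ℕ :=
  ((Fintype.equivFin (DEdge n)) (ω.1 e)).val

/-- `e` is one of the first `m` edges of the process, i.e. an edge of `D(n,m)`. -/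
def inProcess {n : ℕ} (ω : SampleSpace n) (m : ℕ) (e : DEdge n) : Prop :=
  edgePos ω e < m

/-- The probability of an event under the uniform measure on a finite sample space. -/
noncomputable def prob {Ω : Type*} [Fintype Ω] (p : Ω → Prop) : ℝ :=
  (Nat.card {ω : Ω // p ω} : ℝ) / (Fintype.card Ω : ℝ)

/-- Vertex `v` has in-degree zero in `D(n,m)`. -/
def InDegreeZero {n : ℕ} (ω : SampleSpace n) (m : ℕ) (v : Fin n) : Prop :=
  ∀ e : DEdge n, inProcess ω m e → e.val.2 ≠ v

/-- The event `Z_m`: at most one vertex of `D(n,m)` has in-degree zero. -/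
def ZEvent {n : ℕ} (ω : SampleSpace n) (m : ℕ) : Prop :=
  Set.Subsingleton {v : Fin n | InDegreeZero ω m v}

/-- `A` is the edge set of a spanning arborescence rooted at `u`: the root has no
in-edge, every other vertex has exactly one in-edge, and every vertex is reachable
from the root along edges of `A` (equivalently, for every vertex `v` there is
exactly one directed path from `u` to `v`). -/
def IsSpanningArborescence {n : ℕ} (A : Set (DEdge n)) (u : Fin n) : Prop :=
  (∀ e ∈ A, (e : DEdge n).val.2 ≠ u) ∧
  (∀ v : Fin n, v ≠ u → ∃! e : DEdge n, e ∈ A ∧ e.val.2 = v) ∧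
  (∀ v : Fin n, Relation.ReflTransGen (fun x y => ∃ e ∈ A, (e : DEdge n).val = (x, y)) u v)

/-- The event `A_m`: `D(n,m)` contains a spanning arborescence. -/
def AEvent {n : ℕ} (ω : SampleSpace n) (m : ℕ) : Prop :=
  ∃ (u : Fin n) (A : Set (DEdge n)), (∀ e ∈ A, inProcess ω m e) ∧ IsSpanningArborescence A u

/-- The event `R_m`: `D(n,m)` contains a rainbow spanning arborescence. -/
def REvent {n : ℕ} (ω : SampleSpace n) (m : ℕ) : Prop :=
  ∃ (u : Fin n) (A : Set (DEdge n)), (∀ e ∈ A, inProcess ω m e) ∧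
    IsSpanningArborescence A u ∧ Set.InjOn ω.2 A

/-- The hitting time `min {m : P m}`, with the convention `min ∅ = N = n(n-1)`. -/
noncomputable def hitTime (n : ℕ) (P : ℕ → Prop) : ℕ :=
  sInf ({m | P m} ∪ {n * (n - 1)})

namespace RainbowArborescence

/-! ### Finite probability spaces -/

/-- The indicator of a proposition, as a real number. -/
noncomputable def ind (p : Prop) : ℝ := open Classical in if p then 1 else 0

theorem ind_of_true {p : Prop} (h : p) : ind p = 1 := by simp [ind, h]
theorem ind_of_false {p : Prop} (h : ¬p) : ind p = 0 := by simp [ind, h]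
theorem ind_nonneg (p : Prop) : 0 ≤ ind p := by unfold ind; split_ifs <;> norm_num
theorem ind_le_one (p : Prop) : ind p ≤ 1 := by unfold ind; split_ifs <;> norm_num

theorem ind_mono {p q : Prop} (h : p → q) : ind p ≤ ind q := by
  by_cases hp : p
  · rw [ind_of_true hp, ind_of_true (h hp)]
  · rw [ind_of_false hp]; exact ind_nonneg q

theorem ind_and (p q : Prop) : ind (p ∧ q) = ind p * ind q := by
  by_cases hp : p <;> by_cases hq : q <;> simp [ind, hp, hq]

theorem ind_not (p : Prop) : ind (¬p) = 1 - ind p := by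
  by_cases hp : p <;> simp [ind, hp]

theorem ind_or_le (p q : Prop) : ind (p ∨ q) ≤ ind p + ind q := by
  by_cases hp : p <;> by_cases hq : q <;> simp [ind, hp, hq]

theorem ind_forall {ι : Type*} [Fintype ι] (p : ι → Prop) : ind (∀ i, p i) = ∏ i, ind (p i) := by
  by_cases h : ∀ i, p i
  · rw [ind_of_true h, Finset.prod_eq_one fun i _ => ind_of_true (h i)]
  · rw [ind_of_false h]
    push Not at h
    obtain ⟨i, hi⟩ := h
    exact (Finset.prod_eq_zero (Finset.mem_univ i) (ind_of_false hi)).symm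

theorem ind_exists_le {ι : Type*} (s : Finset ι) (p : ι → Prop) :
    ind (∃ i ∈ s, p i) ≤ ∑ i ∈ s, ind (p i) := by
  by_cases h : ∃ i ∈ s, p i
  · obtain ⟨i, hi, hp⟩ := h
    calc ind _ ≤ 1 := ind_le_one _
      _ = ind (p i) := (ind_of_true hp).symm
      _ ≤ _ := Finset.single_le_sum (f := fun i => ind (p i)) (fun i _ => ind_nonneg _) hi
  · rw [ind_of_false h]; exact Finset.sum_nonneg fun i _ => ind_nonneg _

/-- `w` is a probability mass function on a finite type. -/
structure IsProb {Ω : Type*} [Fintype Ω] (w : Ω → ℝ) : Prop where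
  nonneg : ∀ ω, 0 ≤ w ω
  sum_one : ∑ ω, w ω = 1

/-- The expectation of `X` under the mass function `w`. -/
noncomputable def expect {Ω : Type*} [Fintype Ω] (w : Ω → ℝ) (X : Ω → ℝ) : ℝ := ∑ ω, w ω * X ω

/-- The probability of the event `A` under the mass function `w`. -/
noncomputable def pr {Ω : Type*} [Fintype Ω] (w : Ω → ℝ) (A : Ω → Prop) : ℝ :=
  expect w fun ω => ind (A ω)

section Basic

variable {Ω : Type*} [Fintype Ω] {w : Ω → ℝ}

theorem expect_mono (hw : IsProb w) {X Y : Ω → ℝ} (h : ∀ ω, X ω ≤ Y ω) :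
    expect w X ≤ expect w Y :=
  Finset.sum_le_sum fun ω _ => mul_le_mul_of_nonneg_left (h ω) (hw.nonneg ω)

theorem expect_add (X Y : Ω → ℝ) : expect w (fun ω => X ω + Y ω) = expect w X + expect w Y := by
  simp [expect, mul_add, Finset.sum_add_distrib]

theorem expect_sum {ι : Type*} (s : Finset ι) (X : ι → Ω → ℝ) :
    expect w (fun ω => ∑ i ∈ s, X i ω) = ∑ i ∈ s, expect w (X i) := by
  simp only [expect, Finset.mul_sum]; exact Finset.sum_comm

theorem expect_mul_const (X : Ω → ℝ) (c : ℝ) :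
    expect w (fun ω => X ω * c) = expect w X * c := by
  simp [expect, Finset.sum_mul, mul_assoc]

theorem expect_const_mul (X : Ω → ℝ) (c : ℝ) :
    expect w (fun ω => c * X ω) = c * expect w X := by
  simp only [expect, Finset.mul_sum]; exact Finset.sum_congr rfl fun _ _ => by ring

theorem expect_const (hw : IsProb w) (c : ℝ) : expect w (fun _ => c) = c := by
  simp [expect, ← Finset.sum_mul, hw.sum_one]

theorem expect_nonneg (hw : IsProb w) {X : Ω → ℝ} (h : ∀ ω, 0 ≤ X ω) : 0 ≤ expect w X :=
  Finset.sum_nonneg fun ω _ => mul_nonneg (hw.nonneg ω) (h ω)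

theorem pr_nonneg (hw : IsProb w) (A : Ω → Prop) : 0 ≤ pr w A :=
  expect_nonneg hw fun _ => ind_nonneg _

theorem pr_mono (hw : IsProb w) {A B : Ω → Prop} (h : ∀ ω, A ω → B ω) : pr w A ≤ pr w B :=
  expect_mono hw fun ω => ind_mono (h ω)

theorem pr_congr {A B : Ω → Prop} (h : ∀ ω, A ω ↔ B ω) : pr w A = pr w B := by
  have : A = B := funext fun ω => propext (h ω)
  rw [this]

theorem pr_le_one (hw : IsProb w) (A : Ω → Prop) : pr w A ≤ 1 := by
  calc pr w A ≤ expect w (fun _ => 1) := expect_mono hw fun _ => ind_le_one _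
    _ = 1 := expect_const hw 1

theorem pr_of_forall (hw : IsProb w) {A : Ω → Prop} (h : ∀ ω, A ω) : pr w A = 1 := by
  rw [pr, ← expect_const hw 1]; congr 1; funext ω; exact ind_of_true (h ω)

theorem pr_not (hw : IsProb w) (A : Ω → Prop) : pr w (fun ω => ¬A ω) = 1 - pr w A := by
  have h := pr_of_forall hw (A := fun _ => True) (fun _ => trivial)
  have : pr w (fun ω => ¬A ω) + pr w A = 1 := by
    rw [pr, pr, ← expect_add, ← expect_const hw 1]
    congr 1; funext ω; rw [ind_not]; ring
  linarith

theorem pr_or_le (hw : IsProb w) (A B : Ω → Prop) :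
    pr w (fun ω => A ω ∨ B ω) ≤ pr w A + pr w B := by
  rw [pr, pr, pr, ← expect_add]
  exact expect_mono hw fun ω => ind_or_le _ _

theorem pr_exists_le (hw : IsProb w) {ι : Type*} (s : Finset ι) (A : ι → Ω → Prop) :
    pr w (fun ω => ∃ i ∈ s, A i ω) ≤ ∑ i ∈ s, pr w (A i) := by
  unfold pr
  rw [← expect_sum]
  exact expect_mono hw fun ω => ind_exists_le _ _

theorem pr_le_add_of_imp (hw : IsProb w) {A B C : Ω → Prop} (h : ∀ ω, A ω → B ω ∨ C ω) :
    pr w A ≤ pr w B + pr w C :=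
  (pr_mono hw h).trans (pr_or_le hw B C)

theorem sum_pr_le_pr_of_disjoint (hw : IsProb w) {ι : Type*} (s : Finset ι) (A : ι → Ω → Prop)
    (B : Ω → Prop) (hAB : ∀ i ∈ s, ∀ ω, A i ω → B ω)
    (hdis : ∀ ω, ∀ i ∈ s, ∀ j ∈ s, A i ω → A j ω → i = j) : ∑ i ∈ s, pr w (A i) ≤ pr w B := by
  unfold pr
  rw [← expect_sum]
  refine expect_mono hw fun ω => ?_
  by_cases h : ∃ i ∈ s, A i ω
  · obtain ⟨i, hi, hA⟩ := h
    rw [Finset.sum_eq_single_of_mem i hi fun j hj hji =>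
      ind_of_false fun hj' => hji (hdis ω j hj i hi hj' hA)]
    exact ind_mono (hAB i hi ω)
  · push Not at h
    rw [Finset.sum_eq_zero fun i hi => ind_of_false (h i hi)]
    exact ind_nonneg _

/-- Markov's inequality. -/
theorem pr_le_expect_div (hw : IsProb w) {X : Ω → ℝ} (hX : ∀ ω, 0 ≤ X ω) {b : ℝ} (hb : 0 < b) :
    pr w (fun ω => b ≤ X ω) ≤ expect w X / b := by
  rw [le_div_iff₀ hb, pr, ← expect_mul_const]
  refine expect_mono hw fun ω => ?_
  by_cases h : b ≤ X ω
  · rw [ind_of_true h, one_mul]; exact h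
  · rw [ind_of_false h, zero_mul]; exact hX ω

end Basic

/-! ### Product distributions -/

/-- Use `f` on the coordinates satisfying `S` and `g` elsewhere. -/
noncomputable def merge {ι α : Type*} (S : ι → Prop) (f g : ι → α) : ι → α :=
  open Classical in fun i => if S i then f i else g i

theorem merge_of_mem {ι α : Type*} {S : ι → Prop} (f g : ι → α) {i : ι} (h : S i) :
    merge S f g i = f i := by
  simp [merge, h]

theorem merge_of_not_mem {ι α : Type*} {S : ι → Prop} (f g : ι → α) {i : ι} (h : ¬S i) :
    merge S f g i = g i := by
  simp [merge, h]

section Product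

variable {ι α : Type*} [Fintype ι] [DecidableEq ι] [Fintype α]

/-- The mass function of a family of independent random variables. -/
noncomputable def prodWeight (μ : ι → α → ℝ) (f : ι → α) : ℝ := ∏ i, μ i (f i)

theorem sum_prodWeight_mul_prod (μ X : ι → α → ℝ) :
    ∑ f, prodWeight μ f * ∏ i, X i (f i) = ∏ i, ∑ a, μ i a * X i a := by
  rw [Finset.prod_univ_sum, Fintype.piFinset_univ]
  exact Finset.sum_congr rfl fun f _ => Finset.prod_mul_distrib.symm

theorem isProb_prodWeight {μ : ι → α → ℝ} (hμ : ∀ i, IsProb (μ i)) : IsProb (prodWeight μ) where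
  nonneg f := Finset.prod_nonneg fun i _ => (hμ i).nonneg _
  sum_one := by
    have := sum_prodWeight_mul_prod μ fun _ _ => 1
    simpa [fun i => (hμ i).sum_one] using this

theorem pr_prodWeight_forall (μ : ι → α → ℝ) (A : ι → α → Prop) :
    pr (prodWeight μ) (fun f => ∀ i, A i (f i)) = ∏ i, pr (μ i) (A i) := by
  simp only [pr, expect, ind_forall]
  exact sum_prodWeight_mul_prod μ fun i a => ind (A i a)

/-- The probability of a conjunction of events on distinct coordinates. -/
theorem pr_prodWeight_cylinder {μ : ι → α → ℝ} (hμ : ∀ i, IsProb (μ i)) {κ : Type*} [Fintype κ]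
    (j : κ → ι) (hj : Function.Injective j) (A : κ → α → Prop) :
    pr (prodWeight μ) (fun f => ∀ k, A k (f (j k))) = ∏ k, pr (μ (j k)) (A k) := by
  have h1 : ∀ f : ι → α, (∀ k, A k (f (j k))) ↔ ∀ i, ∀ k, j k = i → A k (f i) := fun f =>
    ⟨fun h i k hk => hk ▸ h k, fun h k => h _ k rfl⟩
  rw [pr_congr h1, pr_prodWeight_forall μ fun i a => ∀ k, j k = i → A k a]
  classical
  rw [← Finset.prod_subset (Finset.subset_univ (Finset.univ.image j)), Finset.prod_image]
  · refine Finset.prod_congr rfl fun k _ => pr_congr fun a => ⟨fun h => h k rfl, ?_⟩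
    intro h k' hk'
    rwa [hj hk']
  · exact fun a _ b _ h => hj h
  · intro i _ hi
    refine pr_of_forall (hμ i) fun a k hk => absurd ?_ hi
    exact Finset.mem_image.2 ⟨k, Finset.mem_univ _, hk⟩

/-- Resampling: the coordinates in `S` may be drawn independently from the other ones. -/
theorem expect_merge {μ : ι → α → ℝ} (hμ : ∀ i, IsProb (μ i)) (S : ι → Prop)
    (X : (ι → α) → ℝ) :
    expect (prodWeight μ) X =
      expect (prodWeight μ) fun f => expect (prodWeight μ) fun g => X (merge S f g) := by
  have hinv : Function.Involutive
      (fun x : (ι → α) × (ι → α) => (merge S x.1 x.2, merge S x.2 x.1)) := by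
    rintro ⟨f, g⟩
    ext i <;> by_cases h : S i <;> simp [merge, h]
  have hw : ∀ f g : ι → α, prodWeight μ (merge S f g) * prodWeight μ (merge S g f) =
      prodWeight μ f * prodWeight μ g := by
    intro f g
    simp only [prodWeight, ← Finset.prod_mul_distrib]
    refine Finset.prod_congr rfl fun i _ => ?_
    by_cases h : S i <;> simp [merge, h, mul_comm]
  have h1 : expect (prodWeight μ) (fun f => expect (prodWeight μ) fun g => X (merge S f g)) =
      ∑ x : (ι → α) × (ι → α), prodWeight μ x.1 * prodWeight μ x.2 * X (merge S x.1 x.2) := by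
    rw [Fintype.sum_prod_type]
    simp only [expect, Finset.mul_sum, mul_assoc]
  have h2 : expect (prodWeight μ) X =
      ∑ x : (ι → α) × (ι → α), prodWeight μ x.1 * prodWeight μ x.2 * X x.1 := by
    rw [Fintype.sum_prod_type]
    refine Finset.sum_congr rfl fun f _ => ?_
    simp only
    rw [← Finset.sum_mul, ← Finset.mul_sum, (isProb_prodWeight hμ).sum_one, mul_one]
  rw [h1, h2, ← Equiv.sum_comp (hinv.toPerm _)]
  refine Finset.sum_congr rfl fun x _ => ?_
  simp only [Function.Involutive.coe_toPerm, hw]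

/-- Events determined by disjoint sets of coordinates are independent. -/
theorem pr_and_of_indep {μ : ι → α → ℝ} (hμ : ∀ i, IsProb (μ i)) (S : ι → Prop)
    (A B : (ι → α) → Prop) (hA : ∀ f g, A (merge S f g) ↔ A f)
    (hB : ∀ f g, B (merge S f g) ↔ B g) :
    pr (prodWeight μ) (fun f => A f ∧ B f) = pr (prodWeight μ) A * pr (prodWeight μ) B := by
  rw [pr, expect_merge hμ S]
  simp only [hA, hB, ind_and, expect_const_mul, expect_mul_const]
  rfl

/-- Marginals: a subfamily of an independent family. -/
theorem expect_comp_injective {μ : ι → α → ℝ} (hμ : ∀ i, IsProb (μ i)) {κ : Type*} [Fintype κ]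
    [DecidableEq κ] (j : κ → ι) (hj : Function.Injective j) (X : (κ → α) → ℝ) :
    expect (prodWeight μ) (fun f => X (f ∘ j)) = expect (prodWeight fun k => μ (j k)) X := by
  classical
  have h : ∀ g : κ → α, prodWeight (fun k => μ (j k)) g =
      pr (prodWeight μ) fun f => f ∘ j = g := by
    intro g
    have : ∀ f : ι → α, f ∘ j = g ↔ ∀ k, f (j k) = g k := fun f => funext_iff
    rw [pr_congr this, pr_prodWeight_cylinder hμ j hj fun k a => a = g k]
    refine Finset.prod_congr rfl fun k _ => ?_
    simp [pr, expect, ind]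
  simp only [expect, h, pr, Finset.sum_mul]
  rw [Finset.sum_comm]
  refine Finset.sum_congr rfl fun f _ => ?_
  simp [ind]

/-- Images of independent random variables. -/
theorem expect_map {β : Type*} [Fintype β] [DecidableEq β] (μ : ι → α → ℝ) (F : α → β)
    (X : (ι → β) → ℝ) :
    expect (prodWeight μ) (fun f => X (fun i => F (f i))) =
      expect (prodWeight fun i b => pr (μ i) fun a => F a = b) X := by
  have h : ∀ g : ι → β, prodWeight (fun i b => pr (μ i) fun a => F a = b) g =
      pr (prodWeight μ) fun f => (fun i => F (f i)) = g := by
    intro g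
    have : ∀ f : ι → α, (fun i => F (f i)) = g ↔ ∀ i, F (f i) = g i := fun f => funext_iff
    rw [pr_congr this, pr_prodWeight_forall μ fun i a => F a = g i]
    rfl
  unfold expect
  simp only [h]
  simp only [pr, expect, Finset.sum_mul]
  rw [Finset.sum_comm]
  refine Finset.sum_congr rfl fun f _ => ?_
  simp [ind]

/-- Grouping coordinates into blocks. -/
theorem expect_curry {κ : Type*} [Fintype κ] [DecidableEq κ] (μ : ι × κ → α → ℝ)
    (X : (ι → κ → α) → ℝ) :
    expect (prodWeight μ) (fun f => X fun i k => f (i, k)) =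
      expect (prodWeight fun i => prodWeight fun k => μ (i, k)) X := by
  unfold expect
  rw [← Equiv.sum_comp (Equiv.curry ι κ α)]
  refine Finset.sum_congr rfl fun f _ => ?_
  simp only [prodWeight, Fintype.prod_prod_type]
  rfl

/-- Reindexing coordinates. -/
theorem expect_reindex {κ : Type*} [Fintype κ] [DecidableEq κ] (e : κ ≃ ι) (μ : ι → α → ℝ)
    (X : (κ → α) → ℝ) :
    expect (prodWeight μ) (fun f => X (f ∘ e)) = expect (prodWeight fun k => μ (e k)) X := by
  unfold expect
  rw [← Equiv.sum_comp (e.arrowCongr (Equiv.refl α)).symm]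
  refine Finset.sum_congr rfl fun f _ => ?_
  have h : prodWeight (fun k => μ (e k)) ((e.arrowCongr (Equiv.refl α)).symm f) =
      prodWeight μ f := by
    simp only [prodWeight]
    rw [← Equiv.prod_comp e]
    rfl
  rw [h]
  rfl

/-- Families of independent pairs with independent components. -/
theorem expect_pairs {β : Type*} [Fintype β] (μ : ι → α → ℝ) (ν : ι → β → ℝ)
    (X : (ι → α × β) → ℝ) :
    expect (prodWeight fun i x => μ i x.1 * ν i x.2) X =
      expect (prodWeight μ) fun f => expect (prodWeight ν) fun g => X fun i => (f i, g i) := by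
  have h1 : expect (prodWeight μ) (fun f => expect (prodWeight ν) fun g =>
      X fun i => (f i, g i)) = ∑ x : (ι → α) × (ι → β), prodWeight μ x.1 * prodWeight ν x.2 *
        X fun i => (x.1 i, x.2 i) := by
    rw [Fintype.sum_prod_type]
    simp only [expect, Finset.mul_sum, mul_assoc]
  rw [h1, ← Equiv.sum_comp (Equiv.arrowProdEquivProdArrow ι (fun _ => α) (fun _ => β))]
  refine Finset.sum_congr rfl fun f _ => ?_
  simp only [prodWeight, Finset.prod_mul_distrib]
  rfl

end Product

/-! ### Bernoulli and uniform variables -/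

/-- The Bernoulli mass function. -/
noncomputable def bern (p : ℝ) (b : Bool) : ℝ := if b then p else 1 - p

theorem isProb_bern {p : ℝ} (h0 : 0 ≤ p) (h1 : p ≤ 1) : IsProb (bern p) where
  nonneg b := by cases b <;> simp [bern] <;> linarith
  sum_one := by simp [bern]

theorem pr_bern_true (p : ℝ) : pr (bern p) (fun b => b = true) = p := by
  simp [pr, expect, bern, ind]

theorem pr_bern_false (p : ℝ) : pr (bern p) (fun b => b = false) = 1 - p := by
  simp [pr, expect, bern, ind]

/-- The uniform mass function. -/
noncomputable def unif (α : Type*) [Fintype α] (_ : α) : ℝ := (Fintype.card α : ℝ)⁻¹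

theorem isProb_unif (α : Type*) [Fintype α] [Nonempty α] : IsProb (unif α) where
  nonneg _ := by simp [unif]
  sum_one := by simp [unif]

theorem pr_unif_eq {α : Type*} [Fintype α] (a : α) :
    pr (unif α) (fun b => b = a) = (Fintype.card α : ℝ)⁻¹ := by
  classical
  simp [pr, expect, unif, ind]

/-- The probability that all coordinates in `S` are present and all those in `T` are absent. -/
theorem pr_bern_present_absent {ι : Type*} [Fintype ι] [DecidableEq ι] {p : ℝ} (h0 : 0 ≤ p)
    (h1 : p ≤ 1) (S T : Finset ι) (hST : Disjoint S T) :
    pr (prodWeight fun _ : ι => bern p) (fun f => (∀ i ∈ S, f i = true) ∧ ∀ i ∈ T, f i = false) =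
      p ^ S.card * (1 - p) ^ T.card := by
  have h : ∀ f : ι → Bool, ((∀ i ∈ S, f i = true) ∧ ∀ i ∈ T, f i = false) ↔
      ∀ i, (i ∈ S → f i = true) ∧ (i ∈ T → f i = false) := fun f => by
    constructor
    · rintro ⟨h, h'⟩ i; exact ⟨h i, h' i⟩
    · intro h; exact ⟨fun i => (h i).1, fun i => (h i).2⟩
  rw [pr_congr h, pr_prodWeight_forall (fun _ => bern p)
    fun i b => (i ∈ S → b = true) ∧ (i ∈ T → b = false)]
  have h2 : ∀ i, pr (bern p) (fun b => (i ∈ S → b = true) ∧ (i ∈ T → b = false)) =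
      (if i ∈ S then p else 1) * (if i ∈ T then 1 - p else 1) := by
    intro i
    by_cases hS : i ∈ S
    · have hT : i ∉ T := fun hT => Finset.disjoint_left.1 hST hS hT
      simp [hS, hT, pr_bern_true]
    · by_cases hT : i ∈ T
      · have := pr_bern_false p
        simpa [hS, hT] using this
      · simp only [hS, hT, if_false, mul_one]
        exact pr_of_forall (isProb_bern h0 h1) fun b => by simp
  simp only [h2, Finset.prod_mul_distrib, Finset.prod_ite_mem, Finset.univ_inter,
    Finset.prod_const]

theorem pr_bern_absent {ι : Type*} [Fintype ι] [DecidableEq ι] {p : ℝ} (h0 : 0 ≤ p)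
    (h1 : p ≤ 1) (T : Finset ι) :
    pr (prodWeight fun _ : ι => bern p) (fun f => ∀ i ∈ T, f i = false) = (1 - p) ^ T.card := by
  simpa using pr_bern_present_absent h0 h1 ∅ T (Finset.disjoint_empty_left T)

/-! ### Comparing product measures block by block -/

section Coupling

variable {ι α : Type*} [Fintype ι] [DecidableEq ι] [Fintype α]

theorem expect_prodWeight_update {μ : ι → α → ℝ} (i : ι) (hμ : IsProb (μ i)) (ν : α → ℝ)
    (X : (ι → α) → ℝ) :
    expect (prodWeight (Function.update μ i ν)) X =
      expect (prodWeight μ) fun f => expect ν fun a => X (Function.update f i a) := by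
  have hinv : Function.Involutive
      (fun x : (ι → α) × α => (Function.update x.1 i x.2, x.1 i)) := by
    rintro ⟨f, a⟩
    simp
  have hw : ∀ (f : ι → α) (a : α), prodWeight μ f * ν a =
      prodWeight (Function.update μ i ν) (Function.update f i a) * μ i (f i) := by
    intro f a
    simp only [prodWeight]
    rw [← Finset.mul_prod_erase _ _ (Finset.mem_univ i),
      ← Finset.mul_prod_erase Finset.univ
        (fun j => Function.update μ i ν j (Function.update f i a j)) (Finset.mem_univ i),
      Finset.prod_congr rfl fun j hj => ?_]
    rotate_left
    · exact fun j => Function.update μ i ν j (Function.update f i a j)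
    · simp [Function.update_of_ne (Finset.ne_of_mem_erase hj)]
    · simp only [Function.update_self]
      ring
  have h1 : expect (prodWeight μ) (fun f => expect ν fun a => X (Function.update f i a)) =
      ∑ x : (ι → α) × α, prodWeight μ x.1 * ν x.2 * X (Function.update x.1 i x.2) := by
    rw [Fintype.sum_prod_type]
    simp only [expect, Finset.mul_sum, mul_assoc]
  have h2 : expect (prodWeight (Function.update μ i ν)) X =
      ∑ x : (ι → α) × α, prodWeight (Function.update μ i ν) x.1 * μ i x.2 * X x.1 := by
    rw [Fintype.sum_prod_type]
    refine Finset.sum_congr rfl fun f _ => ?_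
    simp only
    rw [← Finset.sum_mul, ← Finset.mul_sum, hμ.sum_one, mul_one]
  rw [h1, h2, ← Equiv.sum_comp (hinv.toPerm _)]
  refine Finset.sum_congr rfl fun x _ => ?_
  simp only [Function.Involutive.coe_toPerm, ← hw]

/-- The law of one coordinate. -/
theorem expect_coord {μ : ι → α → ℝ} (hμ : ∀ i, IsProb (μ i)) (i : ι) (X : α → ℝ) :
    expect (prodWeight μ) (fun f => X (f i)) = expect (μ i) X := by
  have h := expect_prodWeight_update i (hμ i) (μ i) fun f : ι → α => X (f i)
  rw [Function.update_eq_self] at h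
  rw [h]
  simp only [Function.update_self]
  exact expect_const (isProb_prodWeight hμ) _

/-- If `R` is certified by using at most one element of each block, and each block of `μ` is at
least as likely as that of `ν` to hit any given set, then `R` is more likely under `μ`. -/
theorem pr_le_pr_of_block_certificate {X : Type*} [Fintype X] [DecidableEq X]
    {μ ν : ι → (X → Bool) → ℝ}
    (hμ : ∀ i, IsProb (μ i)) (hν : ∀ i, IsProb (ν i))
    (h : ∀ i (G : Finset X), pr (ν i) (fun a => ∃ x ∈ G, a x = true) ≤
      pr (μ i) (fun a => ∃ x ∈ G, a x = true))
    (R : (ι → X → Bool) → Prop) (ok : (ι → Option X) → Prop)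
    (hR : ∀ f, R f ↔ ∃ c, ok c ∧ ∀ i x, c i = some x → f i x = true) :
    pr (prodWeight ν) R ≤ pr (prodWeight μ) R := by
  classical
  have key : ∀ s : Finset ι, pr (prodWeight ν) R ≤
      pr (prodWeight fun i => if i ∈ s then μ i else ν i) R := by
    intro s
    induction s using Finset.induction_on with
    | empty => simp
    | insert i s hi ih =>
      refine ih.trans ?_
      set ξ : ι → (X → Bool) → ℝ := fun j => if j ∈ s then μ j else ν j with hξ
      have hξp : ∀ j, IsProb (ξ j) := fun j => by
        by_cases hj : j ∈ s
        · simpa [hξ, hj] using hμ j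
        · simpa [hξ, hj] using hν j
      have hup : (fun j => if j ∈ insert i s then μ j else ν j) = Function.update ξ i (μ i) := by
        funext j
        by_cases hj : j = i
        · subst hj; simp
        · simp [hj, hξ]
      have hξi : Function.update ξ i (ν i) = ξ := by
        have : ν i = ξ i := by simp [hξ, hi]
        rw [this, Function.update_eq_self]
      have e1 := expect_prodWeight_update i (hξp i) (ν i) fun f => ind (R f)
      have e2 := expect_prodWeight_update i (hξp i) (μ i) fun f => ind (R f)
      rw [hξi] at e1
      rw [hup]
      unfold pr
      rw [e1, e2]
      refine expect_mono (isProb_prodWeight hξp) fun f => ?_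
      change pr (ν i) (fun a => R (Function.update f i a)) ≤
        pr (μ i) (fun a => R (Function.update f i a))
      by_cases h0 : ∃ c, ok c ∧ c i = none ∧ ∀ j, j ≠ i → ∀ x, c j = some x → f j x = true
      · obtain ⟨c, hc, hci, hcf⟩ := h0
        have : ∀ a, R (Function.update f i a) := fun a => by
          rw [hR]
          refine ⟨c, hc, fun j x hx => ?_⟩
          by_cases hj : j = i
          · subst hj; rw [hci] at hx; cases hx
          · rw [Function.update_of_ne hj]; exact hcf j hj x hx
        rw [pr_of_forall (hν i) this, pr_of_forall (hμ i) this]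
      · set G : Finset X := Finset.univ.filter fun x =>
          ∃ c, ok c ∧ c i = some x ∧ ∀ j, j ≠ i → ∀ y, c j = some y → f j y = true with hG
        have : ∀ a, R (Function.update f i a) ↔ ∃ x ∈ G, a x = true := fun a => by
          rw [hR]
          constructor
          · rintro ⟨c, hc, hcf⟩
            have hoff : ∀ j, j ≠ i → ∀ y, c j = some y → f j y = true := fun j hj y hy => by
              have := hcf j y hy
              rwa [Function.update_of_ne hj] at this
            cases hci : c i with
            | none => exact absurd ⟨c, hc, hci, hoff⟩ h0
            | some x =>
              refine ⟨x, ?_, ?_⟩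
              · simp only [hG, Finset.mem_filter, Finset.mem_univ, true_and]
                exact ⟨c, hc, hci, hoff⟩
              · have := hcf i x hci
                rwa [Function.update_self] at this
          · rintro ⟨x, hx, hax⟩
            simp only [hG, Finset.mem_filter, Finset.mem_univ, true_and] at hx
            obtain ⟨c, hc, hci, hoff⟩ := hx
            refine ⟨c, hc, fun j y hy => ?_⟩
            by_cases hj : j = i
            · subst hj
              rw [hci] at hy
              cases hy
              rwa [Function.update_self]
            · rw [Function.update_of_ne hj]; exact hoff j hj y hy
        rw [pr_congr this, pr_congr this]
        exact h i G
  simpa using key Finset.univ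

end Coupling

/-! ### Rainbow forests below a set of available roots -/

/-- Following `par` from `v` leads to `Λ`. -/
def Reach {V : Type*} (par : V → V) (Λ : Finset V) (v : V) : Prop := ∃ i, par^[i] v ∈ Λ

/-- The coloured digraph `E` contains a rainbow forest, avoiding the colours in `C`, in which the
roots are in `Λ` and every vertex outside `A ∪ Λ` is a non-root. -/
def Good {V W : Type*} (E : V → V → W → Prop) (A Λ : Finset V) (C : Finset W) : Prop :=
  ∃ (par : V → V) (col : V → W),
    (∀ v, v ∉ A → v ∉ Λ → E (par v) v (col v) ∧ par v ∉ A ∧ col v ∉ C ∧ Reach par Λ v) ∧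
    ∀ v v', v ∉ A → v ∉ Λ → v' ∉ A → v' ∉ Λ → col v = col v' → v = v'

section Reach

variable {V : Type*}

theorem Reach.of_mem {par : V → V} {Λ : Finset V} {v : V} (h : v ∈ Λ) : Reach par Λ v := ⟨0, h⟩

theorem Reach.step {par : V → V} {Λ : Finset V} {v : V} (h : Reach par Λ (par v)) :
    Reach par Λ v := by
  obtain ⟨i, hi⟩ := h
  exact ⟨i + 1, by rwa [Function.iterate_succ_apply]⟩

theorem Reach.par {par : V → V} {Λ : Finset V} {v : V} (h : Reach par Λ v) (hv : v ∉ Λ) :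
    Reach par Λ (par v) := by
  obtain ⟨i, hi⟩ := h
  cases i with
  | zero => exact absurd hi hv
  | succ i => exact ⟨i, by rwa [Function.iterate_succ_apply] at hi⟩

/-- Induction along the path from `v` to `Λ`. -/
theorem Reach.induction {par : V → V} {Λ : Finset V} {P : V → Prop}
    (h0 : ∀ v ∈ Λ, P v) (h1 : ∀ v, v ∉ Λ → Reach par Λ v → P (par v) → P v) {v : V}
    (h : Reach par Λ v) : P v := by
  obtain ⟨i, hi⟩ := h
  induction i generalizing v with
  | zero => exact h0 v hi
  | succ i ih =>
    rw [Function.iterate_succ_apply] at hi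
    by_cases hv : v ∈ Λ
    · exact h0 v hv
    · exact h1 v hv (Reach.step ⟨i, hi⟩) (ih hi)

end Reach

theorem pr_bern_exists {X : Type*} [Fintype X] [DecidableEq X] {p : ℝ} (h0 : 0 ≤ p)
    (h1 : p ≤ 1) (G : Finset X) :
    pr (prodWeight fun _ : X => bern p) (fun a => ∃ x ∈ G, a x = true) =
      1 - (1 - p) ^ G.card := by
  have h := pr_not (isProb_prodWeight fun _ : X => isProb_bern h0 h1) fun a => ∀ x ∈ G, a x = false
  rw [pr_bern_absent h0 h1] at h
  rw [← h]
  exact pr_congr fun a => by simp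

/-- The indicator function of a random element `y.2`, present if and only if `y.1` holds. -/
def slot {X : Type*} [DecidableEq X] (y : Bool × X) : X → Bool := fun x => y.1 && decide (y.2 = x)

theorem isProb_slot {X : Type*} [Fintype X] [Nonempty X] {p : ℝ} (h0 : 0 ≤ p) (h1 : p ≤ 1) :
    IsProb (fun y : Bool × X => bern p y.1 * unif X y.2) where
  nonneg y := mul_nonneg ((isProb_bern h0 h1).nonneg _) ((isProb_unif X).nonneg _)
  sum_one := by
    rw [Fintype.sum_prod_type]
    simp only [← Finset.mul_sum, (isProb_unif X).sum_one, mul_one, (isProb_bern h0 h1).sum_one]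

theorem pr_slot_exists {X : Type*} [Fintype X] [DecidableEq X] {p : ℝ} (G : Finset X) :
    pr (fun y : Bool × X => bern p y.1 * unif X y.2) (fun y => ∃ x ∈ G, slot y x = true) =
      p * (G.card / Fintype.card X) := by
  have h : ∀ y : Bool × X, (∃ x ∈ G, slot y x = true) ↔ (y.1 = true ∧ y.2 ∈ G) := by
    rintro ⟨b, x⟩
    simp only [slot, Bool.and_eq_true, decide_eq_true_eq]
    constructor
    · rintro ⟨_, hx, hb, rfl⟩; exact ⟨hb, hx⟩
    · rintro ⟨hb, hx⟩; exact ⟨x, hx, hb, rfl⟩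
  rw [pr_congr h, pr, expect, Fintype.sum_prod_type]
  simp [bern, ind, unif]
  ring

/-- The law of a random indicator function with at most one element. -/
noncomputable def slotLaw (X : Type*) [Fintype X] [DecidableEq X] (p : ℝ) (b : X → Bool) : ℝ :=
  pr (fun y : Bool × X => bern p y.1 * unif X y.2) fun y => slot y = b

theorem pr_slotLaw {X : Type*} [Fintype X] [DecidableEq X] (p : ℝ) (A : (X → Bool) → Prop) :
    pr (slotLaw X p) A = pr (fun y : Bool × X => bern p y.1 * unif X y.2) fun y => A (slot y) := by
  classical
  unfold pr expect
  simp only [slotLaw, pr, expect, Finset.sum_mul]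
  rw [Finset.sum_comm]
  refine Finset.sum_congr rfl fun y _ => ?_
  rw [Finset.sum_eq_single (slot y)]
  · simp [ind]
  · intro b _ hb
    rw [ind_of_false (Ne.symm hb)]; simp
  · simp

theorem isProb_slotLaw {X : Type*} [Fintype X] [DecidableEq X] [Nonempty X] {p : ℝ} (h0 : 0 ≤ p)
    (h1 : p ≤ 1) : IsProb (slotLaw X p) where
  nonneg b := pr_nonneg (isProb_slot h0 h1) _
  sum_one := by
    have h := pr_slotLaw (X := X) p fun _ => True
    rw [pr_of_forall (isProb_slot h0 h1) fun _ => trivial] at h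
    rw [← h, pr, expect]
    exact Finset.sum_congr rfl fun b _ => by rw [ind_of_true trivial, mul_one]

section Slot

variable {ι X : Type*} [Fintype ι] [DecidableEq ι] [Fintype X] [DecidableEq X]

theorem pr_prodWeight_slotLaw (p : ℝ) (R : (ι → X → Prop) → Prop) :
    pr (prodWeight fun _ : ι => slotLaw X p) (fun f => R fun i x => f i x = true) =
      pr (prodWeight fun _ : ι => fun y : Bool × X => bern p y.1 * unif X y.2)
        (fun y => R fun i x => (y i).1 = true ∧ (y i).2 = x) := by
  have e := expect_map (fun _ : ι => fun y : Bool × X => bern p y.1 * unif X y.2) slot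
    fun f : ι → X → Bool => ind (R fun i x => f i x = true)
  refine e.symm.trans ?_
  simp only [slot, Bool.and_eq_true, decide_eq_true_eq]
  rfl

theorem pr_prodWeight_blocks (ρ : ℝ) (R : (ι → X → Prop) → Prop) :
    pr (prodWeight fun _ : ι => prodWeight fun _ : X => bern ρ)
        (fun f => R fun i x => f i x = true) =
      pr (prodWeight fun _ : ι × X => bern ρ) (fun F => R fun i x => F (i, x) = true) :=
  (expect_curry (fun _ : ι × X => bern ρ)
    fun f : ι → X → Bool => ind (R fun i x => f i x = true)).symm

/-- Replacing blocks of independent Bernoulli variables by blocks with at most one element. -/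
theorem pr_bern_le_slot [Nonempty X] {p ρ : ℝ} (hp0 : 0 ≤ p) (hp1 : p ≤ 1) (hρ0 : 0 ≤ ρ)
    (hρ1 : ρ ≤ 1) (R : (ι → X → Prop) → Prop)
    (hmono : ∀ E E', (∀ i x, E i x → E' i x) → R E → R E')
    (hR : ∀ E, R E → ∃ c : ι → Option X, R (fun i x => c i = some x) ∧
      ∀ i x, c i = some x → E i x)
    (h : ∀ g ≤ Fintype.card X, 1 - (1 - ρ) ^ g ≤ p * (g / Fintype.card X)) :
    pr (prodWeight fun _ : ι × X => bern ρ) (fun F => R fun i x => F (i, x) = true) ≤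
      pr (prodWeight fun _ : ι => fun y : Bool × X => bern p y.1 * unif X y.2)
        (fun y => R fun i x => (y i).1 = true ∧ (y i).2 = x) := by
  rw [← pr_prodWeight_slotLaw, ← pr_prodWeight_blocks]
  refine pr_le_pr_of_block_certificate (fun _ => isProb_slotLaw hp0 hp1)
    (fun _ => isProb_prodWeight fun _ => isProb_bern hρ0 hρ1) (fun _ G => ?_) _
    (fun c => R fun i x => c i = some x) (fun f => ⟨hR _, ?_⟩)
  · rw [pr_bern_exists hρ0 hρ1, pr_slotLaw, pr_slot_exists]
    exact h _ (Finset.card_le_univ G)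
  · rintro ⟨c, hc, hcf⟩
    exact hmono _ _ hcf hc

/-- Replacing blocks with at most one element by blocks of independent Bernoulli variables. -/
theorem pr_slot_le_bern [Nonempty X] {p ρ : ℝ} (hp0 : 0 ≤ p) (hp1 : p ≤ 1) (hρ0 : 0 ≤ ρ)
    (hρ1 : ρ ≤ 1) (R : (ι → X → Prop) → Prop)
    (hmono : ∀ E E', (∀ i x, E i x → E' i x) → R E → R E')
    (hR : ∀ E, R E → ∃ c : ι → Option X, R (fun i x => c i = some x) ∧
      ∀ i x, c i = some x → E i x)
    (h : ∀ g ≤ Fintype.card X, p * (g / Fintype.card X) ≤ 1 - (1 - ρ) ^ g) :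
    pr (prodWeight fun _ : ι => fun y : Bool × X => bern p y.1 * unif X y.2)
        (fun y => R fun i x => (y i).1 = true ∧ (y i).2 = x) ≤
      pr (prodWeight fun _ : ι × X => bern ρ) (fun F => R fun i x => F (i, x) = true) := by
  rw [← pr_prodWeight_slotLaw, ← pr_prodWeight_blocks]
  refine pr_le_pr_of_block_certificate (fun _ => isProb_prodWeight fun _ => isProb_bern hρ0 hρ1)
    (fun _ => isProb_slotLaw hp0 hp1) (fun _ G => ?_) _
    (fun c => R fun i x => c i = some x) (fun f => ⟨hR _, ?_⟩)
  · rw [pr_bern_exists hρ0 hρ1, pr_slotLaw, pr_slot_exists]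
    exact h _ (Finset.card_le_univ G)
  · rintro ⟨c, hc, hcf⟩
    exact hmono _ _ hcf hc

end Slot

/-- Concavity of `g ↦ 1 - (1 - ρ) ^ g`. -/
theorem mul_div_le_one_sub_pow {ρ : ℝ} (hρ0 : 0 ≤ ρ) (hρ1 : ρ ≤ 1) {g d : ℕ} (hgd : g ≤ d)
    (hd : 0 < d) : (1 - (1 - ρ) ^ d) * (g / d) ≤ 1 - (1 - ρ) ^ g := by
  have hd' : (0 : ℝ) < d := by exact_mod_cast hd
  rw [← mul_div_assoc, div_le_iff₀ hd']
  set y := 1 - ρ with hy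
  have hy0 : 0 ≤ y := by linarith
  have hy1 : y ≤ 1 := by linarith
  have hs : ∀ k : ℕ, 1 - y ^ k = (1 - y) * ∑ i ∈ Finset.range k, y ^ i := fun k =>
    (mul_neg_geom_sum y k).symm
  rw [hs d, hs g, mul_assoc, mul_assoc]
  refine mul_le_mul_of_nonneg_left ?_ (by linarith)
  obtain ⟨r, rfl⟩ := Nat.exists_eq_add_of_le hgd
  rw [Finset.sum_range_add]
  have h1 : (g : ℝ) * y ^ g ≤ ∑ i ∈ Finset.range g, y ^ i := by
    have := Finset.card_nsmul_le_sum (Finset.range g) (fun i => y ^ i) (y ^ g) fun i hi =>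
      pow_le_pow_of_le_one hy0 hy1 (Finset.mem_range.1 hi).le
    simpa using this
  have h2 : ∑ i ∈ Finset.range r, y ^ (g + i) ≤ r * y ^ g := by
    have := Finset.sum_le_card_nsmul (Finset.range r) (fun i => y ^ (g + i)) (y ^ g) fun i _ =>
      pow_le_pow_of_le_one hy0 hy1 (Nat.le_add_right _ _)
    simpa using this
  have h3 := mul_le_mul_of_nonneg_left h2 (Nat.cast_nonneg g)
  have h4 := mul_le_mul_of_nonneg_left h1 (Nat.cast_nonneg r)
  push_cast
  linarith

section Good

variable {V W : Type*}

theorem Good.mono {E E' : V → V → W → Prop} {A Λ : Finset V} {C : Finset W}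
    (h : ∀ t v w, t ∉ A → v ∉ A → v ∉ Λ → w ∉ C → E t v w → E' t v w) (hE : Good E A Λ C) :
    Good E' A Λ C := by
  obtain ⟨par, col, h1, h2⟩ := hE
  refine ⟨par, col, fun v hA hΛ => ?_, h2⟩
  obtain ⟨a, b, c, d⟩ := h1 v hA hΛ
  exact ⟨h _ _ _ b hA hΛ c a, b, c, d⟩

variable [DecidableEq V] [DecidableEq W]

/-- One colour per edge is more favourable than independent coloured edges. -/
theorem pr_good_le_single [Fintype V] [Fintype W] [Nonempty W] {p ρ : ℝ} (hp0 : 0 ≤ p)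
    (hp1 : p ≤ 1) (hρ0 : 0 ≤ ρ) (hρ1 : ρ ≤ 1) (hpρ : ρ * Fintype.card W ≤ p)
    (A Λ : Finset V) (C : Finset W) :
    pr (prodWeight fun _ : (V × V) × W => bern ρ)
        (fun F => Good (fun t v w => F ((t, v), w) = true) A Λ C) ≤
      pr (prodWeight fun _ : V × V => fun y : Bool × W => bern p y.1 * unif W y.2)
        (fun y => Good (fun t v w => (y (t, v)).1 = true ∧ (y (t, v)).2 = w) A Λ C) := by
  refine pr_bern_le_slot hp0 hp1 hρ0 hρ1
    (fun E : V × V → W → Prop => Good (fun t v w => E (t, v) w) A Λ C)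
    (fun E E' h => Good.mono fun t v w _ _ _ _ => h _ _) ?_ (fun g _ => ?_)
  · rintro E ⟨par, col, h1, h2⟩
    refine ⟨fun i => if i.1 = par i.2 ∧ i.2 ∉ A ∧ i.2 ∉ Λ then some (col i.2) else none,
      ⟨par, col, fun v hA hΛ => ?_, h2⟩, ?_⟩
    · exact ⟨by simp [hA, hΛ], (h1 v hA hΛ).2⟩
    · rintro ⟨t, v⟩ w hw
      simp only at hw
      split_ifs at hw with hc
      obtain ⟨rfl, hA, hΛ⟩ := hc
      simp only [Option.some.injEq] at hw
      subst hw
      exact (h1 v hA hΛ).1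
  · have hb := one_add_mul_le_pow (a := -ρ) (by linarith) g
    have hW : (0 : ℝ) < Fintype.card W := by exact_mod_cast Fintype.card_pos
    have h2 : ρ ≤ p / Fintype.card W := by rwa [le_div_iff₀ hW]
    have h3 : (g : ℝ) * ρ ≤ g * (p / Fintype.card W) :=
      mul_le_mul_of_nonneg_left h2 (Nat.cast_nonneg _)
    have h4 : p * ((g : ℝ) / Fintype.card W) = g * (p / Fintype.card W) := by ring
    rw [← sub_eq_add_neg] at hb
    linarith

/-- Drawing a single uniform tail in `Aᶜ` for each pair of a head and a colour is more favourable
than independent coloured edges. -/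
theorem pr_good_le_tails [Fintype V] [Fintype W] {ρ : ℝ} (hρ0 : 0 ≤ ρ) (hρ1 : ρ ≤ 1)
    (A Λ : Finset V) (C : Finset W) [Nonempty {t // t ∉ A}] {d : ℕ}
    (hd : Fintype.card {t // t ∉ A} = d) :
    pr (prodWeight fun _ : V × W => fun y : Bool × {t // t ∉ A} =>
          bern (1 - (1 - ρ) ^ d) y.1 * unif {t // t ∉ A} y.2)
        (fun y => Good (fun t v w => (y (v, w)).1 = true ∧ ((y (v, w)).2 : V) = t) A Λ C) ≤
      pr (prodWeight fun _ : (V × V) × W => bern ρ)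
        (fun F => Good (fun t v w => F ((t, v), w) = true) A Λ C) := by
  have hd0 : 0 < d := hd ▸ Fintype.card_pos
  have hpow : (1 - ρ) ^ d ≤ 1 := pow_le_one₀ (by linarith) (by linarith)
  have hpow0 : 0 ≤ (1 - ρ) ^ d := pow_nonneg (by linarith) _
  have h1 := pr_slot_le_bern (p := 1 - (1 - ρ) ^ d) (by linarith) (by linarith) hρ0 hρ1
    (fun E : V × W → {t // t ∉ A} → Prop => Good (fun t v w => ∃ x, E (v, w) x ∧ x.1 = t) A Λ C)
    (fun E E' h => Good.mono fun t v w _ _ _ _ ⟨x, hx, hxt⟩ => ⟨x, h _ _ hx, hxt⟩) ?_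
    (fun g hg => by rw [hd] at hg ⊢; exact mul_div_le_one_sub_pow hρ0 hρ1 hg hd0)
  · have h2 := expect_comp_injective (μ := fun _ : (V × V) × W => bern ρ)
      (fun _ => isProb_bern hρ0 hρ1) (κ := (V × W) × {t // t ∉ A})
      (fun i => ((i.2.1, i.1.1), i.1.2))
      (by rintro ⟨⟨v, w⟩, t, ht⟩ ⟨⟨v', w'⟩, t', ht'⟩ h; simp_all)
      (fun F => ind (Good (fun t v w => ∃ x, F ((v, w), x) = true ∧ x.1 = t) A Λ C))
    refine le_trans (le_of_eq (pr_congr fun y => ?_)) (h1.trans (h2.symm.le.trans ?_))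
    · have : (fun (t v : V) (w : W) => (y (v, w)).1 = true ∧ ((y (v, w)).2 : V) = t) =
          fun t v w => ∃ x, ((y (v, w)).1 = true ∧ (y (v, w)).2 = x) ∧ x.1 = t := by
        funext t v w
        simp only [eq_iff_iff]
        constructor
        · rintro ⟨a, b⟩; exact ⟨_, ⟨a, rfl⟩, b⟩
        · rintro ⟨_, ⟨a, rfl⟩, b⟩; exact ⟨a, b⟩
      rw [this]
    · refine pr_mono (isProb_prodWeight fun _ => isProb_bern hρ0 hρ1) fun F => ?_
      refine Good.mono fun t v w _ _ _ _ => ?_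
      rintro ⟨x, hx, rfl⟩
      exact hx
  · rintro E ⟨par, col, h1, h2⟩
    refine ⟨fun i => if h : (i.1 ∉ A ∧ i.1 ∉ Λ) ∧ i.2 = col i.1 then
      some ⟨par i.1, (h1 i.1 h.1.1 h.1.2).2.1⟩ else none, ⟨par, col, fun v hA hΛ => ?_, h2⟩, ?_⟩
    · exact ⟨⟨⟨par v, (h1 v hA hΛ).2.1⟩, by simp [hA, hΛ], rfl⟩, (h1 v hA hΛ).2⟩
    · rintro ⟨v, w⟩ x hx
      simp only at hx
      split_ifs at hx with hc
      obtain ⟨⟨hA, hΛ⟩, rfl⟩ := hc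
      simp only [Option.some.injEq] at hx
      subst hx
      obtain ⟨y, hy, hyp⟩ := (h1 v hA hΛ).1
      have : y = ⟨par v, (h1 v hA hΛ).2.1⟩ := Subtype.ext hyp
      rwa [← this]

end Good

/-! ### Growing a set of available roots -/

section Caterpillar

variable {V W : Type*} [DecidableEq V] [DecidableEq W]

theorem Good.of_two_children {E : V → V → W → Prop} {A Λ : Finset V} {C : Finset W} {x y₁ y₂ : V}
    {w₁ w₂ : W} (hxΛ : x ∈ Λ) (hxA : x ∉ A) (hy : y₁ ≠ y₂) (hw : w₁ ≠ w₂) (hw₁ : w₁ ∉ C)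
    (hw₂ : w₂ ∉ C) (h₁ : E x y₁ w₁) (h₂ : E x y₂ w₂) (hy₁ : y₁ ∉ A) (hy₂ : y₂ ∉ A)
    (hyΛ₁ : y₁ ∉ Λ) (hyΛ₂ : y₂ ∉ Λ)
    (h : Good E (insert x A) (insert y₁ (insert y₂ (Λ.erase x))) (insert w₁ (insert w₂ C))) :
    Good E A Λ C := by
  obtain ⟨par, col, h1, h2⟩ := h
  set par' : V → V := fun v => if v = y₁ ∨ v = y₂ then x else par v with hpar'
  set col' : V → W := fun v => if v = y₁ then w₁ else if v = y₂ then w₂ else col v with hcol'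
  have p1 : par' y₁ = x := by simp [hpar']
  have p2 : par' y₂ = x := by simp [hpar']
  have p3 : ∀ v, v ≠ y₁ → v ≠ y₂ → par' v = par v := fun v a b => by simp [hpar', a, b]
  have c1 : col' y₁ = w₁ := by simp [hcol']
  have c2 : col' y₂ = w₂ := by simp [hcol', hy.symm]
  have c3 : ∀ v, v ≠ y₁ → v ≠ y₂ → col' v = col v := fun v a b => by simp [hcol', a, b]
  have hout : ∀ v, v ∉ A → v ∉ Λ → v ≠ y₁ → v ≠ y₂ →
      v ∉ insert x A ∧ v ∉ insert y₁ (insert y₂ (Λ.erase x)) := fun v a b c d => by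
    refine ⟨?_, by simp [b, c, d]⟩
    have : v ≠ x := fun e => b (e ▸ hxΛ)
    simp [this, a]
  have hr1 : Reach par' Λ y₁ := Reach.step (by rw [p1]; exact Reach.of_mem hxΛ)
  have hr2 : Reach par' Λ y₂ := Reach.step (by rw [p2]; exact Reach.of_mem hxΛ)
  refine ⟨par', col', fun v hA hΛ => ?_, fun v v' hA hΛ hA' hΛ' hc => ?_⟩
  · by_cases e1 : v = y₁
    · subst e1; rw [p1, c1]; exact ⟨h₁, hxA, hw₁, hr1⟩
    by_cases e2 : v = y₂
    · subst e2; rw [p2, c2]; exact ⟨h₂, hxA, hw₂, hr2⟩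
    obtain ⟨i1, i2⟩ := hout v hA hΛ e1 e2
    obtain ⟨a, b, c, d⟩ := h1 v i1 i2
    rw [p3 v e1 e2, c3 v e1 e2]
    refine ⟨a, fun h => b (Finset.mem_insert_of_mem h), fun h => c (by simp [h]), ?_⟩
    refine d.induction (fun u hu => ?_) fun u _ _ hu => ?_
    · simp only [Finset.mem_insert, Finset.mem_erase] at hu
      rcases hu with rfl | rfl | hu
      exacts [hr1, hr2, Reach.of_mem hu.2]
    · by_cases f1 : u = y₁
      · rwa [f1]
      by_cases f2 : u = y₂
      · rwa [f2]
      exact Reach.step (by rwa [p3 u f1 f2])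
  · have hcc : ∀ u, u ∉ A → u ∉ Λ → u ≠ y₁ → u ≠ y₂ → col u ≠ w₁ ∧ col u ≠ w₂ :=
      fun u a b c d => by
        obtain ⟨i1, i2⟩ := hout u a b c d
        have := (h1 u i1 i2).2.2.1
        simp only [Finset.mem_insert, not_or] at this
        exact ⟨this.1, this.2.1⟩
    by_cases e1 : v = y₁
    · subst e1
      by_cases f1 : v' = v
      · exact f1.symm
      rw [c1] at hc
      by_cases f2 : v' = y₂
      · subst f2; rw [c2] at hc; exact absurd hc hw
      rw [c3 v' f1 f2] at hc
      exact absurd hc.symm (hcc v' hA' hΛ' f1 f2).1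
    by_cases e2 : v = y₂
    · subst e2
      rw [c2] at hc
      by_cases f1 : v' = y₁
      · subst f1; rw [c1] at hc; exact absurd hc.symm hw
      by_cases f2 : v' = v
      · exact f2.symm
      rw [c3 v' f1 f2] at hc
      exact absurd hc.symm (hcc v' hA' hΛ' f1 f2).2
    rw [c3 v e1 e2] at hc
    by_cases f1 : v' = y₁
    · subst f1; rw [c1] at hc; exact absurd hc (hcc v hA hΛ e1 e2).1
    by_cases f2 : v' = y₂
    · subst f2; rw [c2] at hc; exact absurd hc (hcc v hA hΛ e1 e2).2
    rw [c3 v' f1 f2] at hc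
    obtain ⟨i1, i2⟩ := hout v hA hΛ e1 e2
    obtain ⟨j1, j2⟩ := hout v' hA' hΛ' f1 f2
    exact h2 v v' i1 i2 j1 j2 hc

/-- Two disjoint elements of a random bipartite graph exist with high probability. -/
theorem pr_no_two_disjoint_le [Fintype V] [Fintype W] {ρ : ℝ} (hρ0 : 0 ≤ ρ) (hρ1 : ρ ≤ 1) (x : V)
    (Y : Finset V) (W' : Finset W) :
    pr (prodWeight fun _ : (V × V) × W => bern ρ)
      (fun F => ¬∃ y₁ ∈ Y, ∃ y₂ ∈ Y, ∃ w₁ ∈ W', ∃ w₂ ∈ W', y₁ ≠ y₂ ∧ w₁ ≠ w₂ ∧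
        F ((x, y₁), w₁) = true ∧ F ((x, y₂), w₂) = true) ≤
      (1 + Y.card * W'.card * ρ) * (1 - ρ) ^ ((Y.card - 1) * (W'.card - 1)) := by
  set μ := prodWeight fun _ : (V × V) × W => bern ρ with hμ
  have hp : IsProb μ := isProb_prodWeight fun _ => isProb_bern hρ0 hρ1
  have hinj : Function.Injective (fun i : V × W => ((x, i.1), i.2)) := by
    rintro ⟨a, b⟩ ⟨a', b'⟩ h; simp_all
  set T : V × W → Finset ((V × V) × W) := fun i =>
    ((Y.erase i.1) ×ˢ (W'.erase i.2)).image fun j => ((x, j.1), j.2) with hT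
  have h1 : pr μ (fun F => ¬∃ y₁ ∈ Y, ∃ y₂ ∈ Y, ∃ w₁ ∈ W', ∃ w₂ ∈ W', y₁ ≠ y₂ ∧ w₁ ≠ w₂ ∧
        F ((x, y₁), w₁) = true ∧ F ((x, y₂), w₂) = true) ≤
      pr μ (fun F => ∀ i ∈ (Y ×ˢ W').image fun j => ((x, j.1), j.2), F i = false) +
      pr μ (fun F => ∃ i ∈ Y ×ˢ W', (∀ j ∈ ({((x, i.1), i.2)} : Finset _), F j = true) ∧
        ∀ j ∈ T i, F j = false) := by
    refine pr_le_add_of_imp hp fun F hF => ?_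
    by_cases h : ∃ i ∈ Y ×ˢ W', F ((x, i.1), i.2) = true
    · right
      obtain ⟨i, hi, hFi⟩ := h
      refine ⟨i, hi, by simpa using hFi, ?_⟩
      intro j hj
      simp only [hT, Finset.mem_image, Finset.mem_product, Finset.mem_erase] at hj
      obtain ⟨⟨y, w⟩, ⟨⟨a, b⟩, c, d⟩, rfl⟩ := hj
      rw [Finset.mem_product] at hi
      rw [← Bool.not_eq_true]
      intro hh
      exact hF ⟨i.1, hi.1, y, b, i.2, hi.2, w, d, Ne.symm a, Ne.symm c, hFi, hh⟩
    · left
      push Not at h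
      intro j hj
      simp only [Finset.mem_image] at hj
      obtain ⟨i, hi, rfl⟩ := hj
      simpa using h i hi
  refine h1.trans ?_
  have h2 := pr_exists_le hp (Y ×ˢ W') fun i F =>
    (∀ j ∈ ({((x, i.1), i.2)} : Finset ((V × V) × W)), F j = true) ∧ ∀ j ∈ T i, F j = false
  have h3 : ∀ i ∈ Y ×ˢ W', pr μ (fun F => (∀ j ∈ ({((x, i.1), i.2)} : Finset ((V × V) × W)),
      F j = true) ∧ ∀ j ∈ T i, F j = false) =
      ρ * (1 - ρ) ^ ((Y.card - 1) * (W'.card - 1)) := by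
    intro i hi
    rw [Finset.mem_product] at hi
    rw [hμ, pr_bern_present_absent hρ0 hρ1, Finset.card_singleton, pow_one, hT,
      Finset.card_image_of_injective _ hinj, Finset.card_product, Finset.card_erase_of_mem hi.1,
      Finset.card_erase_of_mem hi.2]
    simp only [Finset.disjoint_singleton_left, hT, Finset.mem_image, not_exists, not_and]
    rintro ⟨a, b⟩ hab h
    simp only [Prod.mk.injEq, true_and] at h
    simp [h.1] at hab
  rw [Finset.sum_congr rfl h3, Finset.sum_const, Finset.card_product, nsmul_eq_mul] at h2
  have h4 : pr μ (fun F => ∀ i ∈ (Y ×ˢ W').image fun j => ((x, j.1), j.2), F i = false) ≤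
      (1 - ρ) ^ ((Y.card - 1) * (W'.card - 1)) := by
    rw [hμ, pr_bern_absent hρ0 hρ1, Finset.card_image_of_injective _ hinj, Finset.card_product]
    exact pow_le_pow_of_le_one (by linarith) (by linarith)
      (Nat.mul_le_mul (Nat.sub_le _ _) (Nat.sub_le _ _))
  push_cast at h2
  calc _ ≤ _ := add_le_add h4 h2
    _ = _ := by ring

/-- The probability of `Good` for independent coloured edges. -/
noncomputable def goodProb [Fintype V] [Fintype W] (ρ : ℝ) (A Λ : Finset V) (C : Finset W) : ℝ :=
  pr (prodWeight fun _ : (V × V) × W => bern ρ)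
    fun F => Good (fun t v w => F ((t, v), w) = true) A Λ C

theorem goodProb_step [Fintype V] [Fintype W] {ρ : ℝ} (hρ0 : 0 ≤ ρ) (hρ1 : ρ ≤ 1)
    {A Λ : Finset V} {C : Finset W} {x : V} (hxΛ : x ∈ Λ) (hxA : x ∉ A) {b : ℝ} (hb0 : 0 ≤ b)
    (hb : ∀ y₁ y₂ w₁ w₂, y₁ ≠ y₂ → w₁ ≠ w₂ → y₁ ∉ A ∪ Λ → y₂ ∉ A ∪ Λ → w₁ ∉ C → w₂ ∉ C →
      b ≤ goodProb ρ (insert x A) (insert y₁ (insert y₂ (Λ.erase x))) (insert w₁ (insert w₂ C))) :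
    (1 - (1 + (A ∪ Λ)ᶜ.card * Cᶜ.card * ρ) *
      (1 - ρ) ^ (((A ∪ Λ)ᶜ.card - 1) * (Cᶜ.card - 1))) * b ≤ goodProb ρ A Λ C := by
  have hμ : ∀ i : (V × V) × W, IsProb (bern ρ) := fun _ => isProb_bern hρ0 hρ1
  have h0 := pr_no_two_disjoint_le hρ0 hρ1 x (A ∪ Λ)ᶜ Cᶜ
  rw [pr_not (isProb_prodWeight hμ)] at h0
  refine le_trans (mul_le_mul_of_nonneg_right (sub_le_comm.1 h0) hb0) ?_
  rw [goodProb]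
  unfold pr
  rw [← expect_mul_const, expect_merge hμ (fun i => i.1.1 = x) (fun F => ind (Good _ A Λ C))]
  refine expect_mono (isProb_prodWeight hμ) fun f => ?_
  by_cases h : ∃ y₁ ∈ (A ∪ Λ)ᶜ, ∃ y₂ ∈ (A ∪ Λ)ᶜ, ∃ w₁ ∈ Cᶜ, ∃ w₂ ∈ Cᶜ, y₁ ≠ y₂ ∧ w₁ ≠ w₂ ∧
        f ((x, y₁), w₁) = true ∧ f ((x, y₂), w₂) = true
  · rw [ind_of_true h, one_mul]
    obtain ⟨y₁, hy₁, y₂, hy₂, w₁, hw₁, w₂, hw₂, hy, hw, h₁, h₂⟩ := h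
    simp only [Finset.mem_compl] at hy₁ hy₂ hw₁ hw₂
    refine (hb y₁ y₂ w₁ w₂ hy hw hy₁ hy₂ hw₁ hw₂).trans ?_
    refine pr_mono (isProb_prodWeight hμ) fun g hg => ?_
    simp only [Finset.mem_union, not_or] at hy₁ hy₂
    refine Good.of_two_children hxΛ hxA hy hw hw₁ hw₂ ?_ ?_ hy₁.1 hy₂.1 hy₁.2 hy₂.2
      (hg.mono fun t v w ht _ _ _ htvw => ?_)
    · rwa [merge_of_mem (S := fun i : (V × V) × W => i.1.1 = x) f g rfl]
    · rwa [merge_of_mem (S := fun i : (V × V) × W => i.1.1 = x) f g rfl]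
    · rwa [merge_of_not_mem]
      rintro rfl
      exact ht (Finset.mem_insert_self _ _)
  · rw [ind_of_false h, zero_mul]
    exact expect_nonneg (isProb_prodWeight hμ) fun g => ind_nonneg _

/-- Starting from a single root, `k` steps create `k + 1` available roots. -/
theorem goodProb_singleton_ge [Fintype V] [Fintype W] {ρ : ℝ} (hρ0 : 0 ≤ ρ) (hρ1 : ρ ≤ 1) (k : ℕ)
    {b : ℝ} (hb0 : 0 ≤ b)
    (hη : (1 + Fintype.card V * Fintype.card W * ρ) *
      (1 - ρ) ^ ((Fintype.card V - 2 * k) * (Fintype.card W - 2 * k)) ≤ 1)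
    (hb : ∀ (A Λ : Finset V) (C : Finset W), Disjoint A Λ → A.card = k → Λ.card = k + 1 →
      C.card = 2 * k → b ≤ goodProb ρ A Λ C) (u : V) :
    (1 - (1 + Fintype.card V * Fintype.card W * ρ) *
      (1 - ρ) ^ ((Fintype.card V - 2 * k) * (Fintype.card W - 2 * k))) ^ k * b ≤
        goodProb ρ ∅ {u} (∅ : Finset W) := by
  set η := (1 + Fintype.card V * Fintype.card W * ρ) *
      (1 - ρ) ^ ((Fintype.card V - 2 * k) * (Fintype.card W - 2 * k)) with hηdef
  have key : ∀ j ≤ k, ∀ (A Λ : Finset V) (C : Finset W), Disjoint A Λ → A.card = k - j →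
      Λ.card = k - j + 1 → C.card = 2 * (k - j) → (1 - η) ^ j * b ≤ goodProb ρ A Λ C := by
    intro j
    induction j with
    | zero =>
      intro _ A Λ C h1 h2 h3 h4
      simpa using hb A Λ C h1 h2 h3 h4
    | succ j ih =>
      intro hj A Λ C hdis hA hΛ hC
      obtain ⟨x, hx⟩ : Λ.Nonempty := Finset.card_pos.1 (by omega)
      have hxA : x ∉ A := Finset.disjoint_right.1 hdis hx
      have hb' : 0 ≤ (1 - η) ^ j * b := mul_nonneg (pow_nonneg (by linarith) _) hb0
      refine le_trans ?_ (goodProb_step hρ0 hρ1 hx hxA hb' ?_)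
      · rw [pow_succ', mul_assoc]
        refine mul_le_mul_of_nonneg_right ?_ hb'
        have hY : (A ∪ Λ)ᶜ.card = Fintype.card V - (2 * (k - (j + 1)) + 1) := by
          rw [Finset.card_compl, Finset.card_union_of_disjoint hdis]; congr 1; omega
        have hW : Cᶜ.card = Fintype.card W - 2 * (k - (j + 1)) := by
          rw [Finset.card_compl, hC]
        refine sub_le_sub_left ?_ _
        rw [hηdef]
        have hpow : (1 - ρ) ^ (((A ∪ Λ)ᶜ.card - 1) * (Cᶜ.card - 1)) ≤
            (1 - ρ) ^ ((Fintype.card V - 2 * k) * (Fintype.card W - 2 * k)) := by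
          refine pow_le_pow_of_le_one (by linarith) (by linarith) (Nat.mul_le_mul ?_ ?_) <;> omega
        have hYV : ((A ∪ Λ)ᶜ.card : ℝ) ≤ Fintype.card V := by exact_mod_cast Finset.card_le_univ _
        have hWW : (Cᶜ.card : ℝ) ≤ Fintype.card W := by exact_mod_cast Finset.card_le_univ _
        have h1ρ : 0 ≤ 1 - ρ := by linarith
        gcongr
      · intro y₁ y₂ w₁ w₂ hy hw hy₁ hy₂ hw₁ hw₂
        simp only [Finset.mem_union, not_or] at hy₁ hy₂
        have hxy₁ : x ≠ y₁ := fun h => hy₁.2 (h ▸ hx)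
        have hxy₂ : x ≠ y₂ := fun h => hy₂.2 (h ▸ hx)
        refine ih (by omega) _ _ _ ?_ ?_ ?_ ?_
        · rw [Finset.disjoint_left] at hdis ⊢
          intro z hz hz'
          simp only [Finset.mem_insert, Finset.mem_erase] at hz hz'
          rcases hz with rfl | hz
          · rcases hz' with h | h | h
            exacts [hxy₁ h, hxy₂ h, h.1 rfl]
          · rcases hz' with rfl | rfl | h
            exacts [hy₁.1 hz, hy₂.1 hz, hdis hz h.2]
        · rw [Finset.card_insert_of_notMem hxA]; omega
        · rw [Finset.card_insert_of_notMem, Finset.card_insert_of_notMem,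
            Finset.card_erase_of_mem hx]
          · omega
          · simp [hy₂.2]
          · simp [hy₁.2, hy]
        · rw [Finset.card_insert_of_notMem, Finset.card_insert_of_notMem hw₂]
          · omega
          · simp [hw₁, hw]
  have := key k le_rfl ∅ {u} ∅ (Finset.disjoint_empty_left _) (by simp) (by simp) (by simp)
  exact this

end Caterpillar

/-! ### Breaking the cycles of a functional digraph -/

section Breakers

variable {V W : Type*}

/-- `v` lies on a cycle of `a` contained in `Y`. -/
def Cyclic (a : V → V) (Y : Finset V) (v : V) : Prop :=
  (∀ i, a^[i] v ∈ Y) ∧ ∃ m, 0 < m ∧ a^[m] v = v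

theorem Cyclic.iterate {a : V → V} {Y : Finset V} {v : V} (h : Cyclic a Y v) (i : ℕ) :
    Cyclic a Y (a^[i] v) := by
  obtain ⟨h1, m, hm, hv⟩ := h
  refine ⟨fun j => ?_, m, hm, ?_⟩
  · rw [← Function.iterate_add_apply]; exact h1 _
  · rw [← Function.iterate_add_apply, add_comm, Function.iterate_add_apply, hv]

theorem Cyclic.range_iterate_eq {a : V → V} {Y : Finset V} {v : V} (h : Cyclic a Y v) (i : ℕ) :
    (Set.range fun j => a^[j] (a^[i] v)) = Set.range fun j => a^[j] v := by
  obtain ⟨-, m, hm, hv⟩ := h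
  have hmul : ∀ k, a^[m * k] v = v := fun k => by
    rw [Function.iterate_mul]
    exact Function.iterate_fixed hv k
  ext x
  constructor
  · rintro ⟨j, rfl⟩
    exact ⟨j + i, Function.iterate_add_apply _ _ _ _⟩
  · rintro ⟨j, rfl⟩
    refine ⟨j + (m * i - i), ?_⟩
    have : j + (m * i - i) + i = j + m * i := by
      have := Nat.le_mul_of_pos_left i hm
      omega
    simp only
    rw [← Function.iterate_add_apply, this, Function.iterate_add_apply, hmul]

theorem exists_iterate_cyclic [Finite V] {a : V → V} {Y : Finset V} {v : V}
    (h : ∀ i, a^[i] v ∈ Y) : ∃ i, Cyclic a Y (a^[i] v) := by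
  obtain ⟨i, j, hij, he⟩ := Finite.exists_ne_map_eq_of_infinite fun i => a^[i] v
  change a^[i] v = a^[j] v at he
  wlog hlt : i < j generalizing i j
  · exact this j i hij.symm he.symm (by omega)
  refine ⟨i, fun k => ?_, j - i, by omega, ?_⟩
  · rw [← Function.iterate_add_apply]; exact h _
  · rw [← Function.iterate_add_apply, Nat.sub_add_cancel hlt.le, ← he]

/-- If each cycle of `a` has a vertex outside `F`, whose alternative parent leads to `Λ`, and
alternative colours of vertices on distinct cycles are distinct, then all cycles can be broken. -/
theorem good_of_breakers [Fintype V] [DecidableEq V] {E : V → V → W → Prop} {A Λ F : Finset V}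
    {C : Finset W} {a b : V → V} {M s : V → W}
    (ha : ∀ v, v ∉ A → v ∉ Λ → E (a v) v (M v) ∧ M v ∉ C) (haA : ∀ v, a v ∉ A)
    (hb : ∀ v, v ∉ A → v ∉ Λ → v ∉ F → E (b v) v (s v) ∧ s v ∉ C ∧
      ∀ v', v' ∉ A → v' ∉ Λ → s v ≠ M v') (hbA : ∀ v, b v ∉ A)
    (hM : ∀ v v', v ∉ A → v ∉ Λ → v' ∉ A → v' ∉ Λ → M v = M v' → v = v')
    (h1 : ∀ v, Cyclic a (A ∪ Λ)ᶜ v → ∃ i, a^[i] v ∉ F)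
    (h2 : ∀ v v', Cyclic a (A ∪ Λ)ᶜ v → Cyclic a (A ∪ Λ)ᶜ v' → v ∉ F → v' ∉ F → s v = s v' →
      ∃ i, a^[i] v = v')
    (h3 : ∀ v, Cyclic a (A ∪ Λ)ᶜ v → v ∉ F → Reach a Λ (b v)) : Good E A Λ C := by
  classical
  by_cases hne : Nonempty V
  swap
  · exact ⟨id, fun v => absurd ⟨v⟩ hne, fun v => absurd ⟨v⟩ hne, fun v => absurd ⟨v⟩ hne⟩
  set Y := (A ∪ Λ)ᶜ with hY
  have memY : ∀ v, v ∈ Y ↔ v ∉ A ∧ v ∉ Λ := fun v => by simp [hY]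
  set orb : V → Set V := fun v => Set.range fun j => a^[j] v with horb
  set pick : Set V → V := fun O => Classical.epsilon fun x => x ∈ O ∧ x ∉ F with hpick
  have pick_spec : ∀ v, Cyclic a Y v → pick (orb v) ∈ orb v ∧ pick (orb v) ∉ F := by
    intro v hv
    obtain ⟨i, hi⟩ := h1 v hv
    exact Classical.epsilon_spec (p := fun x => x ∈ orb v ∧ x ∉ F) ⟨a^[i] v, ⟨i, rfl⟩, hi⟩
  set Q : V → Prop := fun v => Cyclic a Y v ∧ v = pick (orb v) with hQ
  have QF : ∀ v, Q v → v ∉ F := fun v hv => by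
    have := (pick_spec v hv.1).2
    rwa [← hv.2] at this
  have Q_inj : ∀ v v', Q v → Q v' → s v = s v' → v = v' := by
    intro v v' hv hv' hs
    obtain ⟨i, hi⟩ := h2 v v' hv.1 hv'.1 (QF v hv) (QF v' hv') hs
    have : orb v' = orb v := by rw [← hi]; exact hv.1.range_iterate_eq i
    rw [hv.2, hv'.2, this]
  have Q_ex : ∀ v, (∀ i, a^[i] v ∈ Y) → ∃ i, Q (a^[i] v) := by
    intro v hv
    obtain ⟨i, hi⟩ := exists_iterate_cyclic hv
    obtain ⟨⟨j, hj⟩, -⟩ := pick_spec _ hi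
    refine ⟨j + i, ?_⟩
    rw [Function.iterate_add_apply]
    refine ⟨hi.iterate j, ?_⟩
    rw [horb]
    simp only
    rw [hi.range_iterate_eq j]
    exact hj
  set par : V → V := fun v => if Q v then b v else a v with hpar
  set col : V → W := fun v => if Q v then s v else M v with hcol
  have parQ : ∀ v, Q v → par v = b v := fun v h => by simp [hpar, h]
  have parN : ∀ v, ¬Q v → par v = a v := fun v h => by simp [hpar, h]
  have QY : ∀ v, Q v → v ∉ A ∧ v ∉ Λ := fun v h => (memY v).1 (h.1.1 0)
  have reach_a : ∀ v, Reach a Λ v → Reach par Λ v := by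
    intro v hv
    refine hv.induction (fun u hu => Reach.of_mem hu) fun u hu hr hu' => ?_
    refine Reach.step ?_
    rwa [parN]
    intro hq
    obtain ⟨i, hi⟩ := hr
    exact ((memY _).1 (hq.1.1 i)).2 hi
  have reach_Q : ∀ v, Q v → Reach par Λ v := fun v hv => by
    refine Reach.step ?_
    rw [parQ v hv]
    exact reach_a _ (h3 v hv.1 (QF v hv))
  have reach_it : ∀ i v, Q (a^[i] v) → Reach par Λ v := by
    intro i
    induction i with
    | zero => exact fun v hv => reach_Q v hv
    | succ i ih =>
      intro v hv
      by_cases hq : Q v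
      · exact reach_Q v hq
      · refine Reach.step ?_
        rw [parN v hq]
        exact ih _ (by rwa [Function.iterate_succ_apply] at hv)
  refine ⟨par, col, fun v hA hΛ => ?_, fun v v' hA hΛ hA' hΛ' hc => ?_⟩
  · have hreach : Reach par Λ v := by
      by_cases hr : Reach a Λ v
      · exact reach_a v hr
      · obtain ⟨i, hi⟩ := Q_ex v fun i => by
          rw [memY]
          refine ⟨?_, fun h => hr ⟨i, h⟩⟩
          cases i with
          | zero => exact hA
          | succ i => rw [Function.iterate_succ_apply']; exact haA _
        exact reach_it i v hi
    by_cases hq : Q v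
    · have := hb v hA hΛ (QF v hq)
      simp only [hcol, hq, if_true, parQ v hq]
      exact ⟨this.1, hbA v, this.2.1, hreach⟩
    · simp only [hcol, hq, if_false, parN v hq]
      exact ⟨(ha v hA hΛ).1, haA v, (ha v hA hΛ).2, hreach⟩
  · by_cases hq : Q v <;> by_cases hq' : Q v' <;> simp only [hcol, hq, hq', if_true, if_false] at hc
    · exact Q_inj v v' hq hq' hc
    · exact absurd hc ((hb v hA hΛ (QF v hq)).2.2 v' hA' hΛ')
    · exact absurd hc.symm ((hb v' hA' hΛ' (QF v' hq')).2.2 v hA hΛ)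
    · exact hM v v' hA hΛ hA' hΛ' hc

end Breakers

section Enumerate

variable {V : Type*} [Fintype V]

theorem exists_cycle_enumeration {a : V → V} {Y : Finset V} {v : V} (h : Cyclic a Y v) :
    ∃ m < Fintype.card V, ∃ x : Fin (m + 1) → V, Function.Injective x ∧ x 0 = v ∧
      (∀ k, a (x k) = x (k + 1)) ∧ ∀ k, ∃ i, x k = a^[i] v := by
  obtain ⟨-, n, hn, hv⟩ := h
  have hpos : 0 < Function.minimalPeriod a v :=
    Function.IsPeriodicPt.minimalPeriod_pos hn hv
  obtain ⟨m, hm⟩ := Nat.exists_eq_succ_of_ne_zero hpos.ne'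
  have hinj : Function.Injective fun k : Fin (m + 1) => a^[(k : ℕ)] v := by
    intro k l hkl
    refine Fin.ext (Function.iterate_injOn_Iio_minimalPeriod (f := a) (x := v) ?_ ?_ hkl)
    · rw [hm]; exact k.2
    · rw [hm]; exact l.2
  refine ⟨m, ?_, fun k => a^[(k : ℕ)] v, hinj, rfl, fun k => ?_, fun k => ⟨k, rfl⟩⟩
  · have := Fintype.card_le_of_injective _ hinj
    rw [Fintype.card_fin] at this
    omega
  · simp only
    rw [← Function.iterate_succ_apply' a]
    have hk : ((k + 1 : Fin (m + 1)) : ℕ) = (k : ℕ).succ % (m + 1) := by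
      simp [Fin.val_add]
    rw [hk, ← Function.iterate_mod_minimalPeriod_eq (n := (k : ℕ).succ), hm]

theorem exists_rho_enumeration (a : V → V) (v : V) :
    ∃ m < Fintype.card V, ∃ x : Fin (m + 1) → V, Function.Injective x ∧ x 0 = v ∧
      (∃ j, ∀ k, a (x k) = x (if k = Fin.last m then j else k + 1)) ∧
      ∀ k, ∃ i, x k = a^[i] v := by
  classical
  have hex : ∃ n, ∃ i ≤ n, a^[n + 1] v = a^[i] v := by
    obtain ⟨i, j, hij, he⟩ := Finite.exists_ne_map_eq_of_infinite fun i => a^[i] v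
    change a^[i] v = a^[j] v at he
    wlog hlt : i < j generalizing i j
    · exact this j i hij.symm he.symm (by omega)
    refine ⟨j - 1, i, by omega, ?_⟩
    rw [Nat.sub_add_cancel (by omega), he]
  set m := Nat.find hex with hm
  obtain ⟨j, hj, hjm⟩ := Nat.find_spec hex
  rw [← hm] at hj hjm
  have hlt : ∀ k l, k < l → l ≤ m → a^[k] v ≠ a^[l] v := by
    intro k l hkl hl he
    refine Nat.find_min hex (m := l - 1) (by omega) ⟨k, by omega, ?_⟩
    rw [Nat.sub_add_cancel (by omega), he]
  have hinj : Function.Injective fun k : Fin (m + 1) => a^[(k : ℕ)] v := by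
    intro k l hkl
    rcases lt_trichotomy k l with h | h | h
    · exact absurd hkl (hlt _ _ h (Nat.lt_succ_iff.1 l.2))
    · exact h
    · exact absurd hkl.symm (hlt _ _ h (Nat.lt_succ_iff.1 k.2))
  refine ⟨m, ?_, fun k => a^[(k : ℕ)] v, hinj, rfl, ⟨⟨j, by omega⟩, fun k => ?_⟩,
    fun k => ⟨k, rfl⟩⟩
  · have := Fintype.card_le_of_injective _ hinj
    rw [Fintype.card_fin] at this
    omega
  · simp only
    rw [← Function.iterate_succ_apply' a]
    split_ifs with h
    · subst h; exact hjm
    · rw [Fin.val_add_one_of_lt (lt_of_le_of_ne (Fin.le_last k) h)]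

end Enumerate

/-! ### Cycles of a random functional digraph -/

theorem geom_sum_le {r : ℝ} (h0 : 0 ≤ r) (h1 : r < 1) (N : ℕ) :
    ∑ m ∈ Finset.range N, r ^ m ≤ 1 / (1 - r) := by
  rw [le_div_iff₀ (by linarith), mul_comm, mul_neg_geom_sum]
  linarith [pow_nonneg h0 N]

theorem arith_geom_sum_le {r : ℝ} (h0 : 0 ≤ r) (h1 : r < 1) (N : ℕ) :
    ∑ m ∈ Finset.range N, ((m : ℝ) + 1) * r ^ m ≤ 1 / (1 - r) ^ 2 := by
  have h : ∀ N : ℕ, (∑ m ∈ Finset.range N, ((m : ℝ) + 1) * r ^ m) * (1 - r) ^ 2 =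
      1 - (N + 1) * r ^ N + N * r ^ (N + 1) := by
    intro N
    induction N with
    | zero => simp
    | succ N ih =>
      rw [Finset.sum_range_succ, add_mul, ih]
      push_cast
      ring
  rw [le_div_iff₀ (by have : 0 < 1 - r := by linarith
                      positivity), h]
  have h2 : r ^ (N + 1) ≤ r ^ N := pow_le_pow_of_le_one h0 h1.le (Nat.le_succ N)
  have h3 := mul_le_mul_of_nonneg_left h2 (Nat.cast_nonneg (α := ℝ) N)
  have h4 := pow_nonneg h0 N
  nlinarith

section Wiring

variable {V ι : Type*} [Fintype V] [DecidableEq V] [Fintype ι] [DecidableEq ι] {A : Finset V}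

theorem pr_unif_coe_le (y : V) :
    pr (unif {t // t ∉ A}) (fun t => (t : V) = y) ≤ (Fintype.card {t // t ∉ A} : ℝ)⁻¹ := by
  by_cases h : y ∉ A
  · rw [← pr_unif_eq (⟨y, h⟩ : {t // t ∉ A})]
    exact (pr_congr fun t => by rw [Subtype.ext_iff]).le
  · rw [pr_congr (B := fun _ => False)]
    · simp [pr, expect, ind]
    · exact fun t => ⟨fun e => h (e ▸ t.2), False.elim⟩

variable [Nonempty {t // t ∉ A}] {c : V → ι}

theorem pr_wiring_le (hc : Function.Injective c) {κ : Type*} [Fintype κ] [DecidableEq κ]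
    (T : κ → Finset V) (nxt : κ → κ) :
    pr (prodWeight fun _ : ι => unif {t // t ∉ A})
      (fun t => ∃ x : κ → V, (∀ k, x k ∈ T k) ∧ Function.Injective x ∧
        ∀ k, (t (c (x k)) : V) = x (nxt k)) ≤
      (∏ k, ((T k).card : ℝ)) * ((Fintype.card {t // t ∉ A} : ℝ)⁻¹) ^ Fintype.card κ := by
  classical
  have hp : IsProb (prodWeight fun _ : ι => unif {t // t ∉ A}) :=
    isProb_prodWeight fun _ => isProb_unif _
  set X := (Fintype.piFinset T).filter fun x => Function.Injective x with hX
  calc _ ≤ pr (prodWeight fun _ : ι => unif {t // t ∉ A})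
        (fun t => ∃ x ∈ X, ∀ k, (t (c (x k)) : V) = x (nxt k)) := by
        refine pr_mono hp fun t => ?_
        rintro ⟨x, h1, h2, h3⟩
        exact ⟨x, by simp [hX, h1, h2], h3⟩
    _ ≤ ∑ x ∈ X, pr (prodWeight fun _ : ι => unif {t // t ∉ A})
        (fun t => ∀ k, (t (c (x k)) : V) = x (nxt k)) := pr_exists_le hp _ _
    _ ≤ ∑ _x ∈ X, ((Fintype.card {t // t ∉ A} : ℝ)⁻¹) ^ Fintype.card κ := by
        refine Finset.sum_le_sum fun x hx => ?_
        simp only [hX, Finset.mem_filter] at hx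
        rw [pr_prodWeight_cylinder (fun _ => isProb_unif _) (fun k => c (x k))
          (fun k l h => hx.2 (hc h)) fun k (t : {t // t ∉ A}) => (t : V) = x (nxt k)]
        refine (Finset.prod_le_prod (fun _ _ => pr_nonneg (isProb_unif _) _)
          fun k _ => pr_unif_coe_le _).trans ?_
        simp
    _ ≤ _ := by
        rw [Finset.sum_const, nsmul_eq_mul]
        refine mul_le_mul_of_nonneg_right ?_ (by positivity)
        refine (Nat.cast_le.2 (Finset.card_filter_le _ _)).trans ?_
        rw [Fintype.card_piFinset]
        push_cast
        rfl

/-- The functional digraph determined by the tails at the coordinates `c v`. -/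
def tailMap (c : V → ι) (t : ι → {t // t ∉ A}) (v : V) : V := t (c v)

theorem pr_cycle_in_le (hc : Function.Injective c) (Y F : Finset V)
    (hF : (F.card : ℝ) < (Fintype.card {t // t ∉ A} : ℝ)) :
    pr (prodWeight fun _ : ι => unif {t // t ∉ A})
      (fun t => ∃ v, Cyclic (tailMap c t) Y v ∧ ∀ i, (tailMap c t)^[i] v ∈ F) ≤
      F.card / ((Fintype.card {t // t ∉ A} : ℝ) - F.card) := by
  have hp : IsProb (prodWeight fun _ : ι => unif {t // t ∉ A}) :=
    isProb_prodWeight fun _ => isProb_unif _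
  have hd : 0 < (Fintype.card {t // t ∉ A} : ℝ) := lt_of_le_of_lt (Nat.cast_nonneg _) hF
  set r : ℝ := F.card / (Fintype.card {t // t ∉ A} : ℝ) with hr
  have hr0 : 0 ≤ r := by positivity
  have hr1 : r < 1 := by rwa [hr, div_lt_one hd]
  calc _ ≤ pr (prodWeight fun _ : ι => unif {t // t ∉ A})
        (fun t => ∃ m ∈ Finset.range (Fintype.card V), ∃ x : Fin (m + 1) → V, (∀ k, x k ∈ F) ∧
          Function.Injective x ∧ ∀ k, (t (c (x k)) : V) = x (k + 1)) := by
        refine pr_mono hp fun t => ?_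
        rintro ⟨v, hv, hvF⟩
        obtain ⟨m, hm, x, hx, -, hxn, hxi⟩ := exists_cycle_enumeration hv
        refine ⟨m, Finset.mem_range.2 hm, x, fun k => ?_, hx, hxn⟩
        obtain ⟨i, hi⟩ := hxi k
        rw [hi]; exact hvF i
    _ ≤ ∑ m ∈ Finset.range (Fintype.card V), _ := pr_exists_le hp _ _
    _ ≤ ∑ m ∈ Finset.range (Fintype.card V), r * r ^ m := by
        refine Finset.sum_le_sum fun m _ => ?_
        refine (pr_wiring_le hc (fun _ : Fin (m + 1) => F) fun k => k + 1).trans (le_of_eq ?_)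
        rw [Finset.prod_const, Finset.card_univ, Fintype.card_fin, ← mul_pow, ← div_eq_mul_inv,
          pow_succ']
    _ ≤ r * (1 / (1 - r)) := by
        rw [← Finset.mul_sum]
        exact mul_le_mul_of_nonneg_left (geom_sum_le hr0 hr1 _) hr0
    _ = _ := by
        rw [hr]
        have : (Fintype.card {t // t ∉ A} : ℝ) - F.card ≠ 0 := by linarith
        field_simp

theorem pr_two_cycles_le (hc : Function.Injective c) (Y : Finset V)
    (hY : (Y.card : ℝ) < (Fintype.card {t // t ∉ A} : ℝ))
    (v v' : V) :
    pr (prodWeight fun _ : ι => unif {t // t ∉ A})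
      (fun t => Cyclic (tailMap c t) Y v ∧ Cyclic (tailMap c t) Y v' ∧
        ∀ i, (tailMap c t)^[i] v ≠ v') ≤ 1 / ((Fintype.card {t // t ∉ A} : ℝ) - Y.card) ^ 2 := by
  have hp : IsProb (prodWeight fun _ : ι => unif {t // t ∉ A}) :=
    isProb_prodWeight fun _ => isProb_unif _
  have hd : 0 < (Fintype.card {t // t ∉ A} : ℝ) := lt_of_le_of_lt (Nat.cast_nonneg _) hY
  set r : ℝ := Y.card / (Fintype.card {t // t ∉ A} : ℝ) with hr
  have hr0 : 0 ≤ r := by positivity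
  have hr1 : r < 1 := by rwa [hr, div_lt_one hd]
  set N := Fintype.card V
  set T : (m m' : ℕ) → Fin (m + 1) ⊕ Fin (m' + 1) → Finset V := fun m m' =>
    Sum.elim (Fin.cons {v} fun _ => Y) (Fin.cons {v'} fun _ => Y) with hT
  calc _ ≤ pr (prodWeight fun _ : ι => unif {t // t ∉ A})
        (fun t => ∃ m ∈ Finset.range N ×ˢ Finset.range N,
          ∃ x : Fin (m.1 + 1) ⊕ Fin (m.2 + 1) → V, (∀ k, x k ∈ T m.1 m.2 k) ∧
          Function.Injective x ∧
          ∀ k, (t (c (x k)) : V) = x (Sum.map (fun i => i + 1) (fun i => i + 1) k)) := by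
        refine pr_mono hp fun t => ?_
        rintro ⟨hv, hv', hne⟩
        obtain ⟨m, hm, x, hx, hx0, hxn, hxi⟩ := exists_cycle_enumeration hv
        obtain ⟨m', hm', x', hx', hx0', hxn', hxi'⟩ := exists_cycle_enumeration hv'
        refine ⟨(m, m'), by simp [N, hm, hm'], Sum.elim x x', ?_, ?_, ?_⟩
        · rintro (k | k)
          · refine Fin.cases ?_ (fun k => ?_) k
            · simp [hT, hx0]
            · obtain ⟨i, hi⟩ := hxi k.succ
              simp only [hT, Sum.elim_inl, Fin.cons_succ, hi]
              exact hv.1 i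
          · refine Fin.cases ?_ (fun k => ?_) k
            · simp [hT, hx0']
            · obtain ⟨i, hi⟩ := hxi' k.succ
              simp only [hT, Sum.elim_inr, Fin.cons_succ, hi]
              exact hv'.1 i
        · refine Function.Injective.sumElim hx hx' fun k k' hkk => ?_
          obtain ⟨i, hi⟩ := hxi k
          obtain ⟨j, hj⟩ := hxi' k'
          have h1 := hv.range_iterate_eq i
          have h2 := hv'.range_iterate_eq j
          rw [← hi, hkk, hj, h2] at h1
          have : v' ∈ Set.range fun j => (tailMap c t)^[j] v := by
            rw [← h1]; exact ⟨0, rfl⟩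
          obtain ⟨l, hl⟩ := this
          exact hne l hl
        · rintro (k | k)
          · exact hxn k
          · exact hxn' k
    _ ≤ ∑ m ∈ Finset.range N ×ˢ Finset.range N, _ := pr_exists_le hp _ _
    _ ≤ ∑ m ∈ Finset.range N ×ˢ Finset.range N,
        ((Fintype.card {t // t ∉ A} : ℝ)⁻¹ * r ^ m.1) * ((Fintype.card {t // t ∉ A} : ℝ)⁻¹ *
            r ^ m.2) := by
        refine Finset.sum_le_sum fun m _ => ?_
        refine (pr_wiring_le hc (T m.1 m.2)
          (Sum.map (fun i => i + 1) (fun i => i + 1))).trans (le_of_eq ?_)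
        simp only [hT, Fintype.prod_sum_type, Sum.elim_inl, Sum.elim_inr, Fin.prod_univ_succ,
          Fin.cons_zero, Fin.cons_succ, Finset.card_singleton, Finset.prod_const, Finset.card_univ,
          Fintype.card_fin, Fintype.card_sum]
        rw [hr, div_eq_mul_inv]
        push_cast
        ring
    _ = (∑ m ∈ Finset.range N, (Fintype.card {t // t ∉ A} : ℝ)⁻¹ * r ^ m) *
        ∑ m ∈ Finset.range N, (Fintype.card {t // t ∉ A} : ℝ)⁻¹ * r ^ m := by
        rw [Finset.sum_product, Finset.sum_mul_sum]
    _ ≤ ((Fintype.card {t // t ∉ A} : ℝ)⁻¹ * (1 / (1 - r))) *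
        ((Fintype.card {t // t ∉ A} : ℝ)⁻¹ * (1 / (1 - r))) := by
        rw [← Finset.mul_sum]
        have := mul_le_mul_of_nonneg_left (geom_sum_le hr0 hr1 N) (inv_nonneg.2 hd.le)
        exact mul_le_mul this this (by positivity) (by
          have : 0 < 1 - r := by linarith
          positivity)
    _ = _ := by
        have h1 : (Fintype.card {t // t ∉ A} : ℝ)⁻¹ * (1 / (1 - r)) =
            1 / ((Fintype.card {t // t ∉ A} : ℝ) - Y.card) := by
          rw [hr]
          have : (Fintype.card {t // t ∉ A} : ℝ) - Y.card ≠ 0 := by linarith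
          field_simp
        rw [h1, div_mul_div_comm, one_mul, sq]

theorem pr_not_absorbed_le (hc : Function.Injective c) (Y : Finset V)
    (hY : (Y.card : ℝ) < (Fintype.card {t // t ∉ A} : ℝ))
    (v : V) :
    pr (prodWeight fun _ : ι => unif {t // t ∉ A})
      (fun t => ∀ i, (tailMap c t)^[i] v ∈ Y) ≤ (Fintype.card {t // t ∉ A} : ℝ) /
          ((Fintype.card {t // t ∉ A} : ℝ) - Y.card) ^ 2 := by
  have hp : IsProb (prodWeight fun _ : ι => unif {t // t ∉ A}) :=
    isProb_prodWeight fun _ => isProb_unif _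
  have hd : 0 < (Fintype.card {t // t ∉ A} : ℝ) := lt_of_le_of_lt (Nat.cast_nonneg _) hY
  set r : ℝ := Y.card / (Fintype.card {t // t ∉ A} : ℝ) with hr
  have hr0 : 0 ≤ r := by positivity
  have hr1 : r < 1 := by rwa [hr, div_lt_one hd]
  set N := Fintype.card V
  set T : (m : ℕ) → Fin (m + 1) → Finset V := fun m => Fin.cons {v} fun _ => Y with hT
  calc _ ≤ pr (prodWeight fun _ : ι => unif {t // t ∉ A})
        (fun t => ∃ m ∈ Finset.range N, ∃ j ∈ (Finset.univ : Finset (Fin (m + 1))),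
          ∃ x : Fin (m + 1) → V, (∀ k, x k ∈ T m k) ∧ Function.Injective x ∧
          ∀ k, (t (c (x k)) : V) = x (if k = Fin.last m then j else k + 1)) := by
        refine pr_mono hp fun t ht => ?_
        obtain ⟨m, hm, x, hx, hx0, ⟨j, hj⟩, hxi⟩ := exists_rho_enumeration (tailMap c t) v
        refine ⟨m, Finset.mem_range.2 hm, j, Finset.mem_univ j, x, fun k => ?_, hx, hj⟩
        refine Fin.cases ?_ (fun k => ?_) k
        · simp [hT, hx0]
        · obtain ⟨i, hi⟩ := hxi k.succ
          simp only [hT, Fin.cons_succ, hi]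
          exact ht i
    _ ≤ ∑ m ∈ Finset.range N, _ := pr_exists_le hp _ _
    _ ≤ ∑ m ∈ Finset.range N, (Fintype.card {t // t ∉ A} : ℝ)⁻¹ * (((m : ℝ) + 1) * r ^ m) := by
        refine Finset.sum_le_sum fun m _ => (pr_exists_le hp _ _).trans ?_
        have h1 : ∀ j ∈ (Finset.univ : Finset (Fin (m + 1))), _ ≤
            (Fintype.card {t // t ∉ A} : ℝ)⁻¹ * r ^ m := fun j _ =>
          (pr_wiring_le hc (T m) (fun k => if k = Fin.last m then j else k + 1)).trans
            (le_of_eq (by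
              simp only [hT, Fin.prod_univ_succ, Fin.cons_zero, Fin.cons_succ,
                Finset.card_singleton, Finset.prod_const, Finset.card_univ, Fintype.card_fin]
              rw [hr, div_eq_mul_inv]
              push_cast
              ring))
        refine (Finset.sum_le_sum h1).trans (le_of_eq ?_)
        rw [Finset.sum_const, Finset.card_univ, Fintype.card_fin, nsmul_eq_mul]
        push_cast
        ring
    _ ≤ (Fintype.card {t // t ∉ A} : ℝ)⁻¹ * (1 / (1 - r) ^ 2) := by
        rw [← Finset.mul_sum]
        exact mul_le_mul_of_nonneg_left (arith_geom_sum_le hr0 hr1 N) (inv_nonneg.2 hd.le)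
    _ = _ := by
        rw [hr]
        have : (Fintype.card {t // t ∉ A} : ℝ) - Y.card ≠ 0 := by linarith
        field_simp

theorem pr_bad_breaker_le (hc : Function.Injective c) (Y Z : Finset V)
    (hY : (Y.card : ℝ) < (Fintype.card {t // t ∉ A} : ℝ))
    {c' : V → ι} (hcc : ∀ v ∈ Z, ∀ u, c' v ≠ c u) {β : ℝ} (hβ : 0 < β) :
    pr (prodWeight fun _ : ι => unif {t // t ∉ A})
      (fun t => ∃ v ∈ Z, Cyclic (tailMap c t) Y v ∧
        ∀ i, (tailMap c t)^[i] (t (c' v)) ∈ Y) ≤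
      Y.card * ((Fintype.card {t // t ∉ A} : ℝ) /
          ((Fintype.card {t // t ∉ A} : ℝ) - Y.card) ^ 2) / β + β ^ 2 / (Fintype.card {t // t ∉ A} : ℝ) := by
  classical
  have hu : ∀ _ : ι, IsProb (unif {t // t ∉ A}) := fun _ => isProb_unif _
  have hp := isProb_prodWeight hu
  have hd : 0 < (Fintype.card {t // t ∉ A} : ℝ) := lt_of_le_of_lt (Nat.cast_nonneg _) hY
  set μ := prodWeight fun _ : ι => unif {t // t ∉ A} with hμ
  set B : (ι → {t // t ∉ A}) → Finset V := fun t =>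
    Y.filter fun v => ∀ i, (tailMap c t)^[i] v ∈ Y with hB
  have memB : ∀ t v, v ∈ B t ↔ ∀ i, (tailMap c t)^[i] v ∈ Y := fun t v => by
    simp only [hB, Finset.mem_filter, and_iff_right_iff_imp]
    exact fun h => h 0
  have hEB : expect μ (fun t => ((B t).card : ℝ)) ≤ Y.card * ((Fintype.card {t // t ∉ A} : ℝ) /
      ((Fintype.card {t // t ∉ A} : ℝ) - Y.card) ^ 2) := by
    have h1 : ∀ t, ((B t).card : ℝ) = ∑ v ∈ Y, ind (∀ i, (tailMap c t)^[i] v ∈ Y) := fun t => by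
      rw [hB, Finset.card_filter]
      push_cast
      refine Finset.sum_congr rfl fun v _ => ?_
      by_cases h : ∀ i, (tailMap c t)^[i] v ∈ Y
      · rw [ind_of_true h, if_pos h]
      · rw [ind_of_false h, if_neg h]
    simp only [h1]
    rw [expect_sum]
    refine (Finset.sum_le_card_nsmul Y _ _ fun v _ => pr_not_absorbed_le hc Y hY v).trans ?_
    rw [nsmul_eq_mul]
  set S : ι → Prop := fun i => ∃ u, i = c u with hS
  have hmap : ∀ f g : ι → {t // t ∉ A}, tailMap c (merge S f g) = tailMap c f := fun f g => by
    funext v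
    rw [tailMap, tailMap, merge_of_mem _ _ ⟨v, rfl⟩]
  have hmap' : ∀ (f g : ι → {t // t ∉ A}), ∀ v ∈ Z, merge S f g (c' v) = g (c' v) :=
    fun f g v hv => merge_of_not_mem _ _ fun ⟨u, hu⟩ => hcc v hv u hu
  have hcond : ∀ f, pr μ (fun g => ∃ v ∈ Z, Cyclic (tailMap c (merge S f g)) Y v ∧
      ∀ i, (tailMap c (merge S f g))^[i] ((merge S f g (c' v) : {t // t ∉ A}) : V) ∈ Y) ≤
      ind (β ≤ ((B f).card : ℝ)) + β ^ 2 / (Fintype.card {t // t ∉ A} : ℝ) := by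
    intro f
    by_cases h : β ≤ ((B f).card : ℝ)
    · rw [ind_of_true h]
      have := pr_le_one hp (fun g => ∃ v ∈ Z, Cyclic (tailMap c (merge S f g)) Y v ∧
        ∀ i, (tailMap c (merge S f g))^[i] ((merge S f g (c' v) : {t // t ∉ A}) : V) ∈ Y)
      have : 0 ≤ β ^ 2 / (Fintype.card {t // t ∉ A} : ℝ) := by positivity
      linarith
    · rw [ind_of_false h, zero_add]
      push Not at h
      calc _ ≤ pr μ (fun g => ∃ x ∈ B f ×ˢ B f, (g (c' x.1) : V) = x.2) := by
            refine pr_mono hp fun g => ?_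
            rintro ⟨v, hv, h1, h2⟩
            rw [hmap] at h1 h2
            rw [hmap' f g v hv] at h2
            exact ⟨(v, (g (c' v) : V)), Finset.mem_product.2
              ⟨(memB _ _).2 h1.1, (memB _ _).2 h2⟩, rfl⟩
        _ ≤ ∑ x ∈ B f ×ˢ B f, _ := pr_exists_le hp _ _
        _ ≤ ∑ _x ∈ B f ×ˢ B f, (Fintype.card {t // t ∉ A} : ℝ)⁻¹ := by
            refine Finset.sum_le_sum fun x _ => ?_
            rw [pr, hμ, expect_coord hu (c' x.1) fun t => ind ((t : V) = x.2)]
            exact pr_unif_coe_le x.2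
        _ = ((B f).card : ℝ) ^ 2 / (Fintype.card {t // t ∉ A} : ℝ) := by
            rw [Finset.sum_const, Finset.card_product, nsmul_eq_mul]
            push_cast
            rw [div_eq_mul_inv]; ring
        _ ≤ _ := by gcongr
  rw [pr, expect_merge hu S]
  refine (expect_mono hp hcond).trans ?_
  rw [expect_add, expect_const hp]
  refine add_le_add_left ((pr_le_expect_div hp (fun t => Nat.cast_nonneg _) hβ).trans ?_) _
  gcongr

end Wiring

section TailRound

variable {V W : Type*} [Fintype V] [DecidableEq V] [Fintype W] [DecidableEq W]

/-- If the coloured in-edges present at each vertex allow a rainbow choice `M` together with spare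
colours `s` off a small set `F`, then random tails produce a good configuration. -/
theorem pr_good_tails_ge {A Λ F : Finset V} {C : Finset W} [Nonempty {t // t ∉ A}]
    {h : V × W → Bool} {M s : V → W} {d Y K β : ℝ}
    (hd : (Fintype.card {t // t ∉ A} : ℝ) = d) (hY : (((A ∪ Λ)ᶜ : Finset V).card : ℝ) = Y)
    (hM : ∀ v, v ∉ A → v ∉ Λ → h (v, M v) = true ∧ M v ∉ C)
    (hMinj : ∀ v v', v ∉ A → v ∉ Λ → v' ∉ A → v' ∉ Λ → M v = M v' → v = v')
    (hs : ∀ v, v ∉ A → v ∉ Λ → v ∉ F → h (v, s v) = true ∧ s v ∉ C ∧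
      ∀ v', v' ∉ A → v' ∉ Λ → s v ≠ M v')
    (hF : (F.card : ℝ) < d) (hYd : Y < d) (hβ : 0 < β)
    (hK : (((Finset.univ : Finset (V × V)).filter fun x => (x.1 ∉ A ∧ x.1 ∉ Λ ∧ x.1 ∉ F) ∧
      (x.2 ∉ A ∧ x.2 ∉ Λ ∧ x.2 ∉ F) ∧ s x.1 = s x.2).card : ℝ) ≤ K) :
    1 - (F.card / (d - F.card) + K / (d - Y) ^ 2 + (Y * (d / (d - Y) ^ 2) / β + β ^ 2 / d)) ≤
      pr (prodWeight fun _ : V × W => unif {t // t ∉ A})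
        (fun t => Good (fun t' v w => h (v, w) = true ∧ (t (v, w) : V) = t') A Λ C) := by
  classical
  subst hd
  have hp : IsProb (prodWeight fun _ : V × W => unif {t // t ∉ A}) :=
    isProb_prodWeight fun _ => isProb_unif _
  set Ys : Finset V := (A ∪ Λ)ᶜ with hYs
  have memY : ∀ v, v ∈ Ys ↔ v ∉ A ∧ v ∉ Λ := fun v => by simp [hYs]
  set c : V → V × W := fun v => (v, M v) with hc
  set c' : V → V × W := fun v => (v, s v) with hc'
  have hcinj : Function.Injective c := fun v v' e => congrArg Prod.fst e
  have hYd' : (Ys.card : ℝ) < Fintype.card {t // t ∉ A} := by rw [hY]; exact hYd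
  have e1 := pr_cycle_in_le hcinj Ys F hF
  have e3 := pr_bad_breaker_le hcinj Ys (Ys \ F) hYd' (c' := c') (by
    intro v hv u e
    rw [Finset.mem_sdiff, memY] at hv
    obtain ⟨rfl, e2⟩ := Prod.mk.inj e
    exact (hs v hv.1.1 hv.1.2 hv.2).2.2 v hv.1.1 hv.1.2 e2) hβ
  set X := (Finset.univ : Finset (V × V)).filter fun x => (x.1 ∉ A ∧ x.1 ∉ Λ ∧ x.1 ∉ F) ∧
      (x.2 ∉ A ∧ x.2 ∉ Λ ∧ x.2 ∉ F) ∧ s x.1 = s x.2 with hX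
  have e2 : pr (prodWeight fun _ : V × W => unif {t // t ∉ A})
      (fun t => ∃ x ∈ X, Cyclic (tailMap c t) Ys x.1 ∧ Cyclic (tailMap c t) Ys x.2 ∧
        ∀ i, (tailMap c t)^[i] x.1 ≠ x.2) ≤ K / (Fintype.card {t // t ∉ A} - Y) ^ 2 := by
    refine (pr_exists_le hp X _).trans ((Finset.sum_le_sum fun x _ =>
      pr_two_cycles_le hcinj Ys hYd' x.1 x.2).trans ?_)
    rw [Finset.sum_const, nsmul_eq_mul, hY, mul_one_div]
    gcongr
  rw [hY] at e3
  have key : pr (prodWeight fun _ : V × W => unif {t // t ∉ A})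
      (fun t => ¬ Good (fun t' v w => h (v, w) = true ∧ (t (v, w) : V) = t') A Λ C) ≤ _ :=
    (pr_le_add_of_imp hp (C := fun t => ∃ v ∈ Ys \ F, Cyclic (tailMap c t) Ys v ∧
        ∀ i, (tailMap c t)^[i] (t (c' v)) ∈ Ys) (B := fun t =>
      (∃ v, Cyclic (tailMap c t) Ys v ∧ ∀ i, (tailMap c t)^[i] v ∈ F) ∨
      ∃ x ∈ X, Cyclic (tailMap c t) Ys x.1 ∧ Cyclic (tailMap c t) Ys x.2 ∧
        ∀ i, (tailMap c t)^[i] x.1 ≠ x.2) fun t hbad => by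
      by_contra hcon
      push Not at hcon
      obtain ⟨⟨g1, g2⟩, g3⟩ := hcon
      refine hbad (good_of_breakers (F := F) (a := tailMap c t) (b := fun v => t (c' v)) (M := M)
        (s := s) (fun v h1 h2 => ⟨⟨(hM v h1 h2).1, rfl⟩, (hM v h1 h2).2⟩) (fun v => (t (c v)).2)
        (fun v h1 h2 h3 => ⟨⟨(hs v h1 h2 h3).1, rfl⟩, (hs v h1 h2 h3).2⟩) (fun v => (t (c' v)).2)
        hMinj g1 ?_ ?_)
      · intro v v' hv hv' hvF hvF' hss
        have m1 := (memY v).1 (hv.1 0)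
        have m2 := (memY v').1 (hv'.1 0)
        exact g2 (v, v') (by simp [hX, m1, m2, hvF, hvF', hss]) hv hv'
      · intro v hv hvF
        obtain ⟨i, hi⟩ := g3 v (Finset.mem_sdiff.2 ⟨hv.1 0, hvF⟩) hv
        refine ⟨i, ?_⟩
        rw [memY] at hi
        by_contra hn
        refine hi ⟨?_, hn⟩
        cases i with
        | zero => exact (t (c' v)).2
        | succ i => rw [Function.iterate_succ_apply']; exact (t (c _)).2).trans
    (add_le_add ((pr_or_le hp _ _).trans (add_le_add e1 e2)) e3)
  rw [pr_not hp] at key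
  linarith

end TailRound

/-! ### Rainbow choices with spare colours -/

section Hall

variable {V W : Type*} [DecidableEq V] [DecidableEq W]

theorem card_le_card_neighbours (H : V → W → Prop) [∀ v, DecidablePred (H v)] {Y : Finset V}
    {W' : Finset W} {a b : ℕ}
    (h1 : ∀ v ∈ Y, ∃ w ∈ W', H v w)
    (h2 : ∀ S ⊆ Y, ∀ T ⊆ W', 2 ≤ S.card → S.card < a → T.card + 1 = S.card →
      (∀ w ∈ T, ∃ v ∈ S, ∃ v' ∈ S, v ≠ v' ∧ H v w ∧ H v' w) → ∃ v ∈ S, ∃ w ∈ W' \ T, H v w)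
    (h3 : ∀ S ⊆ Y, ∀ Q ⊆ W', a ≤ S.card → b ≤ Q.card → ∃ v ∈ S, ∃ w ∈ Q, H v w)
    (hroom : Y.card + b ≤ W'.card) {S : Finset V} (hS : S ⊆ Y) :
    S.card ≤ (S.biUnion fun v => W'.filter (H v)).card := by
  set N : Finset V → Finset W := fun S => S.biUnion fun v => W'.filter (H v) with hN
  have memN : ∀ S w, w ∈ N S ↔ w ∈ W' ∧ ∃ v ∈ S, H v w := fun S w => by
    simp only [hN, Finset.mem_biUnion, Finset.mem_filter]
    tauto
  have Nsub : ∀ S, N S ⊆ W' := fun S w hw => ((memN S w).1 hw).1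
  change S.card ≤ (N S).card
  induction S using Finset.strongInduction with
  | H S ih =>
    by_contra hlt
    push Not at hlt
    by_cases ha : a ≤ S.card
    · have hb : ¬ b ≤ (W' \ N S).card := fun hb => by
        obtain ⟨v, hv, w, hw, hvw⟩ := h3 S hS _ Finset.sdiff_subset ha hb
        rw [Finset.mem_sdiff, memN] at hw
        exact hw.2 ⟨hw.1, v, hv, hvw⟩
      have e1 := Finset.card_sdiff_add_card_eq_card (Nsub S)
      have e2 := Finset.card_le_card hS
      omega
    push Not at ha
    have herase : ∀ v ∈ S, N (S.erase v) = N S ∧ (N S).card + 1 = S.card := by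
      intro v hv
      have e1 := ih _ (Finset.erase_ssubset hv) ((Finset.erase_subset _ _).trans hS)
      rw [Finset.card_erase_of_mem hv] at e1
      have e2 : N (S.erase v) ⊆ N S := fun w hw => by
        rw [memN] at hw ⊢
        obtain ⟨h, u, hu, hh⟩ := hw
        exact ⟨h, u, Finset.mem_of_mem_erase hu, hh⟩
      have e3 := Finset.card_le_card e2
      have e4 := Finset.card_pos.2 ⟨v, hv⟩
      exact ⟨Finset.eq_of_subset_of_card_le e2 (by omega), by omega⟩
    obtain ⟨v0, hv0⟩ : S.Nonempty := Finset.card_pos.1 (by omega)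
    obtain ⟨w0, hw0, hvw0⟩ := h1 v0 (hS hv0)
    have hpos : 0 < (N S).card := Finset.card_pos.2 ⟨w0, (memN _ _).2 ⟨hw0, v0, hv0, hvw0⟩⟩
    have hcard := (herase v0 hv0).2
    obtain ⟨v, hv, w, hw, hvw⟩ := h2 S hS (N S) (Nsub S) (by omega) ha hcard (by
      intro w hw
      obtain ⟨-, v, hv, hvw⟩ := (memN S w).1 hw
      rw [← (herase v hv).1, memN] at hw
      obtain ⟨-, v', hv', hvw'⟩ := hw
      exact ⟨v, hv, v', Finset.mem_of_mem_erase hv', (Finset.ne_of_mem_erase hv').symm, hvw, hvw'⟩)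
    rw [Finset.mem_sdiff, memN] at hw
    exact hw.2 ⟨hw.1, v, hv, hvw⟩

theorem exists_spares (H : V → W → Prop) [Nonempty W] {Y : Finset V} {U : Finset W} {a b D : ℕ}
    (hD : 0 < D)
    (h3 : ∀ S ⊆ Y, ∀ Q ⊆ U, a ≤ S.card → b ≤ Q.card → ∃ v ∈ S, ∃ w ∈ Q, H v w)
    (hroom : b + Y.card / D ≤ U.card) :
    ∃ (s : V → W) (F : Finset V), F ⊆ Y ∧ F.card ≤ a ∧ (∀ v ∈ Y \ F, H v (s v) ∧ s v ∈ U) ∧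
      ∀ w, ((Y \ F).filter fun v => s v = w).card ≤ D := by
  classical
  set P : ℕ → Prop := fun f => ∃ (s : V → W) (F : Finset V), F ⊆ Y ∧ F.card = f ∧
    (∀ v ∈ Y \ F, H v (s v) ∧ s v ∈ U) ∧ ∀ w, ((Y \ F).filter fun v => s v = w).card ≤ D with hP
  have hex : ∃ f, P f := ⟨Y.card, fun _ => Classical.arbitrary W, Y, subset_rfl, rfl, by simp,
    by simp⟩
  obtain ⟨s, F, hFY, hFc, hs, hfib⟩ := Nat.find_spec hex
  refine ⟨s, F, hFY, ?_, hs, hfib⟩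
  by_contra hlt
  push Not at hlt
  set Sat := U.filter fun w => ((Y \ F).filter fun v => s v = w).card = D with hSat
  have hsat : Sat.card ≤ Y.card / D := by
    rw [Nat.le_div_iff_mul_le hD]
    calc Sat.card * D = ∑ w ∈ Sat, ((Y \ F).filter fun v => s v = w).card := by
          rw [Finset.sum_const_nat fun w hw => (Finset.mem_filter.1 hw).2]
      _ ≤ (Y \ F).card := by
          rw [Finset.card_eq_sum_card_fiberwise (f := s) (t := U) fun v hv =>
            (hs v (Finset.mem_coe.1 hv)).2]
          exact Finset.sum_le_sum_of_subset (Finset.filter_subset _ _)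
      _ ≤ Y.card := Finset.card_le_card Finset.sdiff_subset
  have hQ : b ≤ (U \ Sat).card := by
    have := Finset.card_sdiff_add_card_eq_card (s := Sat) (t := U) (Finset.filter_subset _ _)
    omega
  obtain ⟨v, hv, w, hw, hvw⟩ := h3 F hFY _ Finset.sdiff_subset hlt.le hQ
  rw [Finset.mem_sdiff] at hw
  have hwD : ((Y \ F).filter fun v => s v = w).card < D :=
    lt_of_le_of_ne (hfib w) fun e => hw.2 (Finset.mem_filter.2 ⟨hw.1, e⟩)
  have hne : ∀ u ∈ Y \ F, u ≠ v := fun u hu e => (Finset.mem_sdiff.1 hu).2 (e ▸ hv)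
  have hYF : Y \ F.erase v = insert v (Y \ F) := by
    ext u
    have := hFY hv
    by_cases e : u = v
    · subst e; simp [this]
    · simp [e]
  refine Nat.find_min hex (m := F.card - 1) (by
    rw [← hFc]; have := Finset.card_pos.2 ⟨v, hv⟩; omega)
    ⟨Function.update s v w, F.erase v, (Finset.erase_subset _ _).trans hFY,
      Finset.card_erase_of_mem hv, ?_, ?_⟩
  · intro u hu
    rw [hYF, Finset.mem_insert] at hu
    rcases hu with rfl | hu
    · simpa using ⟨hvw, hw.1⟩
    · rw [Function.update_of_ne (hne u hu)]
      exact hs u hu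
  · intro w'
    rw [hYF, Finset.filter_insert, Function.update_self]
    have e : ((Y \ F).filter fun u => Function.update s v w u = w') =
        (Y \ F).filter fun u => s u = w' :=
      Finset.filter_congr fun u hu => by rw [Function.update_of_ne (hne u hu)]
    rw [e]
    split_ifs with hww
    · subst hww
      exact (Finset.card_insert_le _ _).trans hwD
    · exact hfib w'

theorem exists_matching_and_spares (H : V → W → Prop) [Nonempty W] {Y : Finset V}
    {W' : Finset W} {a b D : ℕ} (hD : 0 < D)
    (h1 : ∀ v ∈ Y, ∃ w ∈ W', H v w)
    (h2 : ∀ S ⊆ Y, ∀ T ⊆ W', 2 ≤ S.card → S.card < a → T.card + 1 = S.card →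
      (∀ w ∈ T, ∃ v ∈ S, ∃ v' ∈ S, v ≠ v' ∧ H v w ∧ H v' w) → ∃ v ∈ S, ∃ w ∈ W' \ T, H v w)
    (h3 : ∀ S ⊆ Y, ∀ Q ⊆ W', a ≤ S.card → b ≤ Q.card → ∃ v ∈ S, ∃ w ∈ Q, H v w)
    (hroom : Y.card + b + Y.card / D ≤ W'.card) :
    ∃ (M s : V → W) (F : Finset V), F.card ≤ a ∧
      (∀ v ∈ Y, H v (M v) ∧ M v ∈ W') ∧ Set.InjOn M Y ∧
      (∀ v ∈ Y \ F, H v (s v) ∧ s v ∈ W' ∧ ∀ v' ∈ Y, s v ≠ M v') ∧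
      ∀ w, ((Y \ F).filter fun v => s v = w).card ≤ D := by
  classical
  obtain ⟨f, hf, hf'⟩ := (Finset.all_card_le_biUnion_card_iff_exists_injective
    fun v : {v // v ∈ Y} => W'.filter (H v)).1 (by
      intro S
      have := card_le_card_neighbours H h1 h2 h3 ((Nat.le_add_right _ _).trans hroom)
        (S := S.map (Function.Embedding.subtype _)) (by
          intro v hv
          obtain ⟨u, -, rfl⟩ := Finset.mem_map.1 hv
          exact u.2)
      rw [Finset.card_map] at this
      refine this.trans_eq (congrArg _ ?_)
      ext w
      simp)
  set M : V → W := fun v => if h : v ∈ Y then f ⟨v, h⟩ else Classical.arbitrary W with hM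
  have Mval : ∀ v (h : v ∈ Y), M v = f ⟨v, h⟩ := fun v h => dif_pos h
  have Minj : Set.InjOn M Y := fun v hv v' hv' e => by
    rw [Mval v hv, Mval v' hv'] at e
    exact congrArg Subtype.val (hf e)
  have MW : Y.image M ⊆ W' := fun w hw => by
    obtain ⟨v, hv, rfl⟩ := Finset.mem_image.1 hw
    rw [Mval v hv]
    exact (Finset.mem_filter.1 (hf' ⟨v, hv⟩)).1
  obtain ⟨s, F, hFY, hFa, hs, hfib⟩ := exists_spares H (Y := Y) (U := W' \ Y.image M) hD
    (fun S hS Q hQ => h3 S hS Q (hQ.trans Finset.sdiff_subset)) (by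
      have := Finset.card_sdiff_add_card_eq_card MW
      rw [Finset.card_image_of_injOn Minj] at this
      omega)
  refine ⟨M, s, F, hFa, fun v hv => ?_, Minj, fun v hv => ?_, hfib⟩
  · rw [Mval v hv]
    exact (Finset.mem_filter.1 (hf' ⟨v, hv⟩)).symm
  · have := hs v hv
    rw [Finset.mem_sdiff] at this
    exact ⟨this.1, this.2.1, fun v' hv' e => this.2.2 (e ▸ Finset.mem_image_of_mem M hv')⟩

end Hall

/-! ### Random bipartite graphs -/

section Bipartite

variable {V W : Type*} [Fintype V] [DecidableEq V] [Fintype W] [DecidableEq W] {π : ℝ}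

theorem pr_min_degree (h0 : 0 ≤ π) (h1 : π ≤ 1) (Y : Finset V) (W' : Finset W) :
    pr (prodWeight fun _ : V × W => bern π) (fun h => ∀ v ∈ Y, ∃ w ∈ W', h (v, w) = true) =
      (1 - (1 - π) ^ W'.card) ^ Y.card := by
  have e : pr (prodWeight fun _ : V × W => bern π)
      (fun h => ∀ v ∈ Y, ∃ w ∈ W', h (v, w) = true) =
      pr (prodWeight fun _ : V => prodWeight fun _ : W => bern π)
        (fun h => ∀ v, v ∈ Y → ∃ w ∈ W', h v w = true) :=
    expect_curry (fun _ => bern π) fun h => ind (∀ v, v ∈ Y → ∃ w ∈ W', h v w = true)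
  rw [e, pr_prodWeight_forall (fun _ : V => prodWeight fun _ : W => bern π)
    fun v x => v ∈ Y → ∃ w ∈ W', x w = true]
  have hp : IsProb (prodWeight fun _ : W => bern π) :=
    isProb_prodWeight fun _ => isProb_bern h0 h1
  have e2 : ∀ v, pr (prodWeight fun _ : W => bern π) (fun x => v ∈ Y → ∃ w ∈ W', x w = true) =
      if v ∈ Y then 1 - (1 - π) ^ W'.card else 1 := by
    intro v
    split_ifs with hv
    · rw [← pr_bern_exists h0 h1]
      exact pr_congr fun x => by simp [hv]
    · exact pr_of_forall hp fun x hx => absurd hx hv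
  simp only [e2]
  rw [Finset.prod_ite_mem, Finset.univ_inter, Finset.prod_const]

theorem pr_no_edges_le (h0 : 0 ≤ π) (h1 : π ≤ 1) (Y : Finset V) (W' : Finset W) (a b : ℕ) :
    pr (prodWeight fun _ : V × W => bern π) (fun h => ∃ S ⊆ Y, ∃ Q ⊆ W', a ≤ S.card ∧
      b ≤ Q.card ∧ ∀ v ∈ S, ∀ w ∈ Q, h (v, w) = false) ≤
      2 ^ Y.card * 2 ^ W'.card * (1 - π) ^ (a * b) := by
  have hp : IsProb (prodWeight fun _ : V × W => bern π) :=
    isProb_prodWeight fun _ => isProb_bern h0 h1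
  set X := (Y.powerset ×ˢ W'.powerset).filter fun x => a ≤ x.1.card ∧ b ≤ x.2.card with hX
  calc _ ≤ pr (prodWeight fun _ : V × W => bern π)
        (fun h => ∃ x ∈ X, ∀ y ∈ x.1 ×ˢ x.2, h y = false) := by
        refine pr_mono hp fun h => ?_
        rintro ⟨S, hS, Q, hQ, ha, hb, hh⟩
        refine ⟨(S, Q), by simp [hX, hS, hQ, ha, hb], fun y hy => ?_⟩
        rw [Finset.mem_product] at hy
        exact hh y.1 hy.1 y.2 hy.2
    _ ≤ ∑ x ∈ X, (1 - π) ^ (a * b) := by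
        refine (pr_exists_le hp X _).trans (Finset.sum_le_sum fun x hx => ?_)
        rw [pr_bern_absent h0 h1, Finset.card_product]
        rw [hX, Finset.mem_filter] at hx
        exact pow_le_pow_of_le_one (by linarith) (by linarith) (Nat.mul_le_mul hx.2.1 hx.2.2)
    _ ≤ _ := by
        rw [Finset.sum_const, nsmul_eq_mul]
        have : (X.card : ℝ) ≤ 2 ^ Y.card * 2 ^ W'.card := by
          have := Finset.card_filter_le (Y.powerset ×ˢ W'.powerset)
            fun x => a ≤ x.1.card ∧ b ≤ x.2.card
          rw [Finset.card_product, Finset.card_powerset, Finset.card_powerset] at this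
          exact_mod_cast this
        exact mul_le_mul_of_nonneg_right this (pow_nonneg (by linarith) _)

theorem pr_violator_le (h0 : 0 ≤ π) (h1 : π ≤ 1) (S : Finset V) (T W' : Finset W)
    (hT : T ⊆ W') :
    pr (prodWeight fun _ : V × W => bern π) (fun h =>
      (∀ w ∈ T, ∃ v ∈ S, ∃ v' ∈ S, v ≠ v' ∧ h (v, w) = true ∧ h (v', w) = true) ∧
      ∀ v ∈ S, ∀ w ∈ W' \ T, h (v, w) = false) ≤
      ((S.card : ℝ) * π) ^ (2 * T.card) * (1 - π) ^ (S.card * (W'.card - T.card)) := by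
  have hp : IsProb (prodWeight fun _ : V × W => bern π) :=
    isProb_prodWeight fun _ => isProb_bern h0 h1
  set G := Fintype.piFinset fun _ : {w // w ∈ T} => S.offDiag with hG
  set j : ({w // w ∈ T} → V × V) → {w // w ∈ T} × Bool → V × W :=
    fun g x => (if x.2 then (g x.1).1 else (g x.1).2, x.1) with hj
  calc _ ≤ pr (prodWeight fun _ : V × W => bern π) (fun h => ∃ g ∈ G,
        (∀ y ∈ Finset.univ.image (j g), h y = true) ∧ ∀ y ∈ S ×ˢ (W' \ T), h y = false) := by
        refine pr_mono hp fun h => ?_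
        rintro ⟨hh1, hh2⟩
        choose v hv v' hv' hne e e' using hh1
        refine ⟨fun w => (v w w.2, v' w w.2), ?_, ?_, fun y hy => ?_⟩
        · rw [hG, Fintype.mem_piFinset]
          exact fun w => Finset.mem_offDiag.2 ⟨hv _ _, hv' _ _, hne _ _⟩
        · intro y hy
          obtain ⟨⟨w, b⟩, -, rfl⟩ := Finset.mem_image.1 hy
          cases b
          · simpa [hj] using e' w w.2
          · simpa [hj] using e w w.2
        · rw [Finset.mem_product] at hy
          exact hh2 _ hy.1 _ hy.2
    _ ≤ ∑ g ∈ G, π ^ (2 * T.card) * (1 - π) ^ (S.card * (W'.card - T.card)) := by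
        refine (pr_exists_le hp G _).trans (Finset.sum_le_sum fun g hg => ?_)
        rw [hG, Fintype.mem_piFinset] at hg
        have hinj : Function.Injective (j g) := by
          rintro ⟨w, b⟩ ⟨w', b'⟩ e
          obtain ⟨e1, e2⟩ := Prod.mk.inj e
          have e3 : w = w' := Subtype.ext e2
          subst e3
          have hne := (Finset.mem_offDiag.1 (hg w)).2.2
          cases b <;> cases b'
          · rfl
          · exact absurd (show (g w).1 = (g w).2 from e1.symm) hne
          · exact absurd (show (g w).1 = (g w).2 from e1) hne
          · rfl
        rw [pr_bern_present_absent h0 h1, Finset.card_image_of_injective _ hinj,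
          Finset.card_product, Finset.card_sdiff_of_subset hT]
        · simp [mul_comm]
        · rw [Finset.disjoint_left]
          intro y hy hy'
          obtain ⟨⟨w, b⟩, -, rfl⟩ := Finset.mem_image.1 hy
          exact (Finset.mem_sdiff.1 (Finset.mem_product.1 hy').2).2 w.2
    _ ≤ _ := by
        rw [Finset.sum_const, nsmul_eq_mul, mul_pow, mul_assoc]
        refine mul_le_mul_of_nonneg_right ?_ (mul_nonneg (pow_nonneg h0 _)
          (pow_nonneg (by linarith) _))
        rw [hG, Fintype.card_piFinset, Finset.prod_const, Finset.offDiag_card, pow_mul]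
        push_cast
        simp only [Finset.card_univ, Fintype.card_coe]
        gcongr
        rw [sq]
        exact_mod_cast Nat.sub_le _ _

/-- The union bound for minimal violations of Hall's condition. -/
noncomputable def violatorBound (π : ℝ) (a y q : ℕ) : ℝ :=
  ∑ s ∈ Finset.Ico 2 a, (y.choose s : ℝ) * (q.choose (s - 1)) *
    ((s * π) ^ (2 * (s - 1)) * (1 - π) ^ (s * (q - (s - 1))))

theorem pr_exists_violator_le (h0 : 0 ≤ π) (h1 : π ≤ 1) (Y : Finset V) (W' : Finset W) (a : ℕ) :
    pr (prodWeight fun _ : V × W => bern π) (fun h =>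
      ∃ S ⊆ Y, ∃ T ⊆ W', 2 ≤ S.card ∧ S.card < a ∧ T.card + 1 = S.card ∧
      (∀ w ∈ T, ∃ v ∈ S, ∃ v' ∈ S, v ≠ v' ∧ h (v, w) = true ∧ h (v', w) = true) ∧
      ∀ v ∈ S, ∀ w ∈ W' \ T, h (v, w) = false) ≤ violatorBound π a Y.card W'.card := by
  have hp : IsProb (prodWeight fun _ : V × W => bern π) :=
    isProb_prodWeight fun _ => isProb_bern h0 h1
  calc _ ≤ pr (prodWeight fun _ : V × W => bern π) (fun h =>
        ∃ s ∈ Finset.Ico 2 a, ∃ x ∈ Y.powersetCard s ×ˢ W'.powersetCard (s - 1),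
        (∀ w ∈ x.2, ∃ v ∈ x.1, ∃ v' ∈ x.1, v ≠ v' ∧ h (v, w) = true ∧ h (v', w) = true) ∧
        ∀ v ∈ x.1, ∀ w ∈ W' \ x.2, h (v, w) = false) := by
        refine pr_mono hp fun h => ?_
        rintro ⟨S, hS, T, hT, e1, e2, e3, e4, e5⟩
        refine ⟨S.card, Finset.mem_Ico.2 ⟨e1, e2⟩, (S, T), ?_, e4, e5⟩
        rw [Finset.mem_product, Finset.mem_powersetCard, Finset.mem_powersetCard]
        exact ⟨⟨hS, rfl⟩, hT, by simp only; omega⟩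
    _ ≤ _ := by
        refine (pr_exists_le hp _ _).trans (Finset.sum_le_sum fun s hs => ?_)
        calc _ ≤ ∑ x ∈ Y.powersetCard s ×ˢ W'.powersetCard (s - 1),
              ((s * π) ^ (2 * (s - 1)) * (1 - π) ^ (s * (W'.card - (s - 1)))) := by
              refine (pr_exists_le hp _ _).trans (Finset.sum_le_sum fun x hx => ?_)
              rw [Finset.mem_product, Finset.mem_powersetCard, Finset.mem_powersetCard] at hx
              have := pr_violator_le h0 h1 x.1 x.2 W' hx.2.1
              rwa [hx.1.2, hx.2.2] at this
          _ = _ := by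
              rw [Finset.sum_const, nsmul_eq_mul, Finset.card_product, Finset.card_powersetCard,
                Finset.card_powersetCard]
              push_cast
              ring

/-- Good configurations with independent tails: the bound combining all exceptional events. -/
theorem pr_good_pairs_ge (h0 : 0 ≤ π) (h1 : π ≤ 1) [Nonempty W] {A Λ : Finset V} {C : Finset W}
    [Nonempty {t // t ∉ A}] {d y q a b D : ℕ} {β : ℝ}
    (hd : Fintype.card {t // t ∉ A} = d) (hy : (A ∪ Λ)ᶜ.card = y) (hq : Cᶜ.card = q)
    (had : a < d) (hyd : y < d) (hβ : 0 < β) (hD : 0 < D) (hroom : y + b + y / D ≤ q) :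
    (1 - (1 - π) ^ q) ^ y - violatorBound π a y q - 2 ^ y * 2 ^ q * (1 - π) ^ (a * b) -
      (a / (d - a) + y * D / (d - y) ^ 2 + (y * (d / (d - y) ^ 2) / β + β ^ 2 / d)) ≤
      pr (prodWeight fun _ : V × W => fun x : Bool × {t // t ∉ A} =>
          bern π x.1 * unif {t // t ∉ A} x.2)
        (fun x => Good (fun t v w => (x (v, w)).1 = true ∧ ((x (v, w)).2 : V) = t) A Λ C) := by
  classical
  have hp : IsProb (prodWeight fun _ : V × W => bern π) :=
    isProb_prodWeight fun _ => isProb_bern h0 h1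
  have hq' : IsProb (prodWeight fun _ : V × W => unif {t // t ∉ A}) :=
    isProb_prodWeight fun _ => isProb_unif _
  set Y : Finset V := (A ∪ Λ)ᶜ with hYdef
  have memY : ∀ v, v ∈ Y ↔ v ∉ A ∧ v ∉ Λ := fun v => by simp [hYdef]
  set B : ℝ := a / (d - a) + y * D / (d - y) ^ 2 + (y * (d / (d - y) ^ 2) / β + β ^ 2 / d) with hB
  have had' : (a : ℝ) < d := by exact_mod_cast had
  have hyd' : (y : ℝ) < d := by exact_mod_cast hyd
  have hB0 : 0 ≤ B := by
    have : (0 : ℝ) < d - a := by linarith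
    positivity
  set bad : (V × W → Bool) → Prop := fun h =>
    (∃ S ⊆ Y, ∃ T ⊆ Cᶜ, 2 ≤ S.card ∧ S.card < a ∧ T.card + 1 = S.card ∧
      (∀ w ∈ T, ∃ v ∈ S, ∃ v' ∈ S, v ≠ v' ∧ h (v, w) = true ∧ h (v', w) = true) ∧
      ∀ v ∈ S, ∀ w ∈ Cᶜ \ T, h (v, w) = false) ∨
    ∃ S ⊆ Y, ∃ Q ⊆ Cᶜ, a ≤ S.card ∧ b ≤ Q.card ∧ ∀ v ∈ S, ∀ w ∈ Q, h (v, w) = false with hbad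
  have hprbad : pr (prodWeight fun _ : V × W => bern π) bad ≤
      violatorBound π a y q + 2 ^ y * 2 ^ q * (1 - π) ^ (a * b) := by
    refine (pr_or_le hp _ _).trans (add_le_add ?_ ?_)
    · have := pr_exists_violator_le h0 h1 Y Cᶜ a
      rwa [hy, hq] at this
    · have := pr_no_edges_le h0 h1 Y Cᶜ a b
      rwa [hy, hq] at this
  have hdeg := pr_min_degree h0 h1 Y Cᶜ
  rw [hy, hq] at hdeg
  set deg : (V × W → Bool) → Prop := fun h => ∀ v ∈ Y, ∃ w ∈ Cᶜ, h (v, w) = true with hdegdef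
  have hsplit : pr (prodWeight fun _ : V × W => bern π) deg ≤
      pr (prodWeight fun _ : V × W => bern π) (fun h => deg h ∧ ¬ bad h) +
      pr (prodWeight fun _ : V × W => bern π) bad :=
    pr_le_add_of_imp hp fun h hh =>
      (Classical.em (bad h)).elim Or.inr fun hb => Or.inl ⟨hh, hb⟩
  have hexp : pr (prodWeight fun _ : V × W => fun x : Bool × {t // t ∉ A} =>
          bern π x.1 * unif {t // t ∉ A} x.2)
        (fun x => Good (fun t v w => (x (v, w)).1 = true ∧ ((x (v, w)).2 : V) = t) A Λ C) =
      expect (prodWeight fun _ : V × W => bern π) fun h =>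
        pr (prodWeight fun _ : V × W => unif {t // t ∉ A}) fun t =>
          Good (fun t' v w => h (v, w) = true ∧ (t (v, w) : V) = t') A Λ C :=
    expect_pairs (fun _ : V × W => bern π) (fun _ : V × W => unif {t // t ∉ A}) _
  rw [hexp]
  have hlow : pr (prodWeight fun _ : V × W => bern π) (fun h => deg h ∧ ¬ bad h) - B ≤
      expect (prodWeight fun _ : V × W => bern π) fun h =>
        pr (prodWeight fun _ : V × W => unif {t // t ∉ A}) fun t =>
          Good (fun t' v w => h (v, w) = true ∧ (t (v, w) : V) = t') A Λ C := by
    have e : pr (prodWeight fun _ : V × W => bern π) (fun h => deg h ∧ ¬ bad h) - B =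
        expect (prodWeight fun _ : V × W => bern π) (fun h => ind (deg h ∧ ¬ bad h) + -B) := by
      rw [expect_add, expect_const hp]
      rfl
    rw [e]
    refine expect_mono hp fun h => ?_
    by_cases hh : deg h ∧ ¬ bad h
    swap
    · rw [ind_of_false hh]
      have := pr_nonneg hq' (A := fun t =>
        Good (fun t' v w => h (v, w) = true ∧ (t (v, w) : V) = t') A Λ C)
      linarith
    rw [ind_of_true hh]
    obtain ⟨hh1, hh2⟩ := hh
    simp only [hbad, not_or] at hh2
    obtain ⟨n1, n2⟩ := hh2
    push Not at n1 n2
    obtain ⟨M, s, F, hFa, hM, hMinj, hs, hfib⟩ := exists_matching_and_spares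
      (fun v w => h (v, w) = true) (Y := Y) (W' := Cᶜ) (a := a) (b := b) hD hh1
      (fun S hS T hT e1 e2 e3 e4 => by
        obtain ⟨v, hv, w, hw, e⟩ := n1 S hS T hT e1 e2 e3 e4
        exact ⟨v, hv, w, hw, by simpa using e⟩)
      (fun S hS Q hQ e1 e2 => by
        obtain ⟨v, hv, w, hw, e⟩ := n2 S hS Q hQ e1 e2
        exact ⟨v, hv, w, hw, by simpa using e⟩) (by rw [hy, hq]; exact hroom)
    have hFa' : (F.card : ℝ) ≤ a := by exact_mod_cast hFa
    have key := pr_good_tails_ge (A := A) (Λ := Λ) (F := F) (C := C) (h := h) (M := M) (s := s)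
      (d := d) (Y := y) (K := y * D) (β := β) (by rw [hd]) (by rw [← hYdef, hy])
      (fun v e1 e2 => by
        have := hM v ((memY v).2 ⟨e1, e2⟩)
        exact ⟨this.1, Finset.mem_compl.1 this.2⟩)
      (fun v v' e1 e2 e3 e4 e => hMinj ((memY v).2 ⟨e1, e2⟩) ((memY v').2 ⟨e3, e4⟩) e)
      (fun v e1 e2 e3 => by
        have := hs v (Finset.mem_sdiff.2 ⟨(memY v).2 ⟨e1, e2⟩, e3⟩)
        exact ⟨this.1, Finset.mem_compl.1 this.2.1, fun v' e4 e5 =>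
          this.2.2 v' ((memY v').2 ⟨e4, e5⟩)⟩)
      (by linarith) hyd' hβ (by
        rw [Finset.card_eq_sum_card_fiberwise (f := Prod.fst) (t := Y) (fun x hx => by
          have := (Finset.mem_filter.1 (Finset.mem_coe.1 hx)).2.1
          exact (memY _).2 ⟨this.1, this.2.1⟩), ← hy]
        have h3 := Finset.sum_le_card_nsmul Y _ D fun v hv => le_trans
          (Finset.card_le_card_of_injOn (s := Finset.filter (fun x : V × V => x.1 = v)
              (Finset.univ.filter fun x => (x.1 ∉ A ∧ x.1 ∉ Λ ∧ x.1 ∉ F) ∧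
                (x.2 ∉ A ∧ x.2 ∉ Λ ∧ x.2 ∉ F) ∧ s x.1 = s x.2)) Prod.snd (by
            intro x hx
            have hx' := Finset.mem_filter.1 (Finset.mem_coe.1 hx)
            have hx2 := (Finset.mem_filter.1 hx'.1).2
            refine Finset.mem_coe.2 (Finset.mem_filter.2 ⟨Finset.mem_sdiff.2
              ⟨(memY _).2 ⟨hx2.2.1.1, hx2.2.1.2.1⟩, hx2.2.1.2.2⟩, ?_⟩)
            rw [← hx2.2.2, hx'.2]) (by
            intro x hx x' hx' e
            have e1 := (Finset.mem_filter.1 (Finset.mem_coe.1 hx)).2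
            have e2 := (Finset.mem_filter.1 (Finset.mem_coe.1 hx')).2
            exact Prod.ext (e1.trans e2.symm) e)) (hfib (s v))
        rw [smul_eq_mul] at h3
        exact_mod_cast h3)
    refine le_trans ?_ key
    have : (F.card : ℝ) / (d - F.card) ≤ a / (d - a) := by
      have : (0 : ℝ) < d - a := by linarith
      gcongr
    linarith
  linarith

end Bipartite

section RootedBound

variable {V W : Type*} [Fintype V] [DecidableEq V] [Fintype W] [DecidableEq W]

/-- The lower bound for the probability of completing a configuration with `k` vertices removed,
`k + 1` active vertices and `2 * k` used colours, on `n` vertices and `q` colours. -/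
noncomputable def completionBound (ρ β : ℝ) (n q k a b D : ℕ) : ℝ :=
  (1 - ((1 - ρ) ^ (n - k)) ^ (q - 2 * k)) ^ (n - (2 * k + 1)) -
    violatorBound (1 - (1 - ρ) ^ (n - k)) a (n - (2 * k + 1)) (q - 2 * k) -
    2 ^ (n - (2 * k + 1)) * 2 ^ (q - 2 * k) * ((1 - ρ) ^ (n - k)) ^ (a * b) -
    (a / ((n - k : ℕ) - a) + (n - (2 * k + 1) : ℕ) * D / (k + 1) ^ 2 +
      ((n - (2 * k + 1) : ℕ) * ((n - k : ℕ) / (k + 1) ^ 2) / β + β ^ 2 / (n - k : ℕ)))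

theorem goodProb_ge_completionBound [Nonempty W] {ρ β : ℝ} (hρ0 : 0 ≤ ρ) (hρ1 : ρ ≤ 1)
    {n q k a b D : ℕ} (hn : Fintype.card V = n) (hq : Fintype.card W = q) (hkn : 2 * k + 1 ≤ n)
    (hak : a + k < n) (hβ : 0 < β) (hD : 0 < D)
    (hroom : n - (2 * k + 1) + b + (n - (2 * k + 1)) / D ≤ q - 2 * k)
    {A Λ : Finset V} {C : Finset W} (hAΛ : Disjoint A Λ) (hA : A.card = k) (hΛ : Λ.card = k + 1)
    (hC : C.card = 2 * k) : completionBound ρ β n q k a b D ≤ goodProb ρ A Λ C := by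
  have hd : Fintype.card {t // t ∉ A} = n - k := by
    rw [Fintype.card_subtype_compl, Fintype.card_coe, hn, hA]
  have : Nonempty {t // t ∉ A} := by
    rw [← Fintype.card_pos_iff]; omega
  have hy : (A ∪ Λ)ᶜ.card = n - (2 * k + 1) := by
    rw [Finset.card_compl, Finset.card_union_of_disjoint hAΛ, hn, hA, hΛ]; congr 1; omega
  have hqc : Cᶜ.card = q - 2 * k := by rw [Finset.card_compl, hq, hC]
  have hp0 : 0 ≤ (1 - ρ) ^ (n - k) := pow_nonneg (by linarith) _
  have hp1 : (1 - ρ) ^ (n - k) ≤ 1 := pow_le_one₀ (by linarith) (by linarith)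
  have h1 := pr_good_pairs_ge (π := 1 - (1 - ρ) ^ (n - k)) (by linarith) (by linarith) hd hy hqc
    (a := a) (b := b) (by omega) (by omega) hβ hD hroom
  have h2 := pr_good_le_tails hρ0 hρ1 A Λ C hd
  refine le_trans (le_of_eq ?_) (h1.trans h2)
  have e : ((n - k : ℕ) : ℝ) - (n - (2 * k + 1) : ℕ) = k + 1 := by
    rw [Nat.cast_sub (by omega), Nat.cast_sub (by omega)]
    push_cast
    ring
  rw [completionBound, e, sub_sub_cancel]

theorem goodProb_root_ge [Nonempty W] {ρ β : ℝ} (hρ0 : 0 ≤ ρ) (hρ1 : ρ ≤ 1)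
    {n q k a b D : ℕ} (hn : Fintype.card V = n) (hq : Fintype.card W = q) (hkn : 2 * k + 1 ≤ n)
    (hak : a + k < n) (hβ : 0 < β) (hD : 0 < D)
    (hroom : n - (2 * k + 1) + b + (n - (2 * k + 1)) / D ≤ q - 2 * k)
    (hη : (1 + n * q * ρ) * (1 - ρ) ^ ((n - 2 * k) * (q - 2 * k)) ≤ 1)
    (hpos : 0 ≤ completionBound ρ β n q k a b D) (u : V) :
    (1 - (1 + n * q * ρ) * (1 - ρ) ^ ((n - 2 * k) * (q - 2 * k))) ^ k *
      completionBound ρ β n q k a b D ≤ goodProb ρ ∅ {u} (∅ : Finset W) := by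
  subst hn hq
  exact goodProb_singleton_ge hρ0 hρ1 k hpos hη (fun A Λ C h1 h2 h3 h4 =>
    goodProb_ge_completionBound hρ0 hρ1 rfl rfl hkn hak hβ hD hroom h1 h2 h3 h4) u

end RootedBound

/-! ### The binomial random digraph with uniformly random colours -/

section Binomial

variable {n : ℕ} {W : Type*}

/-- The law of one potential edge: present with probability `p`, with a uniform colour. -/
noncomputable def edgeLaw (W : Type*) [Fintype W] (p : ℝ) (x : Bool × W) : ℝ :=
  bern p x.1 * unif W x.2

/-- The present edges span a rainbow arborescence. -/
def HasRainbow (x : DEdge n → Bool × W) : Prop :=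
  ∃ (u : Fin n) (A : Set (DEdge n)), (∀ e ∈ A, (x e).1 = true) ∧ IsSpanningArborescence A u ∧
    Set.InjOn (fun e => (x e).2) A

/-- No present edge enters `v`. -/
def NoInEdge (x : DEdge n → Bool × W) (v : Fin n) : Prop :=
  ∀ e : DEdge n, e.val.2 = v → (x e).1 = false

/-- There is a rainbow choice of in-edges reaching every vertex from `u`. -/
def RootedGood (x : DEdge n → Bool × W) (u : Fin n) : Prop :=
  Good (fun t v w => ∃ h : t ≠ v, (x ⟨(t, v), h⟩).1 = true ∧ (x ⟨(t, v), h⟩).2 = w) ∅ {u} ∅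

theorem not_reach_of_fixed {V : Type*} {par : V → V} {Λ : Finset V} {v : V} (h : par v = v)
    (hv : v ∉ Λ) : ¬ Reach par Λ v := by
  rintro ⟨i, hi⟩
  rw [Function.iterate_fixed h] at hi
  exact hv hi

theorem RootedGood.hasRainbow {x : DEdge n → Bool × W} {u : Fin n} (h : RootedGood x u) :
    HasRainbow x := by
  obtain ⟨par, col, h1, h2⟩ := h
  have hu : ∀ {v}, v ≠ u → v ∉ ({u} : Finset (Fin n)) := fun hv => by simpa using hv
  have hP := fun v (hv : v ≠ u) => h1 v (Finset.notMem_empty v) (hu hv)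
  refine ⟨u, {e | e.val.2 ≠ u ∧ e.val.1 = par e.val.2}, ?_, ⟨fun e he => he.1, ?_, ?_⟩, ?_⟩
  · rintro ⟨⟨t, v⟩, htv⟩ ⟨hv, ht⟩
    change v ≠ u at hv
    change t = par v at ht
    subst ht
    exact (hP v hv).1.choose_spec.1
  · intro v hv
    obtain ⟨⟨hne, -⟩, -⟩ := hP v hv
    refine ⟨⟨(par v, v), hne⟩, ⟨⟨hv, rfl⟩, rfl⟩, ?_⟩
    rintro ⟨⟨t, v'⟩, ht⟩ ⟨⟨h3, h4⟩, h5⟩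
    simp only at h4 h5
    subst h5
    subst h4
    rfl
  · intro v
    by_cases hv : v = u
    · subst hv; exact Relation.ReflTransGen.refl
    refine Reach.induction (P := fun v => Relation.ReflTransGen _ u v) ?_ ?_ (hP v hv).2.2.2
    · intro v hv
      rw [Finset.mem_singleton] at hv
      subst hv
      exact Relation.ReflTransGen.refl
    · intro v hv _ ih
      have hv' : v ≠ u := by simpa using hv
      obtain ⟨⟨hne, -⟩, -⟩ := hP v hv'
      exact ih.tail ⟨⟨(par v, v), hne⟩, ⟨hv', rfl⟩, rfl⟩
  · rintro ⟨⟨t, v⟩, htv⟩ ⟨hv, ht⟩ ⟨⟨t', v'⟩, htv'⟩ ⟨hv', ht'⟩ e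
    change v ≠ u at hv
    change v' ≠ u at hv'
    change t = par v at ht
    change t' = par v' at ht'
    subst ht ht'
    change (x ⟨(par v, v), htv⟩).2 = (x ⟨(par v', v'), htv'⟩).2 at e
    rw [(hP v hv).1.choose_spec.2, (hP v' hv').1.choose_spec.2] at e
    have := h2 v v' (Finset.notMem_empty v) (hu hv) (Finset.notMem_empty v') (hu hv') e
    subst this
    rfl

theorem RootedGood.not_noInEdge {x : DEdge n → Bool × W} {u v : Fin n} (h : RootedGood x u)
    (hv : v ≠ u) : ¬ NoInEdge x v := by
  obtain ⟨par, col, h1, -⟩ := h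
  obtain ⟨⟨hne, h2, -⟩, -⟩ := h1 v (Finset.notMem_empty v) (by simpa using hv)
  intro h3
  rw [h3 _ rfl] at h2
  exact absurd h2 (by simp)

variable [Fintype W]

theorem isProb_edgeLaw [Nonempty W] {p : ℝ} (h0 : 0 ≤ p) (h1 : p ≤ 1) :
    IsProb (edgeLaw W p) where
  nonneg x := mul_nonneg ((isProb_bern h0 h1).nonneg _) ((isProb_unif W).nonneg _)
  sum_one := by
    rw [Fintype.sum_prod_type]
    simp only [edgeLaw, ← Finset.mul_sum, (isProb_unif W).sum_one, mul_one]
    exact (isProb_bern h0 h1).sum_one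

theorem pr_edgeLaw_absent [Nonempty W] (p : ℝ) :
    pr (edgeLaw W p) (fun x => x.1 = false) = 1 - p := by
  rw [← pr_bern_false p]
  simp only [pr, expect, edgeLaw]
  rw [Fintype.sum_prod_type]
  refine Finset.sum_congr rfl fun b _ => ?_
  simp only
  rw [← Finset.sum_mul, ← Finset.mul_sum, (isProb_unif W).sum_one, mul_one]

theorem pr_noInEdge [Nonempty W] {p : ℝ} (h0 : 0 ≤ p) (h1 : p ≤ 1) (v : Fin n) :
    pr (prodWeight fun _ : DEdge n => edgeLaw W p) (fun x => NoInEdge x v) =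
      (1 - p) ^ (n - 1) := by
  set j : {t // t ≠ v} → DEdge n := fun t => ⟨(t, v), t.2⟩ with hj
  have hinj : Function.Injective j := fun t t' e =>
    Subtype.ext (congrArg (fun e : DEdge n => e.val.1) e)
  have h := pr_prodWeight_cylinder (μ := fun _ : DEdge n => edgeLaw W p)
    (fun _ => isProb_edgeLaw h0 h1) j hinj fun _ x => x.1 = false
  simp only [pr_edgeLaw_absent, Finset.prod_const, Finset.card_univ] at h
  rw [Fintype.card_subtype_compl, Fintype.card_subtype_eq, Fintype.card_fin] at h
  rw [← h]
  refine pr_congr fun x => ⟨fun hx t => hx _ rfl, ?_⟩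
  rintro hx ⟨⟨t, w⟩, htw⟩ rfl
  exact hx ⟨t, htw⟩

theorem pr_subsingleton_noInEdge_le [Nonempty W] {p : ℝ} (h0 : 0 ≤ p) (h1 : p ≤ 1) :
    pr (prodWeight fun _ : DEdge n => edgeLaw W p)
      (fun x => Set.Subsingleton {v | NoInEdge x v}) ≤
      (1 - (1 - p) ^ (n - 1)) ^ n +
        n * ((1 - p) ^ (n - 1) * (1 - (1 - p) ^ (n - 1)) ^ (n - 1)) := by
  have hE : IsProb (edgeLaw W p) := isProb_edgeLaw h0 h1
  set row : Fin n → (Fin n → Bool × W) → Prop := fun v r => ∀ t, t ≠ v → (r t).1 = false with hrow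
  set R := prodWeight fun _ : Fin n => edgeLaw W p with hR
  have hRp : IsProb R := isProb_prodWeight fun _ => hE
  have hswap : Function.Injective fun e : DEdge n => (e.val.2, e.val.1) := fun e e' h => by
    obtain ⟨h1, h2⟩ := Prod.mk.inj h
    exact Subtype.ext (Prod.ext h2 h1)
  have e1 := expect_comp_injective (μ := fun _ : Fin n × Fin n => edgeLaw W p) (fun _ => hE)
    (fun e : DEdge n => (e.val.2, e.val.1)) hswap
    fun x => ind (Set.Subsingleton {v | NoInEdge x v})
  have hrowiff : ∀ (y : Fin n × Fin n → Bool × W) v,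
      NoInEdge (y ∘ fun e : DEdge n => (e.val.2, e.val.1)) v ↔ row v fun t => y (v, t) := by
    intro y v
    constructor
    · intro h t ht
      exact h ⟨(t, v), ht⟩ rfl
    · rintro h ⟨⟨t, w⟩, htw⟩ rfl
      exact h t htw
  have e2 := expect_curry (fun _ : Fin n × Fin n => edgeLaw W p)
    fun r => ind (Set.Subsingleton {v | row v (r v)})
  have e3 : pr (prodWeight fun _ : DEdge n => edgeLaw W p)
      (fun x => Set.Subsingleton {v | NoInEdge x v}) =
      pr (prodWeight fun _ : Fin n => R) (fun r => Set.Subsingleton {v | row v (r v)}) := by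
    refine e1.symm.trans (Eq.trans ?_ e2)
    simp only [hrowiff]
  have hx : ∀ v, pr R (row v) = (1 - p) ^ (n - 1) := by
    intro v
    have h := pr_prodWeight_cylinder (μ := fun _ : Fin n => edgeLaw W p) (fun _ => hE)
      (fun t : {t // t ≠ v} => (t : Fin n)) Subtype.val_injective fun _ x => x.1 = false
    simp only [pr_edgeLaw_absent, Finset.prod_const, Finset.card_univ] at h
    rw [Fintype.card_subtype_compl, Fintype.card_subtype_eq, Fintype.card_fin] at h
    rw [← h]
    exact pr_congr fun r => ⟨fun hr t => hr t t.2, fun hr t ht => hr ⟨t, ht⟩⟩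
  have hP : IsProb (prodWeight fun _ : Fin n => R) := isProb_prodWeight fun _ => hRp
  rw [e3]
  refine (pr_le_add_of_imp hP (B := fun r => ∀ v, ¬ row v (r v))
    (C := fun r => ∃ v ∈ Finset.univ, ∀ v', if v' = v then row v' (r v') else ¬ row v' (r v'))
    fun r hr => ?_).trans (add_le_add ?_ ?_)
  · by_cases h : ∀ v, ¬ row v (r v)
    · exact Or.inl h
    · push Not at h
      obtain ⟨v, hv⟩ := h
      refine Or.inr ⟨v, Finset.mem_univ v, fun v' => ?_⟩
      split_ifs with e
      · subst e; exact hv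
      · exact fun hv' => e (hr hv' hv)
  · rw [pr_prodWeight_forall (fun _ : Fin n => R) fun v r => ¬ row v r]
    simp only [pr_not hRp, hx, Finset.prod_const, Finset.card_univ, Fintype.card_fin, le_refl]
  · refine (pr_exists_le hP _ _).trans (le_of_eq ?_)
    have : ∀ v, pr (prodWeight fun _ : Fin n => R)
        (fun r => ∀ v', if v' = v then row v' (r v') else ¬ row v' (r v')) =
        (1 - p) ^ (n - 1) * (1 - (1 - p) ^ (n - 1)) ^ (n - 1) := by
      intro v
      rw [pr_prodWeight_forall (fun _ : Fin n => R)
        fun v' r => if v' = v then row v' r else ¬ row v' r,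
        ← Finset.mul_prod_erase _ _ (Finset.mem_univ v)]
      simp only [if_true, hx]
      congr 1
      rw [Finset.prod_congr rfl fun v' hv' => ?_, Finset.prod_const,
        Finset.card_erase_of_mem (Finset.mem_univ v), Finset.card_univ, Fintype.card_fin]
      simp only [if_neg (Finset.ne_of_mem_erase hv'), pr_not hRp, hx]
    simp only [this, Finset.sum_const, Finset.card_univ, Fintype.card_fin, nsmul_eq_mul]

theorem pr_rootedGood_ge [DecidableEq W] [Nonempty W] {p ρ : ℝ} (hp0 : 0 ≤ p) (hp1 : p ≤ 1)
    (hρ0 : 0 ≤ ρ)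
    (hρ1 : ρ ≤ 1) (hpρ : ρ * Fintype.card W ≤ p) (u : Fin n) :
    goodProb ρ ∅ {u} (∅ : Finset W) ≤
      pr (prodWeight fun _ : DEdge n => edgeLaw W p) (fun x => RootedGood x u) := by
  refine (pr_good_le_single hp0 hp1 hρ0 hρ1 hpρ ∅ {u} ∅).trans ?_
  have h := expect_comp_injective (μ := fun _ : Fin n × Fin n => edgeLaw W p)
    (fun _ => isProb_edgeLaw hp0 hp1) (fun e : DEdge n => e.val) Subtype.val_injective
    fun x => ind (RootedGood x u)
  refine le_trans (pr_mono (isProb_prodWeight fun _ => isProb_edgeLaw hp0 hp1) fun y => ?_)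
    h.le
  rintro ⟨par, col, h1, h2⟩
  refine ⟨par, col, fun v hA hv => ?_, h2⟩
  obtain ⟨h3, h4, h5, h6⟩ := h1 v hA hv
  exact ⟨⟨fun e => not_reach_of_fixed e hv h6, h3⟩, h4, h5, h6⟩

theorem pr_hasRainbow_ge [Nonempty W] {p g : ℝ} (hp0 : 0 ≤ p) (hp1 : p ≤ 1) (hn : 0 < n)
    (hg : ∀ u, g ≤ pr (prodWeight fun _ : DEdge n => edgeLaw W p) (fun x => RootedGood x u)) :
    g * (1 + (n - 1) * (1 - p) ^ (n - 1)) ≤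
      pr (prodWeight fun _ : DEdge n => edgeLaw W p) HasRainbow := by
  have hμ : ∀ _ : DEdge n, IsProb (edgeLaw W p) := fun _ => isProb_edgeLaw hp0 hp1
  have hP := isProb_prodWeight hμ
  set x0 := (1 - p) ^ (n - 1) with hx0
  have hx0n : 0 ≤ x0 := pow_nonneg (by linarith) _
  have hx01 : x0 ≤ 1 := pow_le_one₀ (by linarith) (by linarith)
  have indep : ∀ (u : Fin n) (B : Prop → Prop),
      pr (prodWeight fun _ : DEdge n => edgeLaw W p)
        (fun x => B (NoInEdge x u) ∧ RootedGood x u) =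
      pr (prodWeight fun _ : DEdge n => edgeLaw W p) (fun x => B (NoInEdge x u)) *
      pr (prodWeight fun _ : DEdge n => edgeLaw W p) (fun x => RootedGood x u) := by
    intro u B
    refine pr_and_of_indep hμ (fun e => e.val.2 = u) _ _ (fun f g => ?_) fun f g => ?_
    · have : NoInEdge (merge (fun e : DEdge n => e.val.2 = u) f g) u ↔ NoInEdge f u := by
        refine forall_congr' fun e => forall_congr' fun he => ?_
        rw [merge_of_mem (S := fun e : DEdge n => e.val.2 = u) f g he]
      rw [this]
    · have hm : ∀ t v (h : t ≠ v), v ≠ u →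
          merge (fun e : DEdge n => e.val.2 = u) f g ⟨(t, v), h⟩ = g ⟨(t, v), h⟩ :=
        fun t v h hv => merge_of_not_mem (S := fun e : DEdge n => e.val.2 = u) f g hv
      constructor
      · refine Good.mono fun t v w _ _ hv _ => ?_
        rintro ⟨h, h'⟩
        rw [hm t v h (by simpa using hv)] at h'
        exact ⟨h, h'⟩
      · refine Good.mono fun t v w _ _ hv _ => ?_
        rintro ⟨h, h'⟩
        rw [← hm t v h (by simpa using hv)] at h'
        exact ⟨h, h'⟩
  set u0 : Fin n := ⟨0, hn⟩
  set Ev : Option (Fin n) → (DEdge n → Bool × W) → Prop := fun o x =>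
    o.elim (¬ NoInEdge x u0 ∧ RootedGood x u0) fun u => NoInEdge x u ∧ RootedGood x u with hEv
  have key := sum_pr_le_pr_of_disjoint hP Finset.univ Ev HasRainbow (by
    rintro (_ | u) - x ⟨-, h⟩
    · exact h.hasRainbow
    · exact h.hasRainbow) (by
    have aux : ∀ x v, Ev none x → ¬ Ev (some v) x := by
      rintro x v ⟨h1, h2⟩ ⟨h3, h4⟩
      by_cases hv : v = u0
      · subst hv; exact h1 h3
      · exact h2.not_noInEdge hv h3
    rintro x (_ | u) - (_ | v) - h h'
    · rfl
    · exact absurd h' (aux x v h)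
    · exact absurd h (aux x u h')
    · by_contra hne
      exact h.2.not_noInEdge (fun e => hne (congrArg some e.symm)) h'.1)
  rw [Fintype.sum_option] at key
  refine le_trans ?_ key
  have e1 : ∀ u, x0 * g ≤ pr (prodWeight fun _ : DEdge n => edgeLaw W p) (Ev (some u)) := by
    intro u
    have := indep u id
    simp only [id] at this
    rw [pr_noInEdge hp0 hp1] at this
    exact (mul_le_mul_of_nonneg_left (hg u) hx0n).trans this.ge
  have e2 : (1 - x0) * g ≤ pr (prodWeight fun _ : DEdge n => edgeLaw W p) (Ev none) := by
    have := indep u0 Not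
    rw [pr_not hP, pr_noInEdge hp0 hp1] at this
    exact (mul_le_mul_of_nonneg_left (hg u0) (by linarith)).trans this.ge
  have e3 := Finset.sum_le_sum fun u (_ : u ∈ (Finset.univ : Finset (Fin n))) => e1 u
  rw [Finset.sum_const, Finset.card_univ, Fintype.card_fin, nsmul_eq_mul] at e3
  calc _ = (1 - x0) * g + n * (x0 * g) := by ring
    _ ≤ _ := add_le_add e2 e3

end Binomial

/-! ### Comparison of the uniform process with the binomial model -/

section Count

variable {ι : Type*} [Fintype ι] [DecidableEq ι] {p : ℝ}

/-- The number of present coordinates. -/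
def count (f : ι → Bool) : ℕ := (Finset.univ.filter fun i => f i = true).card

theorem expect_centred_mul_le (h0 : 0 ≤ p) (h1 : p ≤ 1) (i j : ι) :
    expect (prodWeight fun _ : ι => bern p)
      (fun f => ((if f i = true then 1 else 0) - p) * ((if f j = true then 1 else 0) - p)) ≤
      if i = j then p else 0 := by
  have hμ : ∀ _ : ι, IsProb (bern p) := fun _ => isProb_bern h0 h1
  split_ifs with hij
  · subst hij
    rw [expect_coord hμ i fun b => ((if b = true then (1 : ℝ) else 0) - p) *
      ((if b = true then 1 else 0) - p)]
    simp only [expect, bern, Fintype.sum_bool, if_true, Bool.false_eq_true, if_false]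
    nlinarith
  · have h := sum_prodWeight_mul_prod (fun _ : ι => bern p) fun k b =>
      (if k = i then (if b = true then (1 : ℝ) else 0) - p else 1) *
        (if k = j then (if b = true then (1 : ℝ) else 0) - p else 1)
    simp only [Finset.prod_mul_distrib, Finset.prod_ite_eq', Finset.mem_univ, if_true] at h
    have h' : expect (prodWeight fun _ : ι => bern p) (fun f =>
        ((if f i = true then 1 else 0) - p) * ((if f j = true then 1 else 0) - p)) = _ := h
    rw [h', Finset.prod_eq_zero (Finset.mem_univ i)]
    simp only [if_true, if_neg hij, mul_one, Fintype.sum_bool, bern, Bool.false_eq_true, if_false]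
    ring

theorem pr_count_far_le (h0 : 0 ≤ p) (h1 : p ≤ 1) {r : ℝ} (hr : 0 < r) :
    pr (prodWeight fun _ : ι => bern p) (fun f => r ≤ |(count f : ℝ) - Fintype.card ι * p|) ≤
      Fintype.card ι * p / r ^ 2 := by
  have hμ : ∀ _ : ι, IsProb (bern p) := fun _ => isProb_bern h0 h1
  have hP := isProb_prodWeight hμ
  have hcount : ∀ f : ι → Bool, (count f : ℝ) - Fintype.card ι * p =
      ∑ i, ((if f i = true then 1 else 0) - p) := fun f => by
    simp [count, Finset.sum_sub_distrib]
  refine (pr_mono hP (B := fun f => r ^ 2 ≤ ((count f : ℝ) - Fintype.card ι * p) ^ 2)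
    fun f hf => ?_).trans ((pr_le_expect_div hP (fun f => sq_nonneg _) (by positivity)).trans ?_)
  · rw [← sq_abs ((count f : ℝ) - _)]
    exact pow_le_pow_left₀ hr.le hf 2
  gcongr
  simp only [hcount, sq, Finset.sum_mul_sum]
  rw [expect_sum]
  simp only [expect_sum]
  refine (Finset.sum_le_sum fun i _ => Finset.sum_le_sum fun j _ =>
    expect_centred_mul_le h0 h1 i j).trans ?_
  simp

end Count

section RandomOrdering

variable {ι : Type*} [Fintype ι]

theorem exists_perm_prefix (f : ι → Bool) :
    ∃ τ : Equiv.Perm ι, ∀ i, f i = decide ((Fintype.equivFin ι (τ i)).val < count f) := by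
  have hle : count f ≤ Fintype.card ι := Finset.card_le_univ _
  have hcard : Fintype.card {i // f i = true} =
      Fintype.card {i // (Fintype.equivFin ι i).val < count f} := by
    rw [Fintype.card_subtype, Fintype.card_subtype]
    have : (Finset.univ.filter fun i : ι => (Fintype.equivFin ι i).val < count f).card =
        (Finset.univ.filter fun x : Fin (Fintype.card ι) => x.val < count f).card :=
      Finset.card_equiv (Fintype.equivFin ι) (by simp)
    rw [this, Fin.card_filter_val_lt, min_eq_right hle]
    rfl
  set e := Fintype.equivOfCardEq hcard
  refine ⟨e.extendSubtype, fun i => ?_⟩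
  by_cases h : f i = true
  · rw [h, eq_comm, decide_eq_true_eq]
    exact e.extendSubtype_mem i h
  · have := e.extendSubtype_not_mem i h
    rw [Bool.not_eq_true] at h
    rw [h, eq_comm, decide_eq_false_iff_not]
    exact this

variable [DecidableEq ι]

/-- The probability that the first `k` elements of a uniformly random ordering satisfy `G`,
averaged over the randomness encoded in `G`. -/
noncomputable def processMean (G : (ι → Bool) → ℝ) (k : ℕ) : ℝ :=
  expect (unif (Equiv.Perm ι)) fun σ => G fun i => decide ((Fintype.equivFin ι (σ i)).val < k)

theorem expect_perm_mul (τ : Equiv.Perm ι) (X : Equiv.Perm ι → ℝ) :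
    expect (unif (Equiv.Perm ι)) (fun σ => X (τ * σ)) = expect (unif (Equiv.Perm ι)) X := by
  exact Equiv.sum_comp (Equiv.mulLeft τ) fun σ => unif (Equiv.Perm ι) σ * X σ

theorem expect_bern_eq (p : ℝ) (G : (ι → Bool) → ℝ) :
    expect (prodWeight fun _ : ι => bern p) G =
      expect (prodWeight fun _ : ι => bern p) fun f => processMean G (count f) := by
  have h1 : ∀ f, processMean G (count f) =
      expect (unif (Equiv.Perm ι)) fun σ => G (f ∘ σ) := by
    intro f
    obtain ⟨τ, hτ⟩ := exists_perm_prefix f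
    unfold processMean
    rw [← expect_perm_mul τ]
    congr 1
    funext σ
    congr 1
    funext i
    exact (hτ (σ i)).symm
  have h2 : ∀ σ : Equiv.Perm ι, expect (prodWeight fun _ : ι => bern p) (fun f => G (f ∘ σ)) =
      expect (prodWeight fun _ : ι => bern p) G := fun σ =>
    expect_reindex σ (fun _ : ι => bern p) G
  simp only [h1]
  have h3 : expect (prodWeight fun _ : ι => bern p)
      (fun f => expect (unif (Equiv.Perm ι)) fun σ => G (f ∘ σ)) =
      expect (unif (Equiv.Perm ι)) fun σ => expect (prodWeight fun _ : ι => bern p)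
        fun f => G (f ∘ σ) := by
    unfold expect
    simp only [Finset.mul_sum]
    rw [Finset.sum_comm]
    exact Finset.sum_congr rfl fun _ _ => Finset.sum_congr rfl fun _ _ => by ring
  rw [h3]
  simp only [h2]
  rw [expect_const (isProb_unif _)]

variable {G : (ι → Bool) → ℝ}

theorem processMean_mono (hG : ∀ f g : ι → Bool, (∀ i, f i = true → g i = true) → G f ≤ G g)
    {k l : ℕ} (h : k ≤ l) : processMean G k ≤ processMean G l := by
  refine expect_mono (isProb_unif _) fun σ => hG _ _ fun i hi => ?_
  rw [decide_eq_true_eq] at hi ⊢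
  omega

theorem processMean_nonneg (h : ∀ f, 0 ≤ G f) (k : ℕ) : 0 ≤ processMean G k :=
  expect_nonneg (isProb_unif _) fun _ => h _

theorem processMean_le_one (h : ∀ f, G f ≤ 1) (k : ℕ) : processMean G k ≤ 1 :=
  (expect_mono (isProb_unif _) fun _ => h _).trans (expect_const (isProb_unif _) 1).le

theorem expect_bern_le_processMean {p : ℝ} (h0 : 0 ≤ p) (h1 : p ≤ 1)
    (hG : ∀ f g : ι → Bool, (∀ i, f i = true → g i = true) → G f ≤ G g)
    (hG0 : ∀ f, 0 ≤ G f) (hG1 : ∀ f, G f ≤ 1) (m : ℕ) :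
    expect (prodWeight fun _ : ι => bern p) G ≤
      processMean G m + pr (prodWeight fun _ : ι => bern p) (fun f => m < count f) := by
  have hP : IsProb (prodWeight fun _ : ι => bern p) :=
    isProb_prodWeight fun _ => isProb_bern h0 h1
  rw [expect_bern_eq, pr, ← expect_const hP (processMean G m), ← expect_add]
  refine expect_mono hP fun f => ?_
  by_cases h : m < count f
  · rw [ind_of_true h]
    linarith [processMean_le_one hG1 (count f), processMean_nonneg hG0 m]
  · rw [ind_of_false h, add_zero]
    exact processMean_mono hG (not_lt.1 h)

theorem processMean_le_expect_bern {p : ℝ} (h0 : 0 ≤ p) (h1 : p ≤ 1)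
    (hG : ∀ f g : ι → Bool, (∀ i, f i = true → g i = true) → G f ≤ G g)
    (hG0 : ∀ f, 0 ≤ G f) (hG1 : ∀ f, G f ≤ 1) (m : ℕ) :
    processMean G m ≤ expect (prodWeight fun _ : ι => bern p) G +
      pr (prodWeight fun _ : ι => bern p) (fun f => count f < m) := by
  have hP : IsProb (prodWeight fun _ : ι => bern p) :=
    isProb_prodWeight fun _ => isProb_bern h0 h1
  rw [expect_bern_eq, pr, ← expect_const hP (processMean G m), ← expect_add]
  refine expect_mono hP fun f => ?_
  by_cases h : count f < m
  · rw [ind_of_true h]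
    linarith [processMean_le_one hG1 m, processMean_nonneg hG0 (count f)]
  · rw [ind_of_false h, add_zero]
    exact processMean_mono hG (not_lt.1 h)

end RandomOrdering

section Coloured

variable {ι W : Type*} [Fintype ι] [DecidableEq ι] [Fintype W]

/-- The probability of `Q` over uniform colourings for given present edges. -/
noncomputable def colourMean (Q : (ι → Bool × W) → Prop) (f : ι → Bool) : ℝ :=
  pr (prodWeight fun _ : ι => unif W) fun c => Q fun i => (f i, c i)

theorem pr_edgeLaw_eq (p : ℝ) (Q : (ι → Bool × W) → Prop) :
    pr (prodWeight fun _ : ι => edgeLaw W p) Q =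
      expect (prodWeight fun _ : ι => bern p) (colourMean Q) :=
  expect_pairs (fun _ => bern p) (fun _ => unif W) fun x => ind (Q x)

theorem prob_process_eq (Q : (ι → Bool × W) → Prop) (m : ℕ) :
    prob (fun ω : Equiv.Perm ι × (ι → W) =>
      Q fun i => (decide ((Fintype.equivFin ι (ω.1 i)).val < m), ω.2 i)) =
      processMean (colourMean Q) m := by
  classical
  unfold prob processMean colourMean pr expect
  rw [Nat.card_eq_fintype_card, Fintype.card_subtype, Finset.card_eq_sum_ones, Nat.cast_sum,
    Finset.sum_filter, Fintype.sum_prod_type, Finset.sum_div]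
  refine Finset.sum_congr rfl fun σ _ => ?_
  rw [Finset.sum_div, Finset.mul_sum]
  refine Finset.sum_congr rfl fun c _ => ?_
  simp only [unif, prodWeight, Finset.prod_const, Finset.card_univ, ind, Fintype.card_prod,
    Fintype.card_fun, Nat.cast_mul, Nat.cast_pow]
  split_ifs <;> simp [mul_comm]

/-- Monotone events are more likely in the process than in a sparser binomial model. -/
theorem pr_edgeLaw_le_prob [Nonempty W] {Q : (ι → Bool × W) → Prop} {p r : ℝ} (h0 : 0 ≤ p)
    (h1 : p ≤ 1)
    (hQ : ∀ (f g : ι → Bool) (c : ι → W), (∀ i, f i = true → g i = true) → Q (fun i => (f i, c i)) →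
      Q fun i => (g i, c i)) (hr : 0 < r) {m : ℕ} (hm : Fintype.card ι * p + r ≤ m + 1) :
    pr (prodWeight fun _ : ι => edgeLaw W p) Q ≤
      prob (fun ω : Equiv.Perm ι × (ι → W) =>
        Q fun i => (decide ((Fintype.equivFin ι (ω.1 i)).val < m), ω.2 i)) +
      Fintype.card ι * p / r ^ 2 := by
  have hW : IsProb (prodWeight fun _ : ι => unif W) := isProb_prodWeight fun _ => isProb_unif _
  rw [prob_process_eq, pr_edgeLaw_eq]
  refine (expect_bern_le_processMean h0 h1 (fun f g h => pr_mono hW fun c => hQ f g c h)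
    (fun f => pr_nonneg hW _) (fun f => pr_le_one hW _) m).trans ?_
  refine add_le_add le_rfl (le_trans (pr_mono (isProb_prodWeight fun _ => isProb_bern h0 h1)
    fun f hf => ?_) (pr_count_far_le h0 h1 hr))
  have : (m : ℝ) + 1 ≤ count f := by exact_mod_cast hf
  exact le_trans (by linarith) (le_abs_self _)

/-- Monotone events are less likely in the process than in a denser binomial model. -/
theorem prob_le_pr_edgeLaw [Nonempty W] {Q : (ι → Bool × W) → Prop} {p r : ℝ} (h0 : 0 ≤ p)
    (h1 : p ≤ 1)
    (hQ : ∀ (f g : ι → Bool) (c : ι → W), (∀ i, f i = true → g i = true) → Q (fun i => (f i, c i)) →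
      Q fun i => (g i, c i)) (hr : 0 < r) {m : ℕ} (hm : m ≤ Fintype.card ι * p - r) :
    prob (fun ω : Equiv.Perm ι × (ι → W) =>
        Q fun i => (decide ((Fintype.equivFin ι (ω.1 i)).val < m), ω.2 i)) ≤
      pr (prodWeight fun _ : ι => edgeLaw W p) Q + Fintype.card ι * p / r ^ 2 := by
  have hW : IsProb (prodWeight fun _ : ι => unif W) := isProb_prodWeight fun _ => isProb_unif _
  rw [prob_process_eq, pr_edgeLaw_eq]
  refine (processMean_le_expect_bern h0 h1 (fun f g h => pr_mono hW fun c => hQ f g c h)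
    (fun f => pr_nonneg hW _) (fun f => pr_le_one hW _) m).trans ?_
  refine add_le_add le_rfl (le_trans (pr_mono (isProb_prodWeight fun _ => isProb_bern h0 h1)
    fun f hf => ?_) (pr_count_far_le h0 h1 hr))
  have : (count f : ℝ) ≤ m := by exact_mod_cast hf.le
  exact le_trans (by linarith) (neg_le_abs _)

end Coloured

/-! ### Asymptotics of the in-degree zero vertices -/

section Asymptotics

theorem tendsto_log_natCast : Tendsto (fun n : ℕ => Real.log n) atTop atTop :=
  Real.tendsto_log_atTop.comp tendsto_natCast_atTop_atTop

theorem tendsto_log_pow_div_rpow (j : ℕ) {s : ℝ} (hs : 0 < s) :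
    Tendsto (fun n : ℕ => Real.log n ^ j / (n : ℝ) ^ s) atTop (nhds 0) := by
  have h := (isLittleO_log_rpow_rpow_atTop (j : ℝ) hs).tendsto_div_nhds_zero
  refine (h.comp tendsto_natCast_atTop_atTop).congr fun n => ?_
  simp

theorem tendsto_log_pow_div (j : ℕ) :
    Tendsto (fun n : ℕ => Real.log n ^ j / n) atTop (nhds 0) := by
  simpa using tendsto_log_pow_div_rpow j one_pos

variable (c : ℝ)

theorem eventually_log_add_mem :
    ∀ᶠ n : ℕ in atTop, 1 ≤ Real.log n + c ∧ Real.log n + c ≤ 2 * Real.log n := by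
  filter_upwards [tendsto_log_natCast.eventually_ge_atTop (1 - c),
    tendsto_log_natCast.eventually_ge_atTop c] with n h1 h2
  constructor <;> linarith

/-- The edge probability of the binomial random digraph at the connectivity threshold. -/
noncomputable def edgeProb (n : ℕ) : ℝ := (Real.log n + c) / n

theorem tendsto_edgeProb : Tendsto (edgeProb c) atTop (nhds 0) := by
  have h1 := tendsto_log_pow_div 1
  have h2 : Tendsto (fun n : ℕ => c / (n : ℝ)) atTop (nhds 0) :=
    tendsto_const_div_atTop_nhds_zero_nat c
  have := h1.add h2
  simp only [pow_one, add_zero] at this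
  exact this.congr fun n => (add_div _ _ _).symm

theorem eventually_edgeProb_mem :
    ∀ᶠ n : ℕ in atTop, 0 ≤ edgeProb c n ∧ edgeProb c n ≤ 1 / 2 := by
  filter_upwards [eventually_log_add_mem c,
    (tendsto_edgeProb c).eventually_le_const (show (0 : ℝ) < 1 / 2 by norm_num)] with n h1 h2
  exact ⟨div_nonneg (by linarith) (Nat.cast_nonneg n), h2⟩

theorem tendsto_mul_edgeProb_sq :
    Tendsto (fun n : ℕ => n * edgeProb c n ^ 2) atTop (nhds 0) := by
  have h2 : Tendsto (fun n : ℕ => 4 * (Real.log n ^ 2 / n)) atTop (nhds 0) := by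
    simpa using (tendsto_log_pow_div 2).const_mul 4
  refine squeeze_zero' (.of_forall fun n => by positivity) ?_ h2
  filter_upwards [eventually_log_add_mem c, eventually_gt_atTop 0] with n h1 hn
  have hn' : (0 : ℝ) < n := by exact_mod_cast hn
  rw [edgeProb, div_pow, ← mul_div_assoc, sq (n : ℝ), mul_div_mul_left _ _ hn'.ne', ← mul_div_assoc]
  gcongr
  nlinarith

theorem tendsto_mul_one_sub_edgeProb_pow :
    Tendsto (fun n : ℕ => (n : ℝ) * (1 - edgeProb c n) ^ (n - 1)) atTop
      (nhds (Real.exp (-c))) := by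
  have h0 : Tendsto (fun n : ℕ => -c + edgeProb c n) atTop (nhds (-c)) := by
    simpa using (tendsto_edgeProb c).const_add (-c)
  have h1 : Tendsto (fun n : ℕ => -c + edgeProb c n - 2 * (n * edgeProb c n ^ 2)) atTop
      (nhds (-c)) := by
    simpa using h0.sub ((tendsto_mul_edgeProb_sq c).const_mul 2)
  have h2 : Tendsto (fun n : ℕ => Real.log n + (n - 1 : ℕ) * Real.log (1 - edgeProb c n)) atTop
      (nhds (-c)) := by
    refine tendsto_of_tendsto_of_tendsto_of_le_of_le' h1 h0 ?_ ?_ <;>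
    filter_upwards [eventually_edgeProb_mem c, eventually_gt_atTop 0] with n hp hn
    all_goals
      have hn' : (0 : ℝ) < n := by exact_mod_cast hn
      have hnp : n * edgeProb c n = Real.log n + c := by
        rw [edgeProb]; field_simp
      rw [Nat.cast_sub (Nat.one_le_iff_ne_zero.2 hn.ne'), Nat.cast_one]
      have hn1 : (1 : ℝ) ≤ n := by exact_mod_cast hn
    · have h3 := Real.one_sub_inv_le_log_of_pos (show 0 < 1 - edgeProb c n by linarith)
      have h4 : (1 - edgeProb c n)⁻¹ ≤ 1 + edgeProb c n + 2 * edgeProb c n ^ 2 := by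
        rw [inv_le_iff_one_le_mul₀ (by linarith)]
        nlinarith [mul_nonneg (sq_nonneg (edgeProb c n))
          (show 0 ≤ 1 - 2 * edgeProb c n by linarith)]
      nlinarith [mul_le_mul_of_nonneg_left (h3.trans' (sub_le_sub_left h4 1))
        (show (0 : ℝ) ≤ n - 1 by linarith), sq_nonneg (edgeProb c n)]
    · have h3 := Real.log_le_sub_one_of_pos (show 0 < 1 - edgeProb c n by linarith)
      nlinarith [mul_le_mul_of_nonneg_left h3 (show (0 : ℝ) ≤ n - 1 by linarith)]
  refine ((Real.continuous_exp.tendsto _).comp h2).congr' ?_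
  filter_upwards [eventually_edgeProb_mem c, eventually_gt_atTop 0] with n hp hn
  have hn' : (0 : ℝ) < n := by exact_mod_cast hn
  rw [Function.comp_apply, Real.exp_add, Real.exp_log hn', Real.exp_nat_mul,
    Real.exp_log (by linarith)]

theorem tendsto_one_sub_pow {x : ℕ → ℝ} {t : ℝ}
    (h : Tendsto (fun n : ℕ => n * x n) atTop (nhds t)) :
    Tendsto (fun n => (1 - x n) ^ n) atTop (nhds (Real.exp (-t))) := by
  have : Tendsto (fun n : ℕ => n * -x n) atTop (nhds (-t)) := by simpa using h.neg
  simpa [sub_eq_add_neg] using Real.tendsto_one_add_pow_exp_of_tendsto this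

theorem tendsto_zero_of_tendsto_mul {x : ℕ → ℝ} {t : ℝ}
    (h : Tendsto (fun n : ℕ => n * x n) atTop (nhds t)) : Tendsto x atTop (nhds 0) := by
  have := h.mul (tendsto_inv_atTop_nhds_zero_nat (𝕜 := ℝ))
  rw [mul_zero] at this
  refine this.congr' ?_
  filter_upwards [eventually_gt_atTop 0] with n hn
  have hn' : (n : ℝ) ≠ 0 := by exact_mod_cast hn.ne'
  field_simp

theorem tendsto_at_most_one {x : ℕ → ℝ} {t : ℝ}
    (h : Tendsto (fun n : ℕ => n * x n) atTop (nhds t)) :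
    Tendsto (fun n : ℕ => (1 - x n) ^ n + n * (x n * (1 - x n) ^ (n - 1))) atTop
      (nhds ((1 + t) * Real.exp (-t))) := by
  have h0 := tendsto_zero_of_tendsto_mul h
  have h1 := tendsto_one_sub_pow h
  have h2 : Tendsto (fun n => 1 - x n) atTop (nhds 1) := by simpa using h0.const_sub 1
  have h3 := h1.add (h.mul (h1.div h2 one_ne_zero))
  rw [div_one, ← one_add_mul] at h3
  refine h3.congr' ?_
  filter_upwards [h0.eventually_lt_const one_pos, eventually_gt_atTop 0] with n hx hn
  obtain ⟨n, rfl⟩ := Nat.exists_eq_succ_of_ne_zero hn.ne'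
  have : 1 - x (n + 1) ≠ 0 := by linarith
  simp only [Nat.succ_eq_add_one, Pi.div_apply, Nat.add_sub_cancel, pow_succ]
  field_simp

/-- The limiting probability that at most one vertex has in-degree zero. -/
noncomputable def limitProb : ℝ := (1 + Real.exp (-c)) * Real.exp (-Real.exp (-c))

theorem continuous_limitProb : Continuous limitProb := by
  unfold limitProb
  fun_prop

end Asymptotics

/-! ### The number of colours -/

section Colours

theorem tendsto_eps : Tendsto eps atTop (nhds 0) := by
  have h := (Real.isLittleO_log_id_atTop.tendsto_div_nhds_zero).comp tendsto_log_natCast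
  exact h

theorem eventually_le_log_log (C : ℝ) : ∀ᶠ n : ℕ in atTop, C ≤ Real.log (Real.log n) :=
  (Real.tendsto_log_atTop.comp tendsto_log_natCast).eventually_ge_atTop C

theorem eventually_eps_pos : ∀ᶠ n : ℕ in atTop, 0 < eps n := by
  filter_upwards [eventually_le_log_log 1, tendsto_log_natCast.eventually_gt_atTop 0]
    with n h1 h2
  exact div_pos (by linarith) h2

theorem eventually_numColours_ge :
    ∀ᶠ n : ℕ in atTop, (1 + 49 * eps n) * n ≤ numColours n := by
  filter_upwards [eventually_le_log_log 1, eventually_gt_atTop 0,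
    (tendsto_log_pow_div 1).eventually_le_const one_pos, tendsto_log_natCast.eventually_gt_atTop 0]
    with n h1 hn h2 h3
  have hn' : (0 : ℝ) < n := by exact_mod_cast hn
  have h4 : 1 ≤ eps n * n := by
    rw [pow_one, div_le_one hn'] at h2
    rw [eps, div_mul_eq_mul_div, le_div_iff₀ h3]
    nlinarith
  have h5 := Nat.lt_floor_add_one ((1 + 50 * eps n) * n)
  rw [← numColours] at h5
  nlinarith

theorem eventually_numColours_le :
    ∀ᶠ n : ℕ in atTop, (numColours n : ℝ) ≤ 2 * n := by
  filter_upwards [tendsto_eps.eventually_le_const (show (0 : ℝ) < 1 / 50 by norm_num),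
    eventually_eps_pos] with n h1 h2
  refine (Nat.floor_le (by positivity)).trans ?_
  gcongr
  linarith

theorem eventually_le_numColours : ∀ᶠ n : ℕ in atTop, n ≤ numColours n := by
  filter_upwards [eventually_numColours_ge, eventually_eps_pos] with n h1 h2
  have : (n : ℝ) ≤ numColours n := h1.trans' (by nlinarith [(Nat.cast_nonneg n : (0 : ℝ) ≤ n)])
  exact_mod_cast this

end Colours

/-! ### Transfer between the process and the binomial model -/

section Transfer

theorem prob_mono {Ω : Type*} [Fintype Ω] {p q : Ω → Prop} (h : ∀ ω, p ω → q ω) :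
    prob p ≤ prob q := by
  unfold prob
  gcongr
  exact Nat.card_le_card_of_injective (Subtype.map id h)
    (Subtype.map_injective h Function.injective_id)

theorem card_dEdge (n : ℕ) : Fintype.card (DEdge n) = n * (n - 1) := by
  rw [Fintype.card_of_subtype (Finset.univ.offDiag : Finset (Fin n × Fin n)) (by simp),
    Finset.offDiag_card, Finset.card_univ, Fintype.card_fin, Nat.mul_sub_one]

theorem rEvent_iff {n : ℕ} (ω : SampleSpace n) (m : ℕ) :
    REvent ω m ↔ HasRainbow fun e =>
      (decide ((Fintype.equivFin (DEdge n) (ω.1 e)).val < m), ω.2 e) := by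
  simp only [REvent, HasRainbow, inProcess, edgePos, decide_eq_true_eq]

variable {n : ℕ} {W : Type*}

theorem hasRainbow_mono {f g : DEdge n → Bool} {c : DEdge n → W}
    (hfg : ∀ e, f e = true → g e = true) (h : HasRainbow fun e => (f e, c e)) :
    HasRainbow fun e => (g e, c e) := by
  obtain ⟨u, A, h1, h2⟩ := h
  exact ⟨u, A, fun e he => hfg e (h1 e he), h2⟩

theorem subsingleton_noInEdge_mono {f g : DEdge n → Bool} {c : DEdge n → W}
    (hfg : ∀ e, f e = true → g e = true)
    (h : Set.Subsingleton {v | NoInEdge (fun e => (f e, c e)) v}) :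
    Set.Subsingleton {v | NoInEdge (fun e => (g e, c e)) v} := by
  refine h.anti fun v hv e he => ?_
  by_contra hf
  rw [Bool.not_eq_false] at hf
  have := hv e he
  simp only [hfg e hf, Bool.true_eq_false] at this

theorem HasRainbow.subsingleton_noInEdge {x : DEdge n → Bool × W} (h : HasRainbow x) :
    Set.Subsingleton {v | NoInEdge x v} := by
  obtain ⟨u, A, h1, ⟨-, h2, -⟩, -⟩ := h
  have key : ∀ v, NoInEdge x v → v = u := fun v hv => by
    by_contra hvu
    obtain ⟨e, ⟨he, hev⟩, -⟩ := h2 v hvu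
    have := hv e hev
    rw [h1 e he] at this
    exact absurd this (by simp)
  exact fun v hv w hw => (key v hv).trans (key w hw).symm

theorem card_mul_edgeProb (c : ℝ) {n : ℕ} (hn : 0 < n) :
    Fintype.card (DEdge n) * edgeProb c n = (n - 1) * (Real.log n + c) := by
  have hn' : (n : ℝ) ≠ 0 := by exact_mod_cast hn.ne'
  rw [card_dEdge, Nat.cast_mul, Nat.cast_sub (Nat.one_le_iff_ne_zero.2 hn.ne'), Nat.cast_one,
    edgeProb]
  field_simp

theorem tendsto_transfer_error (c : ℝ) {δ : ℝ} (hδ : 0 < δ) :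
    Tendsto (fun n : ℕ => Fintype.card (DEdge n) * edgeProb c n / (δ * n) ^ 2) atTop (nhds 0) := by
  have h : Tendsto (fun n : ℕ => 2 / δ ^ 2 * (Real.log n ^ 1 / n)) atTop (nhds 0) := by
    simpa using (tendsto_log_pow_div 1).const_mul (2 / δ ^ 2)
  refine squeeze_zero' ?_ ?_ h
  · filter_upwards [eventually_edgeProb_mem c] with n hp
    have := hp.1
    positivity
  filter_upwards [eventually_log_add_mem c, eventually_gt_atTop 0] with n h1 hn
  have hn' : (0 : ℝ) < n := by exact_mod_cast hn
  rw [card_mul_edgeProb c hn, pow_one, div_mul_div_comm, mul_pow,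
    div_le_div_iff₀ (by positivity) (by positivity)]
  have h2 : ((n : ℝ) - 1) * (Real.log n + c) ≤ n * (2 * Real.log n) := by nlinarith
  calc _ ≤ n * (2 * Real.log n) * (δ ^ 2 * n) := by gcongr
    _ = _ := by ring

variable {c : ℝ}

theorem eventually_floor_add_one_ge {δ : ℝ} (hδ : 0 < δ) :
    ∀ᶠ n : ℕ in atTop, Fintype.card (DEdge n) * edgeProb (c - 2 * δ) n + δ * n ≤
      ⌊(n : ℝ) * (Real.log n + c)⌋₊ + 1 := by
  filter_upwards [eventually_log_add_mem (c - 2 * δ), eventually_gt_atTop 0] with n h1 hn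
  rw [card_mul_edgeProb _ hn]
  have h2 := (Nat.lt_floor_add_one ((n : ℝ) * (Real.log n + c))).le
  have hn' : (0 : ℝ) < n := by exact_mod_cast hn
  nlinarith

theorem eventually_floor_le {δ : ℝ} (hδ : 0 < δ) :
    ∀ᶠ n : ℕ in atTop, (⌊(n : ℝ) * (Real.log n + c)⌋₊ : ℝ) ≤
      Fintype.card (DEdge n) * edgeProb (c + 2 * δ) n - δ * n := by
  filter_upwards [eventually_log_add_mem c, eventually_gt_atTop 0,
    (tendsto_edgeProb (c + 2 * δ)).eventually_le_const hδ] with n h1 hn h3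
  have hn' : (0 : ℝ) < n := by exact_mod_cast hn
  rw [card_mul_edgeProb _ hn]
  have h2 := Nat.floor_le (show 0 ≤ (n : ℝ) * (Real.log n + c) by nlinarith)
  rw [edgeProb, div_le_iff₀ hn'] at h3
  nlinarith

theorem eventually_prob_rEvent_le {b : ℝ} (hb : limitProb c < b) :
    ∀ᶠ n : ℕ in atTop, prob (fun ω : SampleSpace n =>
      REvent ω ⌊(n : ℝ) * (Real.log n + c)⌋₊) < b := by
  obtain ⟨δ, hδ, hδb⟩ : ∃ δ > 0, limitProb (c + 2 * δ) < b := by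
    have h : Tendsto (fun δ : ℝ => limitProb (c + 2 * δ)) (nhdsWithin 0 (Set.Ioi 0))
        (nhds (limitProb c)) := by
      have : Continuous fun δ : ℝ => limitProb (c + 2 * δ) :=
        continuous_limitProb.comp (by fun_prop)
      simpa using (this.tendsto 0).mono_left nhdsWithin_le_nhds
    exact ((h.eventually_lt_const hb).and self_mem_nhdsWithin).exists.imp fun δ h => ⟨h.2, h.1⟩
  have hlim := (tendsto_at_most_one (tendsto_mul_one_sub_edgeProb_pow (c + 2 * δ))).add
    (tendsto_transfer_error (c + 2 * δ) hδ)
  rw [add_zero] at hlim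
  filter_upwards [hlim.eventually_lt_const hδb, eventually_floor_le (c := c) hδ,
    eventually_edgeProb_mem (c + 2 * δ), eventually_gt_atTop 0, eventually_le_numColours]
    with n h1 h2 hp hn hq
  have : NeZero (numColours n) := ⟨(hn.trans_le hq).ne'⟩
  refine lt_of_le_of_lt ?_ h1
  have hn' : (0 : ℝ) < n := by exact_mod_cast hn
  refine le_trans ?_ (add_le_add (pr_subsingleton_noInEdge_le (W := Colour n) hp.1
    (by linarith [hp.2])) le_rfl)
  refine le_trans ?_ (prob_le_pr_edgeLaw (Q := fun x : DEdge n → Bool × Colour n =>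
    Set.Subsingleton {v | NoInEdge x v}) hp.1 (by linarith [hp.2])
    (fun f g c h => subsingleton_noInEdge_mono h) (by positivity) h2)
  exact prob_mono fun ω h => ((rEvent_iff ω _).1 h).subsingleton_noInEdge

end Transfer

/-! ### A bound on the Hall violators -/

theorem pow_pred_div_factorial_le (t : ℕ) :
    ((t + 1 : ℕ) : ℝ) ^ t / (t + 1).factorial ≤ Real.exp (t + 1) ∧
      ((t + 1 : ℕ) : ℝ) ^ t / t.factorial ≤ Real.exp (t + 1) := by
  have h := Real.pow_div_factorial_le_exp ((t + 1 : ℕ) : ℝ) (by positivity) (t + 1)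
  have h2 : ((t + 1 : ℕ) : ℝ) ^ t / t.factorial =
      ((t + 1 : ℕ) : ℝ) ^ (t + 1) / (t + 1).factorial := by
    rw [Nat.factorial_succ, pow_succ]
    push_cast
    field_simp
  rw [Nat.cast_add_one] at h h2 ⊢
  refine ⟨h.trans' ?_, h2.trans_le h⟩
  gcongr
  · simp
  · exact Nat.le_succ t

theorem violatorBound_le {π l w : ℝ} {n a y q : ℕ} (h0 : 0 ≤ π) (h1 : π ≤ 1)
    (hw : 1 ≤ w) (hwn : w ^ 8 = n) (hπ : π ≤ l / n) (hy : y ≤ n) (hq : q ≤ 2 * n)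
    (hexp : (1 - π) ^ (q - a) ≤ 1 / w ^ 7)
    (hz : 2 * Real.exp 4 * l ^ 2 / w ^ 6 ≤ 1 / 2) :
    violatorBound π a y q ≤ 2 * (2 * Real.exp 4 * l ^ 2 / w ^ 6) := by
  set z := 2 * Real.exp 4 * l ^ 2 / w ^ 6 with hzdef
  have hw0 : 0 < w := by linarith
  have hn : (0 : ℝ) < n := by rw [← hwn]; positivity
  have hz0 : 0 ≤ z := by positivity
  have hterm : ∀ s ∈ Finset.Ico 2 a, (y.choose s : ℝ) * (q.choose (s - 1)) *
      ((s * π) ^ (2 * (s - 1)) * (1 - π) ^ (s * (q - (s - 1)))) ≤ z ^ (s - 1) := by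
    intro s hs
    rw [Finset.mem_Ico] at hs
    obtain ⟨t, rfl⟩ := Nat.exists_eq_succ_of_ne_zero (show s ≠ 0 by omega)
    simp only [Nat.succ_eq_add_one, Nat.add_sub_cancel] at hs ⊢
    have e1 : (y.choose (t + 1) : ℝ) ≤ (n : ℝ) ^ (t + 1) / (t + 1).factorial :=
      (Nat.choose_le_pow_div _ _).trans (by gcongr)
    have e2 : (q.choose t : ℝ) ≤ (2 * n : ℝ) ^ t / t.factorial :=
      (Nat.choose_le_pow_div _ _).trans (by gcongr; exact_mod_cast hq)
    have e3 : (((t + 1 : ℕ) : ℝ) * π) ^ (2 * t) ≤ (((t + 1 : ℕ) : ℝ) * (l / n)) ^ (2 * t) := by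
      gcongr
    have e4 : (1 - π) ^ ((t + 1) * (q - t)) ≤ (1 / w ^ 7) ^ (t + 1) := by
      calc (1 - π) ^ ((t + 1) * (q - t)) ≤ (1 - π) ^ ((t + 1) * (q - a)) :=
            pow_le_pow_of_le_one (by linarith) (by linarith)
              (Nat.mul_le_mul_left _ (by omega))
        _ = ((1 - π) ^ (q - a)) ^ (t + 1) := by rw [mul_comm, pow_mul]
        _ ≤ _ := pow_le_pow_left₀ (pow_nonneg (by linarith) _) hexp _
    have h1π : 0 ≤ 1 - π := by linarith
    calc _ ≤ (n : ℝ) ^ (t + 1) / (t + 1).factorial * ((2 * n : ℝ) ^ t / t.factorial) *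
          ((((t + 1 : ℕ) : ℝ) * (l / n)) ^ (2 * t) * (1 / w ^ 7) ^ (t + 1)) := by
          gcongr
          exact (even_two_mul t).pow_nonneg _
      _ = (2 * l ^ 2) ^ t * (w / (w ^ 7) ^ t) * (((t + 1 : ℕ) : ℝ) ^ t / (t + 1).factorial *
          (((t + 1 : ℕ) : ℝ) ^ t / t.factorial)) := by
        rw [← hwn]
        have : (t + 1).factorial ≠ 0 := Nat.factorial_ne_zero _
        have : t.factorial ≠ 0 := Nat.factorial_ne_zero _
        obtain ⟨u, hu⟩ : ∃ u, u = w ^ t := ⟨_, rfl⟩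
        have hu0 : u ≠ 0 := by rw [hu]; positivity
        rw [mul_pow 2 (w ^ 8), mul_pow _ (l / _), div_pow l, div_pow 1, one_pow, mul_pow 2 (l ^ 2),
          show (w ^ 8) ^ (t + 1) = u ^ 8 * w ^ 8 by rw [hu]; ring,
          show (w ^ 8) ^ t = u ^ 8 by rw [hu]; ring,
          show (w ^ 8) ^ (2 * t) = u ^ 16 by rw [hu]; ring,
          show (w ^ 7) ^ (t + 1) = u ^ 7 * w ^ 7 by rw [hu]; ring,
          show (w ^ 7) ^ t = u ^ 7 by rw [hu]; ring]
        field_simp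
        ring
      _ ≤ (2 * l ^ 2) ^ t * (w ^ t / (w ^ 7) ^ t) * (Real.exp (t + 1) * Real.exp (t + 1)) := by
        have ht := pow_pred_div_factorial_le t
        gcongr
        · exact le_self_pow₀ hw (by omega)
        · exact ht.1
        · exact ht.2
      _ ≤ (2 * l ^ 2) ^ t * (w ^ t / (w ^ 7) ^ t) * Real.exp 4 ^ t := by
        have ht : (1 : ℝ) ≤ t := by exact_mod_cast (show 1 ≤ t by omega)
        gcongr
        rw [← Real.exp_add, ← Real.exp_nat_mul]
        gcongr
        linarith
      _ = z ^ t := by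
        rw [hzdef, ← div_pow, ← mul_pow, ← mul_pow]
        congr 1
        field_simp
  have hsum : ∑ s ∈ Finset.Ico 2 a, z ^ (s - 1) ≤ 2 * z := by
    calc ∑ s ∈ Finset.Ico 2 a, z ^ (s - 1) = ∑ i ∈ Finset.range (a - 2), z * z ^ i := by
          rw [Finset.sum_Ico_eq_sum_range]
          refine Finset.sum_congr rfl fun i _ => ?_
          rw [← pow_succ']
          congr 1
          omega
      _ = z * ∑ i ∈ Finset.range (a - 2), z ^ i := by rw [Finset.mul_sum]
      _ ≤ z * ∑ i ∈ Finset.range (a - 2), (1 / 2 : ℝ) ^ i := by gcongr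
      _ ≤ z * 2 := by
        gcongr
        exact sum_geometric_two_le _
      _ = 2 * z := mul_comm _ _
  exact (Finset.sum_le_sum hterm).trans hsum

/-! ### The choice of parameters -/

/-- The number of vertices set aside for repairing the in-degree zero vertices. -/
noncomputable def reserveSize (n : ℕ) : ℕ := ⌊n / Real.log n ^ 2⌋₊

/-- The size below which vertex sets are treated by the first moment method. -/
noncomputable def smallSize (n : ℕ) : ℕ := ⌈n / √(Real.log (Real.log n))⌉₊

/-- The number of colours left unmatched. -/
noncomputable def spareSize (n : ℕ) : ℕ := ⌈20 * eps n * n⌉₊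

/-- The probability that a given edge is present with a given colour. -/
noncomputable def pairProb (c : ℝ) (n : ℕ) : ℝ := edgeProb c n / numColours n

theorem eventually_reserveSize_le :
    ∀ᶠ n : ℕ in atTop, (reserveSize n : ℝ) ≤ n / Real.log n ^ 2 :=
  .of_forall fun n => Nat.floor_le (by positivity)

theorem le_reserveSize_add_one (n : ℕ) : n / Real.log n ^ 2 ≤ reserveSize n + 1 :=
  (Nat.lt_floor_add_one _).le

theorem tendsto_log_mul_reserveSize (c : ℝ) :
    Tendsto (fun n : ℕ => (Real.log n + c) * (reserveSize n / n)) atTop (nhds 0) := by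
  have h : Tendsto (fun n : ℕ => 2 * (Real.log n)⁻¹) atTop (nhds 0) := by
    simpa using (tendsto_inv_atTop_zero.comp tendsto_log_natCast).const_mul 2
  refine squeeze_zero' ?_ ?_ h
  · filter_upwards [eventually_log_add_mem c] with n h1
    have : 0 ≤ Real.log n + c := by linarith
    positivity
  filter_upwards [eventually_log_add_mem c, eventually_gt_atTop 0,
    tendsto_log_natCast.eventually_gt_atTop 0, eventually_reserveSize_le] with n h1 hn h2 h3
  have hn' : (0 : ℝ) < n := by exact_mod_cast hn
  calc (Real.log n + c) * (reserveSize n / n) ≤ 2 * Real.log n * (n / Real.log n ^ 2 / n) := by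
        gcongr
        exact h1.2
    _ = _ := by field_simp

theorem eventually_reserveSize_mul_le {δ : ℝ} (hδ : 0 < δ) :
    ∀ᶠ n : ℕ in atTop, (reserveSize n : ℝ) ≤ δ * n := by
  filter_upwards [(tendsto_log_mul_reserveSize 0).eventually_le_const hδ,
    tendsto_log_natCast.eventually_ge_atTop 1, eventually_gt_atTop 0] with n h1 h2 hn
  have hn' : (0 : ℝ) < n := by exact_mod_cast hn
  rw [add_zero] at h1
  rw [← div_le_iff₀ hn']
  nlinarith [show (0 : ℝ) ≤ reserveSize n / n by positivity]

theorem tendsto_smallSize_div :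
    Tendsto (fun n : ℕ => (smallSize n : ℝ) / n) atTop (nhds 0) := by
  have h : Tendsto (fun n : ℕ => (√(Real.log (Real.log n)))⁻¹ + (n : ℝ)⁻¹) atTop (nhds 0) := by
    have h1 : Tendsto (fun n : ℕ => √(Real.log (Real.log n))) atTop atTop :=
      Real.tendsto_sqrt_atTop.comp (Real.tendsto_log_atTop.comp tendsto_log_natCast)
    simpa using (tendsto_inv_atTop_zero.comp h1).add (tendsto_inv_atTop_nhds_zero_nat (𝕜 := ℝ))
  refine squeeze_zero (fun n => by positivity) (fun n => ?_) h
  rcases Nat.eq_zero_or_pos n with rfl | hn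
  · simp
  have hn' : (0 : ℝ) < n := by exact_mod_cast hn
  rw [div_le_iff₀ hn', add_mul, inv_mul_cancel₀ hn'.ne', inv_mul_eq_div]
  exact (Nat.ceil_lt_add_one (by positivity)).le

theorem eventually_smallSize_mul_le {δ : ℝ} (hδ : 0 < δ) :
    ∀ᶠ n : ℕ in atTop, (smallSize n : ℝ) ≤ δ * n := by
  filter_upwards [tendsto_smallSize_div.eventually_le_const hδ, eventually_gt_atTop 0] with n h1 hn
  have hn' : (0 : ℝ) < n := by exact_mod_cast hn
  rwa [div_le_iff₀ hn'] at h1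

theorem eventually_room :
    ∀ᶠ n : ℕ in atTop, n - (2 * reserveSize n + 1) + spareSize n +
      (n - (2 * reserveSize n + 1)) / n.sqrt ≤ numColours n - 2 * reserveSize n := by
  filter_upwards [eventually_numColours_ge, eventually_le_log_log 1, eventually_gt_atTop 0,
    tendsto_log_natCast.eventually_gt_atTop 0, eventually_eps_pos,
    (tendsto_log_pow_div_rpow 1 (s := 1 / 2) (by norm_num)).eventually_le_const one_pos,
    eventually_reserveSize_mul_le (show (0 : ℝ) < 1 / 4 by norm_num), eventually_ge_atTop 2]
    with n h1 h2 hn h3 h4 h5 h6 hn2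
  have hn' : (1 : ℝ) ≤ n := by exact_mod_cast hn
  have hk : 4 * reserveSize n ≤ n := by
    have : (4 * reserveSize n : ℝ) ≤ n := by linarith
    exact_mod_cast this
  have hs1 : 1 ≤ √(n : ℝ) := Real.one_le_sqrt.2 hn'
  have hss : √(n : ℝ) * √(n : ℝ) = n := Real.mul_self_sqrt (by linarith)
  have h7 : √(n : ℝ) ≤ eps n * n := by
    rw [pow_one, ← Real.sqrt_eq_rpow, div_le_one (by linarith)] at h5
    rw [eps, div_mul_eq_mul_div, le_div_iff₀ h3]
    nlinarith
  have h8 : (spareSize n : ℝ) ≤ 20 * eps n * n + 1 := (Nat.ceil_lt_add_one (by positivity)).le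
  have h9 : (n - (2 * reserveSize n + 1)) / n.sqrt ≤ n.sqrt + 2 := by
    refine (Nat.div_le_div_right (Nat.sub_le _ _)).trans (Nat.div_le_of_le_mul ?_)
    have := Nat.sqrt_le_add n
    rw [mul_add]
    omega
  have h10 : (n.sqrt : ℝ) ≤ √n := Real.nat_sqrt_le_real_sqrt
  have h11 : n + spareSize n + (n.sqrt + 2) ≤ numColours n := by
    have : (n : ℝ) + spareSize n + (n.sqrt + 2) ≤ numColours n := by nlinarith
    exact_mod_cast this
  omega

/-! ### Asymptotics of the completion probability -/

theorem one_sub_pow_le_exp {ρ : ℝ} (h1 : ρ ≤ 1) (M : ℕ) :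
    (1 - ρ) ^ M ≤ Real.exp (-(ρ * M)) := by
  calc (1 - ρ) ^ M ≤ Real.exp (-ρ) ^ M :=
        pow_le_pow_left₀ (by linarith) (Real.one_sub_le_exp_neg ρ) M
    _ = _ := by rw [← Real.exp_nat_mul]; congr 1; ring

variable (c : ℝ)

theorem pairProb_mul_numColours {n : ℕ} (hn : 0 < n) (hq : n ≤ numColours n) :
    n * numColours n * pairProb c n = Real.log n + c := by
  have hn' : (n : ℝ) ≠ 0 := by exact_mod_cast hn.ne'
  have hq' : (numColours n : ℝ) ≠ 0 := by exact_mod_cast (hn.trans_le hq).ne'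
  rw [pairProb, edgeProb]
  field_simp

theorem eventually_pairProb_mem :
    ∀ᶠ n : ℕ in atTop, 0 ≤ pairProb c n ∧ pairProb c n ≤ 1 := by
  filter_upwards [eventually_edgeProb_mem c, eventually_gt_atTop 0, eventually_le_numColours]
    with n hp hn hq
  refine ⟨div_nonneg hp.1 (Nat.cast_nonneg _), ?_⟩
  have : (1 : ℝ) ≤ numColours n := by exact_mod_cast hn.trans_le hq
  exact (div_le_self hp.1 this).trans (by linarith [hp.2])

variable {c}

theorem pairProb_mul_ge {n i j : ℕ} (hn : 0 < n) (hq : n ≤ numColours n)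
    (hL : 0 ≤ Real.log n + c) (hi : i ≤ n) (hj : j ≤ numColours n) :
    (Real.log n + c) * (1 - (i + j) / n) ≤
      pairProb c n * ((n - i) * (numColours n - j) : ℕ) := by
  have hn' : (0 : ℝ) < n := by exact_mod_cast hn
  have hnq : (n : ℝ) ≤ numColours n := by exact_mod_cast hq
  have hq' : (0 : ℝ) < numColours n := hn'.trans_le hnq
  have hj' : (j : ℝ) ≤ numColours n := by exact_mod_cast hj
  have h1 : (i : ℝ) / n ≤ 1 := by rw [div_le_one hn']; exact_mod_cast hi
  have h2 : (j : ℝ) / numColours n ≤ j / n := by gcongr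
  have h3 : (0 : ℝ) ≤ i / n := by positivity
  have h4 : (0 : ℝ) ≤ j / numColours n := by positivity
  have h5 : pairProb c n * ((n - i) * (numColours n - j) : ℕ) =
      (Real.log n + c) * ((1 - i / n) * (1 - j / numColours n)) := by
    rw [← pairProb_mul_numColours c hn hq, Nat.cast_mul, Nat.cast_sub hi, Nat.cast_sub hj]
    field_simp
  rw [h5, add_div]
  gcongr
  nlinarith

variable (c)

/-- An upper bound for the probability that a vertex sees no free pair. -/
noncomputable def missBound (n : ℕ) : ℝ :=
  Real.exp (-(Real.log n + c) + 4 * ((Real.log n + c) * (reserveSize n / n)))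

theorem tendsto_mul_missBound :
    Tendsto (fun n : ℕ => n * missBound c n) atTop (nhds (Real.exp (-c))) := by
  have h : Tendsto (fun n : ℕ => Real.exp (-c + 4 * ((Real.log n + c) * (reserveSize n / n))))
      atTop (nhds (Real.exp (-c))) := by
    refine (Real.continuous_exp.tendsto _).comp ?_
    simpa using ((tendsto_log_mul_reserveSize c).const_mul 4).const_add (-c)
  refine h.congr' ?_
  filter_upwards [eventually_gt_atTop 0] with n hn
  have hn' : (0 : ℝ) < n := by exact_mod_cast hn
  nth_rw 3 [← Real.exp_log hn']
  rw [missBound, ← Real.exp_add]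
  congr 1
  ring

theorem eventually_pow_le_missBound :
    ∀ᶠ n : ℕ in atTop, ∀ i, i ≤ 2 * reserveSize n →
      (1 - pairProb c n) ^ ((n - i) * (numColours n - 2 * reserveSize n)) ≤ missBound c n := by
  filter_upwards [eventually_pairProb_mem c, eventually_gt_atTop 0, eventually_le_numColours,
    eventually_log_add_mem c, eventually_reserveSize_mul_le (show (0 : ℝ) < 1 / 4 by norm_num)]
    with n hρ hn hq hL hk i hi
  have hk' : 4 * reserveSize n ≤ n := by
    have : (4 * reserveSize n : ℝ) ≤ n := by linarith
    exact_mod_cast this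
  have hn' : (0 : ℝ) < n := by exact_mod_cast hn
  refine (one_sub_pow_le_exp hρ.2 _).trans (Real.exp_le_exp.2 ?_)
  have h1 := pairProb_mul_ge (c := c) (i := i) (j := 2 * reserveSize n) hn hq (by linarith)
    (by omega) (by omega)
  have h2 : ((i : ℝ) + (2 * reserveSize n : ℕ)) / n ≤ 4 * (reserveSize n / n) := by
    rw [← mul_div_assoc]
    gcongr
    exact_mod_cast (show i + 2 * reserveSize n ≤ 4 * reserveSize n by omega)
  nlinarith [mul_le_mul_of_nonneg_left h2 (show 0 ≤ Real.log n + c by linarith)]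

theorem eventually_violatorBound_le :
    ∀ᶠ n : ℕ in atTop, violatorBound (1 - (1 - pairProb c n) ^ (n - reserveSize n)) (smallSize n)
      (n - (2 * reserveSize n + 1)) (numColours n - 2 * reserveSize n) ≤
      16 * Real.exp 4 * (Real.log n ^ 2 / (n : ℝ) ^ (3 / 4 : ℝ)) := by
  have hz : Tendsto (fun n : ℕ => 8 * Real.exp 4 * (Real.log n ^ 2 / (n : ℝ) ^ (3 / 4 : ℝ))) atTop
      (nhds 0) := by
    simpa using (tendsto_log_pow_div_rpow 2 (s := 3 / 4) (by norm_num)).const_mul (8 * Real.exp 4)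
  filter_upwards [eventually_pairProb_mem c, eventually_gt_atTop 0, eventually_le_numColours,
    eventually_log_add_mem c, eventually_reserveSize_mul_le (show (0 : ℝ) < 1 / 96 by norm_num),
    eventually_smallSize_mul_le (show (0 : ℝ) < 1 / 32 by norm_num), eventually_numColours_le,
    hz.eventually_le_const (show (0 : ℝ) < 1 / 2 by norm_num),
    tendsto_log_natCast.eventually_ge_atTop (-15 * c)]
    with n hρ hn hq hL hk ha hq2 hz hLc
  have hn' : (0 : ℝ) < n := by exact_mod_cast hn
  have hn1 : (1 : ℝ) ≤ n := by exact_mod_cast hn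
  have hka : reserveSize n + (2 * reserveSize n + smallSize n) ≤ n := by
    have : (reserveSize n + (2 * reserveSize n + smallSize n) : ℝ) ≤ n := by linarith
    exact_mod_cast this
  have hL0 : 0 ≤ Real.log n := Real.log_nonneg hn1
  have hb0 : 0 ≤ (1 - pairProb c n) := by linarith [hρ.2]
  have hw6 : Real.exp (Real.log n / 8) ^ 6 = (n : ℝ) ^ (3 / 4 : ℝ) := by
    rw [← Real.exp_nat_mul, Real.rpow_def_of_pos hn']
    congr 1
    push_cast
    ring
  have hzz : 2 * Real.exp 4 * (2 * Real.log n) ^ 2 / Real.exp (Real.log n / 8) ^ 6 =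
      8 * Real.exp 4 * (Real.log n ^ 2 / (n : ℝ) ^ (3 / 4 : ℝ)) := by
    rw [hw6]; ring
  refine (violatorBound_le (l := 2 * Real.log n) (w := Real.exp (Real.log n / 8)) (n := n)
    ?_ ?_ ?_ ?_ ?_ (Nat.sub_le _ _) ?_ ?_ ?_).trans_eq (by rw [hzz]; ring)
  · linarith [pow_le_one₀ hb0 (show 1 - pairProb c n ≤ 1 by linarith [hρ.1])
      (n := n - reserveSize n)]
  · linarith [pow_nonneg hb0 (n - reserveSize n)]
  · exact Real.one_le_exp (by positivity)
  · rw [← Real.exp_nat_mul]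
    push_cast
    rw [mul_div_cancel₀ _ (by norm_num), Real.exp_log hn']
  · have h1 := one_add_mul_le_pow (show -2 ≤ -pairProb c n by linarith [hρ.2])
      (n - reserveSize n)
    rw [← sub_eq_add_neg] at h1
    have h2 : ((n - reserveSize n : ℕ) : ℝ) ≤ n := by exact_mod_cast Nat.sub_le _ _
    have h3 := mul_le_mul_of_nonneg_right h2 hρ.1
    refine (show _ ≤ n * pairProb c n by linarith).trans ?_
    rw [le_div_iff₀ hn']
    have h4 := pairProb_mul_numColours c hn hq
    have h5 : (n : ℝ) ≤ numColours n := by exact_mod_cast hq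
    nlinarith [mul_le_mul_of_nonneg_left h5 (mul_nonneg hn'.le hρ.1), hL.2]
  · have : numColours n ≤ 2 * n := by exact_mod_cast hq2
    omega
  · rw [sub_sub_cancel, ← pow_mul, ← Real.exp_nat_mul, one_div, ← Real.exp_neg, Nat.sub_sub]
    refine (one_sub_pow_le_exp hρ.2 _).trans (Real.exp_le_exp.2 (neg_le_neg ?_))
    refine le_trans ?_ (pairProb_mul_ge hn hq (by linarith) (by omega) (by omega))
    have h1 : ((reserveSize n : ℝ) + (2 * reserveSize n + smallSize n : ℕ)) / n ≤ 1 / 16 := by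
      rw [div_le_iff₀ hn']
      push_cast
      linarith
    push_cast at h1 ⊢
    nlinarith [mul_le_mul_of_nonneg_left h1 (show 0 ≤ Real.log n + c by linarith)]
  · exact hzz.trans_le hz

theorem eventually_expansion_le :
    ∀ᶠ n : ℕ in atTop, (2 : ℝ) ^ (n - (2 * reserveSize n + 1)) *
      2 ^ (numColours n - 2 * reserveSize n) *
      ((1 - pairProb c n) ^ (n - reserveSize n)) ^ (smallSize n * spareSize n) ≤
      Real.exp (-n) := by
  filter_upwards [eventually_pairProb_mem c, eventually_gt_atTop 0, eventually_le_numColours,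
    eventually_log_add_mem c, eventually_reserveSize_mul_le (show (0 : ℝ) < 1 / 4 by norm_num),
    eventually_numColours_le, tendsto_log_natCast.eventually_ge_atTop (-4 * c),
    eventually_le_log_log 1, tendsto_log_natCast.eventually_gt_atTop 0]
    with n hρ hn hq hL hk hq2 hLc hll hL0
  have hn' : (0 : ℝ) < n := by exact_mod_cast hn
  have hq0 : (0 : ℝ) < numColours n := by exact_mod_cast hn.trans_le hq
  have hkn : reserveSize n ≤ n := by
    have : (reserveSize n : ℝ) ≤ n := by linarith
    exact_mod_cast this
  have hρn : Real.log n / (4 * n) ≤ pairProb c n * (n - reserveSize n : ℕ) := by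
    have h1 : pairProb c n = (Real.log n + c) / (n * numColours n) := by
      rw [eq_div_iff (by positivity), ← pairProb_mul_numColours c hn hq, mul_comm]
    have h2 : (3 / 4 * n : ℝ) ≤ (n - reserveSize n : ℕ) := by
      rw [Nat.cast_sub hkn]; linarith
    calc Real.log n / (4 * n) ≤ 3 / 4 * Real.log n / (n * (2 * n)) * (3 / 4 * n) := by
          rw [div_mul_eq_mul_div, div_le_div_iff₀ (by positivity) (by positivity)]
          nlinarith [mul_pos hL0 (mul_pos hn' hn')]
      _ ≤ _ := by
        rw [h1]
        gcongr
        · linarith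
        · linarith
        · linarith
  have hab : 20 * √(Real.log (Real.log n)) * n ^ 2 / Real.log n ≤ smallSize n * spareSize n := by
    have hs : 0 < √(Real.log (Real.log n)) := Real.sqrt_pos.2 (by linarith)
    have hss : √(Real.log (Real.log n)) * √(Real.log (Real.log n)) = Real.log (Real.log n) :=
      Real.mul_self_sqrt (by linarith)
    have h1 : n / √(Real.log (Real.log n)) ≤ smallSize n := Nat.le_ceil _
    have h2 : 20 * eps n * n ≤ spareSize n := Nat.le_ceil _
    have h3 : 0 ≤ eps n := div_nonneg (by linarith) hL0.le
    refine le_trans (le_of_eq ?_) (mul_le_mul h1 h2 (by positivity) (by positivity))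
    rw [eps]
    nth_rw 3 [← hss]
    field_simp
  have hs1 : 1 ≤ √(Real.log (Real.log n)) := Real.one_le_sqrt.2 hll
  have hexp : 5 * n ≤ pairProb c n * ((n - reserveSize n) * (smallSize n * spareSize n) : ℕ) := by
    rw [Nat.cast_mul, Nat.cast_mul, ← mul_assoc]
    refine le_trans ?_ (mul_le_mul hρn hab (by positivity) (mul_nonneg hρ.1 (Nat.cast_nonneg _)))
    have : Real.log n / (4 * n) * (20 * √(Real.log (Real.log n)) * n ^ 2 / Real.log n) =
        5 * √(Real.log (Real.log n)) * n := by field_simp; norm_num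
    rw [this]
    nlinarith
  have h2e : ∀ j : ℕ, (2 : ℝ) ^ j ≤ Real.exp j := fun j => by
    rw [← mul_one (j : ℝ), Real.exp_nat_mul]
    have := Real.add_one_le_exp (1 : ℝ)
    exact pow_le_pow_left₀ (by norm_num) (by linarith) j
  rw [← pow_mul]
  calc _ ≤ Real.exp (n - (2 * reserveSize n + 1) : ℕ) *
        Real.exp (numColours n - 2 * reserveSize n : ℕ) * Real.exp (-(5 * n)) := by
        gcongr
        · exact pow_nonneg (by linarith [hρ.2]) _
        · exact h2e _
        · exact h2e _
        · exact (one_sub_pow_le_exp hρ.2 _).trans (Real.exp_le_exp.2 (neg_le_neg hexp))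
    _ ≤ Real.exp n * Real.exp (2 * n) * Real.exp (-(5 * n)) := by
        gcongr
        · exact Nat.sub_le _ _
        · exact le_trans (by exact_mod_cast Nat.sub_le _ _) hq2
    _ ≤ _ := by
        rw [← Real.exp_add, ← Real.exp_add]
        gcongr
        linarith

theorem eventually_remainder_le :
    ∀ᶠ n : ℕ in atTop,
      ((smallSize n : ℝ) / ((n - reserveSize n : ℕ) - smallSize n) +
        (n - (2 * reserveSize n + 1) : ℕ) * n.sqrt / (reserveSize n + 1) ^ 2 +
        ((n - (2 * reserveSize n + 1) : ℕ) * ((n - reserveSize n : ℕ) / (reserveSize n + 1) ^ 2) /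
          (n : ℝ) ^ (1 / 4 : ℝ) + ((n : ℝ) ^ (1 / 4 : ℝ)) ^ 2 / (n - reserveSize n : ℕ))) ≤
      2 * (smallSize n / n) + Real.log n ^ 4 / (n : ℝ) ^ (1 / 2 : ℝ) +
        (Real.log n ^ 4 / (n : ℝ) ^ (1 / 4 : ℝ) +
          2 * (Real.log n ^ 0 / (n : ℝ) ^ (1 / 2 : ℝ))) := by
  filter_upwards [eventually_gt_atTop 0,
    eventually_reserveSize_mul_le (show (0 : ℝ) < 1 / 4 by norm_num),
    eventually_smallSize_mul_le (show (0 : ℝ) < 1 / 4 by norm_num),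
    tendsto_log_natCast.eventually_gt_atTop 0] with n hn hk ha hL0
  have hn' : (0 : ℝ) < n := by exact_mod_cast hn
  have hkn : reserveSize n ≤ n := by
    have : (reserveSize n : ℝ) ≤ n := by linarith
    exact_mod_cast this
  have hd : ((n - reserveSize n : ℕ) : ℝ) = n - reserveSize n := Nat.cast_sub hkn
  have hd' : ((n - reserveSize n : ℕ) : ℝ) ≤ n := by exact_mod_cast Nat.sub_le _ _
  have hy : ((n - (2 * reserveSize n + 1) : ℕ) : ℝ) ≤ n := by exact_mod_cast Nat.sub_le _ _
  have hh : (n : ℝ) ^ (1 / 2 : ℝ) * (n : ℝ) ^ (1 / 2 : ℝ) = n := by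
    rw [← Real.rpow_add hn']; norm_num
  have hh0 : 0 < (n : ℝ) ^ (1 / 2 : ℝ) := Real.rpow_pos_of_pos hn' _
  have hk1 := le_reserveSize_add_one n
  refine add_le_add (add_le_add ?_ ?_) (add_le_add ?_ ?_)
  · calc (smallSize n : ℝ) / ((n - reserveSize n : ℕ) - smallSize n) ≤ smallSize n / (n / 2) := by
          gcongr
          linarith
      _ = _ := by field_simp
  · have hs : (n.sqrt : ℝ) ≤ (n : ℝ) ^ (1 / 2 : ℝ) := by
      rw [← Real.sqrt_eq_rpow]
      exact Real.nat_sqrt_le_real_sqrt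
    calc _ ≤ n * (n : ℝ) ^ (1 / 2 : ℝ) / (n / Real.log n ^ 2) ^ 2 := by gcongr
      _ = Real.log n ^ 4 / (n : ℝ) ^ (1 / 2 : ℝ) := by
        field_simp
        rw [sq, hh]
  · calc _ ≤ n * (n / (n / Real.log n ^ 2) ^ 2) / (n : ℝ) ^ (1 / 4 : ℝ) := by gcongr
      _ = _ := by field_simp
  · calc _ ≤ ((n : ℝ) ^ (1 / 4 : ℝ)) ^ 2 / (n / 2) := by
          gcongr
          linarith
      _ = _ := by
        rw [← Real.rpow_natCast, ← Real.rpow_mul hn'.le,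
          show (1 / 4 : ℝ) * (2 : ℕ) = 1 / 2 by norm_num, pow_zero]
        field_simp
        rw [sq, hh]

/-- The completion probability of the construction for the chosen parameters. -/
noncomputable def completionProb (n : ℕ) : ℝ :=
  completionBound (pairProb c n) ((n : ℝ) ^ (1 / 4 : ℝ)) n (numColours n) (reserveSize n)
    (smallSize n) (spareSize n) n.sqrt

theorem exists_tendsto_le_completionProb :
    ∃ g : ℕ → ℝ, Tendsto g atTop (nhds (Real.exp (-Real.exp (-c)))) ∧
      ∀ᶠ n in atTop, g n ≤ completionProb c n := by
  refine ⟨fun n => (1 - missBound c n) ^ n -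
    16 * Real.exp 4 * (Real.log n ^ 2 / (n : ℝ) ^ (3 / 4 : ℝ)) - Real.exp (-n) -
    (2 * (smallSize n / n) + Real.log n ^ 4 / (n : ℝ) ^ (1 / 2 : ℝ) +
        (Real.log n ^ 4 / (n : ℝ) ^ (1 / 4 : ℝ) +
          2 * (Real.log n ^ 0 / (n : ℝ) ^ (1 / 2 : ℝ)))), ?_, ?_⟩
  · have h1 := tendsto_one_sub_pow (tendsto_mul_missBound c)
    have h2 := (tendsto_log_pow_div_rpow 2 (s := 3 / 4) (by norm_num)).const_mul (16 * Real.exp 4)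
    have h3 : Tendsto (fun n : ℕ => Real.exp (-n)) atTop (nhds 0) :=
      (Real.tendsto_exp_neg_atTop_nhds_zero).comp tendsto_natCast_atTop_atTop
    have h4 := tendsto_smallSize_div.const_mul 2
    have h5 := tendsto_log_pow_div_rpow 4 (s := 1 / 2) (by norm_num)
    have h6 := tendsto_log_pow_div_rpow 4 (s := 1 / 4) (by norm_num)
    have h7 := (tendsto_log_pow_div_rpow 0 (s := 1 / 2) (by norm_num)).const_mul 2
    simpa using ((h1.sub h2).sub h3).sub ((h4.add h5).add (h6.add h7))
  · filter_upwards [eventually_violatorBound_le c, eventually_expansion_le c,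
      eventually_remainder_le, eventually_pow_le_missBound c, eventually_pairProb_mem c,
      (tendsto_zero_of_tendsto_mul (tendsto_mul_missBound c)).eventually_le_const one_pos]
      with n h1 h2 h3 h4 hρ h5
    unfold completionProb completionBound
    refine sub_le_sub (sub_le_sub (sub_le_sub ?_ h1) h2) h3
    have h6 := h4 (reserveSize n) (by omega)
    rw [pow_mul] at h6
    have h7 : 0 ≤ ((1 - pairProb c n) ^ (n - reserveSize n)) ^
        (numColours n - 2 * reserveSize n) :=
      pow_nonneg (pow_nonneg (by linarith [hρ.2]) _) _
    calc (1 - missBound c n) ^ n ≤ (1 - ((1 - pairProb c n) ^ (n - reserveSize n)) ^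
          (numColours n - 2 * reserveSize n)) ^ n :=
          pow_le_pow_left₀ (by linarith) (by linarith) n
      _ ≤ _ := pow_le_pow_of_le_one (by linarith) (by linarith) (Nat.sub_le _ _)

/-! ### The limiting probability -/

/-- An upper bound for the failure probability of a single repair step. -/
noncomputable def repairError (c : ℝ) (n : ℕ) : ℝ := (1 + (Real.log n + c)) * missBound c n

theorem tendsto_repairError (c : ℝ) : Tendsto (repairError c) atTop (nhds 0) := by
  have h := (tendsto_edgeProb (1 + c)).mul (tendsto_mul_missBound c)
  rw [zero_mul] at h
  refine h.congr' ?_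
  filter_upwards [eventually_gt_atTop 0] with n hn
  have hn' : (n : ℝ) ≠ 0 := by exact_mod_cast hn.ne'
  rw [edgeProb, repairError]
  field_simp
  ring

theorem tendsto_reserveSize_mul_repairError (c : ℝ) :
    Tendsto (fun n => reserveSize n * repairError c n) atTop (nhds 0) := by
  have h := (tendsto_log_mul_reserveSize (1 + c)).mul (tendsto_mul_missBound c)
  rw [zero_mul] at h
  refine h.congr' ?_
  filter_upwards [eventually_gt_atTop 0] with n hn
  have hn' : (n : ℝ) ≠ 0 := by exact_mod_cast hn.ne'
  rw [repairError]
  field_simp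
  ring

theorem exists_tendsto_le_rootedGood (c : ℝ) :
    ∃ g : ℕ → ℝ, Tendsto g atTop (nhds (Real.exp (-Real.exp (-c)))) ∧
      ∀ᶠ n in atTop, ∀ u, g n ≤ pr (prodWeight fun _ : DEdge n => edgeLaw (Colour n) (edgeProb c n))
        (fun x => RootedGood x u) := by
  obtain ⟨g, hg, hgle⟩ := exists_tendsto_le_completionProb c
  refine ⟨fun n => (1 - reserveSize n * repairError c n) * g n, ?_, ?_⟩
  · simpa using ((tendsto_reserveSize_mul_repairError c).const_sub 1).mul hg
  filter_upwards [hgle, hg.eventually_const_lt (Real.exp_pos _), eventually_edgeProb_mem c,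
    eventually_pairProb_mem c, eventually_gt_atTop 0, eventually_le_numColours,
    eventually_pow_le_missBound c, (tendsto_repairError c).eventually_le_const one_pos,
    eventually_room, eventually_log_add_mem c,
    eventually_reserveSize_mul_le (show (0 : ℝ) < 1 / 4 by norm_num),
    eventually_smallSize_mul_le (show (0 : ℝ) < 1 / 4 by norm_num), eventually_ge_atTop 2]
    with n h1 h2 hp hρ hn hq hmiss hη hroom hL hk ha hn2 u
  have hn' : (0 : ℝ) < n := by exact_mod_cast hn
  have : NeZero (numColours n) := ⟨(hn.trans_le hq).ne'⟩
  have hq0 : (numColours n : ℝ) ≠ 0 := by exact_mod_cast (hn.trans_le hq).ne'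
  have hk4 : 4 * reserveSize n ≤ n := by
    have : (4 * reserveSize n : ℝ) ≤ n := by linarith
    exact_mod_cast this
  have hak : smallSize n + reserveSize n < n := by
    have : (smallSize n + reserveSize n : ℝ) < n := by linarith
    exact_mod_cast this
  have hηle : (1 + n * numColours n * pairProb c n) * (1 - pairProb c n) ^
      ((n - 2 * reserveSize n) * (numColours n - 2 * reserveSize n)) ≤ repairError c n := by
    rw [pairProb_mul_numColours c hn hq, repairError]
    exact mul_le_mul_of_nonneg_left (hmiss _ le_rfl) (by linarith)
  have hpos : 0 ≤ completionProb c n := h2.le.trans h1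
  refine le_trans ?_ (pr_rootedGood_ge (W := Colour n) hp.1 (by linarith [hp.2]) hρ.1 hρ.2
    (le_of_eq ?_) u)
  · refine le_trans ?_ (goodProb_root_ge hρ.1 hρ.2 (Fintype.card_fin n)
      (Fintype.card_fin (numColours n)) (by omega) hak (Real.rpow_pos_of_pos hn' (1 / 4))
      (Nat.sqrt_pos.2 hn) hroom (hηle.trans hη) hpos u)
    have h3 := one_add_mul_le_pow (show -2 ≤ -repairError c n by linarith) (reserveSize n)
    rw [← sub_eq_add_neg, mul_neg, ← sub_eq_add_neg] at h3
    calc _ ≤ (1 - repairError c n) ^ reserveSize n * completionProb c n :=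
          mul_le_mul h3 h1 h2.le (pow_nonneg (by linarith) _)
      _ ≤ _ := mul_le_mul_of_nonneg_right
          (pow_le_pow_left₀ (by linarith) (by linarith) _) hpos
  · rw [Fintype.card_fin, pairProb, div_mul_cancel₀ _ hq0]

theorem eventually_lt_prob_rEvent {c b : ℝ} (hb : b < limitProb c) :
    ∀ᶠ n : ℕ in atTop, b < prob (fun ω : SampleSpace n =>
      REvent ω ⌊(n : ℝ) * (Real.log n + c)⌋₊) := by
  obtain ⟨δ, hδ, hδb⟩ : ∃ δ > 0, b < limitProb (c - 2 * δ) := by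
    have h : Tendsto (fun δ : ℝ => limitProb (c - 2 * δ)) (nhdsWithin 0 (Set.Ioi 0))
        (nhds (limitProb c)) := by
      have : Continuous fun δ : ℝ => limitProb (c - 2 * δ) :=
        continuous_limitProb.comp (by fun_prop)
      simpa using (this.tendsto 0).mono_left nhdsWithin_le_nhds
    exact ((h.eventually_const_lt hb).and self_mem_nhdsWithin).exists.imp fun δ h => ⟨h.2, h.1⟩
  obtain ⟨g, hg, hgle⟩ := exists_tendsto_le_rootedGood (c - 2 * δ)
  have hx := tendsto_mul_one_sub_edgeProb_pow (c - 2 * δ)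
  have hlim := (hg.mul ((hx.sub (tendsto_zero_of_tendsto_mul hx)).const_add 1)).sub
    (tendsto_transfer_error (c - 2 * δ) hδ)
  rw [sub_zero, sub_zero, mul_comm (Real.exp _)] at hlim
  filter_upwards [hlim.eventually_const_lt hδb, hgle, eventually_floor_add_one_ge (c := c) hδ,
    eventually_edgeProb_mem (c - 2 * δ), eventually_gt_atTop 0, eventually_le_numColours]
    with n h1 h2 h3 hp hn hq
  have : NeZero (numColours n) := ⟨(hn.trans_le hq).ne'⟩
  have hn' : (0 : ℝ) < n := by exact_mod_cast hn
  have h4 := pr_hasRainbow_ge (W := Colour n) hp.1 (by linarith [hp.2]) hn h2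
  have h5 := pr_edgeLaw_le_prob (Q := fun x : DEdge n → Bool × Colour n => HasRainbow x)
    hp.1 (by linarith [hp.2]) (fun f g c h => hasRainbow_mono h) (by positivity) h3
  simp only [rEvent_iff]
  rw [sub_one_mul] at h4
  linarith

end RainbowArborescence

/-- For `m = ⌊n (log n + c)⌋`, the probability that `D(n,m)` contains
a rainbow spanning arborescence converges to `(1 + e^{-c}) e^{-e^{-c}}`. -/
theorem prob_rainbow_arborescence_limit (c : ℝ) :
    Tendsto
      (fun n : ℕ => prob (fun ω : SampleSpace n =>
        REvent ω ⌊(n : ℝ) * (Real.log n + c)⌋₊))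
      atTop (nhds ((1 + Real.exp (-c)) * Real.exp (-Real.exp (-c)))) :=
  tendsto_order.2 ⟨fun _ hb => RainbowArborescence.eventually_lt_prob_rEvent hb,
    fun _ hb => RainbowArborescence.eventually_prob_rEvent_le hb⟩
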